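/- Let t ≥ 4 and 2 ≤ s ≤ t, and let β = ⌊(t+1)/(s+1)⌋. There exists n₀ such that for all n ≥ n₀ the following holds: with G⋆ and K as in the extremal setup, if H is a connected component of G⋆ − K with exactly t+2 vertices, then β ≤ 2; moreover, H is isomorphic to S^1(\overline{H_{s,t}}) if β = 2, and H is isomorphic to the complement \overline{H⋆} of the Petersen graph (so that t = 8) if β = 1. -/

import Mathlib

open SimpleGraph

/-- `H` is a minor of `G` (branch-set definition). -/
def MinorOf {α β : Type} (H : SimpleGraph α) (G : SimpleGraph β) : Prop :=
  ∃ φ : α → Set β,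
    (∀ a, (G.induce (φ a)).Connected) ∧
    (Pairwise fun a b => Disjoint (φ a) (φ b)) ∧
    (∀ a b, H.Adj a b → ∃ x ∈ φ a, ∃ y ∈ φ b, G.Adj x y)

/-- Adjacency matrix over ℝ. -/
noncomputable def adjMat {V : Type} [Fintype V] (G : SimpleGraph V) : Matrix V V ℝ :=
  letI := Classical.decRel G.Adj
  SimpleGraph.adjMatrix ℝ G

theorem adjMat_herm {V : Type} [Fintype V] (G : SimpleGraph V) : (adjMat G).IsHermitian := by
  letI := Classical.decRel G.Adj
  ext i j
  simp [adjMat, Matrix.conjTranspose_apply, SimpleGraph.adjMatrix_apply, SimpleGraph.adj_comm]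

/-- Spectral radius = largest adjacency eigenvalue. -/
noncomputable def specRad {V : Type} [Fintype V] [DecidableEq V] (G : SimpleGraph V) : ℝ :=
  ⨆ i, (adjMat_herm G).eigenvalues i

/-- degree -/
noncomputable def deg {V : Type} (G : SimpleGraph V) (v : V) : ℕ := (G.neighborSet v).ncard

/-- number of edges -/
noncomputable def ecard {V : Type} (G : SimpleGraph V) : ℕ := G.edgeSet.ncard

/-- k disjoint copies of G -/
def copies (k : ℕ) {V : Type} (G : SimpleGraph V) : SimpleGraph (Fin k × V) :=
  SimpleGraph.fromRel fun x y => x.1 = y.1 ∧ G.Adj x.2 y.2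

/-- disjoint union -/
def gUnion {V W : Type} (G : SimpleGraph V) (H : SimpleGraph W) : SimpleGraph (V ⊕ W) :=
  SimpleGraph.fromRel fun x y =>
    (∃ a b, x = Sum.inl a ∧ y = Sum.inl b ∧ G.Adj a b) ∨
    (∃ a b, x = Sum.inr a ∧ y = Sum.inr b ∧ H.Adj a b)

/-- join -/
def gJoin {V W : Type} (G : SimpleGraph V) (H : SimpleGraph W) : SimpleGraph (V ⊕ W) :=
  SimpleGraph.fromRel fun x y =>
    (∃ a b, x = Sum.inl a ∧ y = Sum.inl b ∧ G.Adj a b) ∨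
    (∃ a b, x = Sum.inr a ∧ y = Sum.inr b ∧ H.Adj a b) ∨
    (∃ a b, x = Sum.inl a ∧ y = Sum.inr b)

/-- Petersen graph (Kneser graph K(5,2)). -/
def petersen : SimpleGraph {s : Finset (Fin 5) // s.card = 2} :=
  SimpleGraph.fromRel fun a b => Disjoint a.1 b.1

/-- star K_{1,m} -/
def starG (m : ℕ) : SimpleGraph (Fin 1 ⊕ Fin m) := completeBipartiteGraph (Fin 1) (Fin m)

/-- the star forest H_{s,t} -/
def Hst (s t : ℕ) :
    SimpleGraph ((Fin ((t+1)/(s+1) - 1) × (Fin 1 ⊕ Fin s)) ⊕ (Fin 1 ⊕ Fin (t - ((t+1)/(s+1) - 1) * (s+1)))) :=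
  gUnion (copies ((t+1)/(s+1) - 1) (starG s)) (starG (t - ((t+1)/(s+1) - 1) * (s+1)))

/-- subdivide the edge uv of G by a path through k new vertices -/
def subdividePath {V : Type} (G : SimpleGraph V) (u v : V) (k : ℕ) : SimpleGraph (V ⊕ Fin k) :=
  SimpleGraph.fromRel fun x y =>
    (∃ a b, x = Sum.inl a ∧ y = Sum.inl b ∧ G.Adj a b ∧ ¬(a = u ∧ b = v) ∧ ¬(a = v ∧ b = u)) ∨
    (∃ i : Fin k, x = Sum.inl u ∧ y = Sum.inr i ∧ (i : ℕ) = 0) ∨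
    (∃ i j : Fin k, x = Sum.inr i ∧ y = Sum.inr j ∧ (j : ℕ) = (i : ℕ) + 1) ∨
    (∃ i : Fin k, x = Sum.inr i ∧ y = Sum.inl v ∧ (i : ℕ) = k - 1)

/-- (s,t)-property -/
def HasSTProp (s t : ℕ) {V : Type} (G : SimpleGraph V) : Prop :=
  ∀ a b : ℕ, 1 ≤ a → 1 ≤ b → a + b = t + 1 → a ≤ min s ((t+1)/2) →
    ¬ MinorOf (completeBipartiteGraph (Fin a) (Fin b)) G

/-- H_{a,b,c} -/
def Habc (a b c : ℕ) : SimpleGraph (Fin 3 ⊕ (Fin a ⊕ Fin b ⊕ Fin c)) :=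
  SimpleGraph.fromRel fun x y =>
    (x = Sum.inl 0 ∧ y = Sum.inl 1) ∨
    (x = Sum.inl 0 ∧ ∃ i : Fin a, y = Sum.inr (Sum.inl i)) ∨
    (x = Sum.inl 0 ∧ ∃ i : Fin b, y = Sum.inr (Sum.inr (Sum.inl i))) ∨
    (x = Sum.inl 1 ∧ ∃ i : Fin a, y = Sum.inr (Sum.inl i)) ∨
    (x = Sum.inl 1 ∧ ∃ i : Fin c, y = Sum.inr (Sum.inr (Sum.inr i))) ∨
    (x = Sum.inl 2 ∧ ∃ i : Fin b, y = Sum.inr (Sum.inr (Sum.inl i))) ∨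
    (x = Sum.inl 2 ∧ ∃ i : Fin c, y = Sum.inr (Sum.inr (Sum.inr i)))

noncomputable def edgeDegSum {V : Type} (G H : SimpleGraph V) : ℕ :=
  ∑ᶠ e ∈ G.edgeSet, Sym2.lift ⟨fun u v => deg H u + deg H v, fun u v => by dsimp; ring⟩ e

open SimpleGraph

namespace CT

/-- Model of a complete bipartite minor inside the vertex set `W`. -/
def Bip {V : Type} (G : SimpleGraph V) (W : Set V) (a b : ℕ) : Prop :=
  ∃ φ : Fin a ⊕ Fin b → Set V, (∀ i, φ i ⊆ W) ∧ (∀ i, (G.induce (φ i)).Connected) ∧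
    (Pairwise fun i j => Disjoint (φ i) (φ j)) ∧
    ∀ i j, ∃ x ∈ φ (Sum.inl i), ∃ y ∈ φ (Sum.inr j), G.Adj x y

theorem bip_of_types {V α β : Type} [Fintype α] [Fintype β] (G : SimpleGraph V) (W : Set V)
    (φ : α ⊕ β → Set V) (h1 : ∀ i, φ i ⊆ W) (h2 : ∀ i, (G.induce (φ i)).Connected)
    (h3 : Pairwise fun i j => Disjoint (φ i) (φ j))
    (h4 : ∀ i j, ∃ x ∈ φ (Sum.inl i), ∃ y ∈ φ (Sum.inr j), G.Adj x y) (a b : ℕ)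
    (ha : a ≤ Fintype.card α) (hb : b ≤ Fintype.card β) : Bip G W a b := by
  classical
  let f : Fin a → α := fun i => (Fintype.equivFin α).symm (Fin.castLE ha i)
  let g : Fin b → β := fun i => (Fintype.equivFin β).symm (Fin.castLE hb i)
  have hf : Function.Injective f := (Fintype.equivFin α).symm.injective.comp (Fin.castLE_injective ha)
  have hg : Function.Injective g := (Fintype.equivFin β).symm.injective.comp (Fin.castLE_injective hb)
  refine ⟨fun i => φ (Sum.map f g i), fun i => h1 _, fun i => h2 _, ?_, fun i j => h4 _ _⟩
  intro i j hij
  exact h3 (fun h => hij ((hf.sumMap hg) h))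

theorem induce_connected_mono {V : Type} {G G' : SimpleGraph V} {S : Set V}
    (h : ∀ u ∈ S, ∀ v ∈ S, G.Adj u v → G'.Adj u v) (hc : (G.induce S).Connected) :
    (G'.induce S).Connected := by
  refine hc.mono ?_
  intro u v huv
  exact h u u.2 v v.2 huv

theorem bip_mono {V : Type} {G G' : SimpleGraph V} {W W' : Set V} (hW : W ⊆ W')
    (h : ∀ u ∈ W, ∀ v ∈ W, G.Adj u v → G'.Adj u v) {a b : ℕ} (hb : Bip G W a b) :
    Bip G' W' a b := by
  obtain ⟨φ, h1, h2, h3, h4⟩ := hb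
  refine ⟨φ, fun i => (h1 i).trans hW, fun i => induce_connected_mono
    (fun u hu v hv => h u (h1 i hu) v (h1 i hv)) (h2 i), h3, ?_⟩
  intro i j
  obtain ⟨x, hx, y, hy, hxy⟩ := h4 i j
  exact ⟨x, hx, y, hy, h x (h1 _ hx) y (h1 _ hy) hxy⟩

theorem bip_map {V V' : Type} {G : SimpleGraph V} {G' : SimpleGraph V'} (f : V → V')
    (hf : Function.Injective f) (hG : ∀ u v, G.Adj u v → G'.Adj (f u) (f v)) {W' : Set V'}
    (hW : ∀ u, f u ∈ W') {a b : ℕ} (hb : Bip G Set.univ a b) : Bip G' W' a b := by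
  obtain ⟨φ, h1, h2, h3, h4⟩ := hb
  refine ⟨fun i => f '' φ i, ?_, ?_, ?_, ?_⟩
  · rintro i _ ⟨u, hu, rfl⟩
    exact hW u
  · intro i
    refine (h2 i).map (f := ⟨fun u => ⟨f u.1, u.1, u.2, rfl⟩, ?_⟩) ?_
    · intro u v huv
      exact hG _ _ huv
    · rintro ⟨_, u, hu, rfl⟩
      exact ⟨⟨u, hu⟩, rfl⟩
  · intro i j hij
    exact (Set.disjoint_image_iff hf).2 (h3 hij)
  · intro i j
    obtain ⟨x, hx, y, hy, hxy⟩ := h4 i j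
    exact ⟨f x, ⟨x, hx, rfl⟩, f y, ⟨y, hy, rfl⟩, hG _ _ hxy⟩

theorem const_of_connected {V ι : Type} {G : SimpleGraph V} {S W : Set V} (f : V → ι)
    (hf : ∀ u ∈ W, ∀ v ∈ W, G.Adj u v → f u = f v) (hS : S ⊆ W)
    (hc : (G.induce S).Connected) : ∀ u ∈ S, ∀ v ∈ S, f u = f v := by
  intro u hu v hv
  obtain ⟨p⟩ := hc.preconnected ⟨u, hu⟩ ⟨v, hv⟩
  have key : ∀ (a b : S), (G.induce S).Walk a b → f a = f b := by
    intro a b p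
    induction p with
    | nil => rfl
    | cons h p ih => exact (hf _ (hS (Subtype.property _)) _ (hS (Subtype.property _)) h).trans ih
  exact key _ _ p

theorem bip_fiber {V ι : Type} {G : SimpleGraph V} {W : Set V} (f : V → ι)
    (hf : ∀ u ∈ W, ∀ v ∈ W, G.Adj u v → f u = f v) {a b : ℕ} (ha : 1 ≤ a) (hb : 1 ≤ b)
    (h : Bip G W a b) : ∃ i, Bip G (W ∩ f ⁻¹' {i}) a b := by
  obtain ⟨φ, h1, h2, h3, h4⟩ := h
  have hc := fun k => const_of_connected f hf (h1 k) (h2 k)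
  obtain ⟨x0, hx0⟩ : (φ (Sum.inl ⟨0, ha⟩)).Nonempty :=
    Set.nonempty_coe_sort.1 (h2 (Sum.inl ⟨0, ha⟩)).nonempty
  have hR : ∀ j, ∀ y ∈ φ (Sum.inr j), f y = f x0 := by
    intro j y hy
    obtain ⟨x, hx, y', hy', hxy⟩ := h4 ⟨0, ha⟩ j
    rw [hc _ y hy y' hy', ← hf x (h1 _ hx) y' (h1 _ hy') hxy]
    exact hc _ _ hx _ hx0
  have hL : ∀ i, ∀ x ∈ φ (Sum.inl i), f x = f x0 := by
    intro i x hx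
    obtain ⟨x', hx', y', hy', hxy⟩ := h4 i ⟨0, hb⟩
    rw [hc _ x hx x' hx', hf x' (h1 _ hx') y' (h1 _ hy') hxy]
    exact hR _ _ hy'
  refine ⟨f x0, φ, ?_, h2, h3, h4⟩
  rintro (i | j) x hx
  · exact ⟨h1 _ hx, hL _ _ hx⟩
  · exact ⟨h1 _ hx, hR _ _ hx⟩

theorem induce_singleton_connected {V : Type} (G : SimpleGraph V) (v : V) :
    (G.induce ({v} : Set V)).Connected := by
  have : Nonempty ({v} : Set V) := ⟨⟨v, rfl⟩⟩
  refine ⟨?_⟩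
  rintro ⟨a, ha⟩ ⟨b, hb⟩
  have : a = b := by rw [Set.mem_singleton_iff.1 ha, Set.mem_singleton_iff.1 hb]
  subst this
  exact Reachable.refl _

theorem induce_pair_connected' {V : Type} (G : SimpleGraph V) {u v : V} (h : G.Adj u v) :
    (G.induce ({u, v} : Set V)).Connected := by
  exact induce_pair_connected_of_adj h

/-- `K` is a dominating clique. -/
def DomK {V : Type} (G : SimpleGraph V) (K : Finset V) : Prop :=
  G.IsClique (↑K : Set V) ∧ ∀ v : V, v ∉ K → ∀ u ∈ K, G.Adj u v

theorem DomK.adj {V : Type} {G : SimpleGraph V} {K : Finset V} (h : DomK G K) {u v : V}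
    (hu : u ∈ K) (huv : u ≠ v) : G.Adj u v := by
  by_cases hv : v ∈ K
  · exact h.1 hu hv huv
  · exact h.2 v hv u hu

theorem minor_of_bip {V : Type} {G : SimpleGraph V} {K : Finset V} (hK : DomK G K) {s t a b : ℕ}
    (hcard : K.card = s - 1) (ha : 1 ≤ a) (has : a ≤ s) (hb : 1 ≤ b) (hab : a + b = t + 1)
    (h : Bip G (↑K)ᶜ a b) : MinorOf (completeBipartiteGraph (Fin s) (Fin t)) G := by
  obtain ⟨φ, h1, h2, h3, h4⟩ := h
  let k : Fin (s-1) → V := fun i => (K.equivFinOfCardEq hcard).symm i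
  have hkK : ∀ i, k i ∈ K := fun i => ((K.equivFinOfCardEq hcard).symm i).2
  have hkinj : Function.Injective k := Subtype.val_injective.comp (Equiv.injective _)
  -- index map
  let g : Fin s ⊕ Fin t → (Fin a ⊕ Fin b) ⊕ Fin (s-1) := fun i => match i with
    | Sum.inl i => if hi : (i:ℕ) < a then Sum.inl (Sum.inl ⟨i, hi⟩) else Sum.inr ⟨i - a, by omega⟩
    | Sum.inr j => if hj : (j:ℕ) < b then Sum.inl (Sum.inr ⟨j, hj⟩) else
        Sum.inr ⟨s - a + (j - b), by omega⟩
  have hg : Function.Injective g := by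
    rintro (i | i) (j | j) hij <;> simp only [g] at hij <;> split_ifs at hij <;>
      simp only [Sum.inl.injEq, Sum.inr.injEq, Fin.mk.injEq, reduceCtorEq] at hij ⊢ <;>
      (try apply Fin.ext) <;> omega
  let ψ : (Fin a ⊕ Fin b) ⊕ Fin (s-1) → Set V := Sum.elim φ (fun i => {k i})
  have hψd : Pairwise fun i j => Disjoint (ψ i) (ψ j) := by
    rintro (i | i) (j | j) hij
    · exact h3 (fun h => hij (by rw [h]))
    · refine Set.disjoint_singleton_right.2 (fun h => h1 _ h (hkK j))
    · refine Set.disjoint_singleton_left.2 (fun h => h1 _ h (hkK i))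
    · refine Set.disjoint_singleton.2 (fun h => hij (by rw [hkinj h]))
  have hψc : ∀ i, (G.induce (ψ i)).Connected := by
    rintro (i | i)
    · exact h2 i
    · exact induce_singleton_connected G _
  have hne : ∀ i, (ψ i).Nonempty := fun i => Set.nonempty_coe_sort.1 (hψc i).nonempty
  have hadjK : ∀ i j, Sum.inr i ≠ j → ∃ x ∈ ψ (Sum.inr i), ∃ y ∈ ψ j, G.Adj x y := by
    intro i j hij
    obtain ⟨y, hy⟩ := hne j
    refine ⟨k i, rfl, y, hy, hK.adj (hkK i) ?_⟩
    rintro rfl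
    exact Set.disjoint_left.1 (hψd hij) rfl hy
  have hmain : ∀ (i : Fin s) (j : Fin t),
      ∃ x ∈ ψ (g (Sum.inl i)), ∃ y ∈ ψ (g (Sum.inr j)), G.Adj x y := by
    intro i j
    have hne : g (Sum.inl i) ≠ g (Sum.inr j) := fun h => absurd (@hg (Sum.inl i) (Sum.inr j) h) (by simp)
    rcases hgi : g (Sum.inl i) with i' | i'
    · rcases hgj : g (Sum.inr j) with j' | j'
      · simp only [g] at hgi hgj
        split_ifs at hgi
        split_ifs at hgj
        cases hgi; cases hgj
        exact h4 _ _
      · rw [hgi, hgj] at hne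
        obtain ⟨x, hx, y, hy, hxy⟩ := hadjK j' _ hne.symm
        exact ⟨y, hy, x, hx, hxy.symm⟩
    · rw [hgi] at hne
      exact hadjK i' _ hne
  refine ⟨fun i => ψ (g i), fun i => hψc _, fun i j hij => hψd (fun h => hij (hg h)), ?_⟩
  rintro (i | i) (j | j) hij
  · simp at hij
  · exact hmain i j
  · obtain ⟨x, hx, y, hy, hxy⟩ := hmain j i
    exact ⟨y, hy, x, hx, hxy.symm⟩
  · simp at hij

theorem bip_of_minor {V : Type} {G : SimpleGraph V} {K : Finset V} {s t : ℕ}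
    (hs : 1 ≤ s) (hst : s ≤ t) (hcard : K.card = s - 1)
    (h : MinorOf (completeBipartiteGraph (Fin s) (Fin t)) G) :
    ∃ a b, 1 ≤ a ∧ a ≤ s ∧ 1 ≤ b ∧ a + b = t + 1 ∧ Bip G (↑K)ᶜ a b := by
  classical
  obtain ⟨φ, h2, h3, h4⟩ := h
  let bad : Finset (Fin s ⊕ Fin t) := Finset.univ.filter fun i => ∃ x ∈ φ i, x ∈ K
  have hbad : bad.card ≤ s - 1 := by
    have hex : ∀ i : Fin s ⊕ Fin t, ∃ x : V, i ∈ bad → x ∈ φ i ∧ x ∈ K := by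
      intro i
      by_cases hi : i ∈ bad
      · obtain ⟨x, hx, hxK⟩ := (Finset.mem_filter.1 hi).2
        exact ⟨x, fun _ => ⟨hx, hxK⟩⟩
      · have := (h2 i).nonempty
        obtain ⟨x⟩ := this
        exact ⟨x, fun h => absurd h hi⟩
    choose f hf using hex
    rw [← hcard]
    refine Finset.card_le_card_of_injOn f (fun i hi => (hf i hi).2) ?_
    intro i hi j hj hij
    by_contra hne
    exact Set.disjoint_left.1 (h3 hne) (hf i hi).1 (hij ▸ (hf j hj).1)
  let α := {i : Fin s // Sum.inl i ∉ bad}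
  let β := {i : Fin t // Sum.inr i ∉ bad}
  have hsum : s + t ≤ Fintype.card α + Fintype.card β + (s - 1) := by
    have e : Fintype.card (Fin s ⊕ Fin t) = s + t := by simp
    have h5 : (Finset.univ.filter fun i => i ∉ bad).card + bad.card = s + t := by
      rw [← e, add_comm, ← Finset.card_univ]
      have : bad = Finset.univ.filter (fun i => i ∈ bad) := by ext; simp
      conv_lhs => rw [this]
      have h6 := Finset.card_filter_add_card_filter_not (s := (Finset.univ : Finset (Fin s ⊕ Fin t)))
        (fun i => i ∈ bad)
      simpa using h6
    have h7 : (Finset.univ.filter fun i => i ∉ bad).card ≤ Fintype.card (α ⊕ β) := by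
      rw [← Fintype.card_coe]
      refine Fintype.card_le_of_surjective (fun x : α ⊕ β => match x with
        | Sum.inl i => ⟨Sum.inl i.1, by simpa using i.2⟩
        | Sum.inr i => ⟨Sum.inr i.1, by simpa using i.2⟩) ?_
      rintro ⟨i | i, hi⟩
      · exact ⟨Sum.inl ⟨i, by simpa using hi⟩, rfl⟩
      · exact ⟨Sum.inr ⟨i, by simpa using hi⟩, rfl⟩
    rw [Fintype.card_sum] at h7
    omega
  have hα : Fintype.card α ≤ s := (Fintype.card_subtype_le _).trans (by simp)
  have hβ : Fintype.card β ≤ t := (Fintype.card_subtype_le _).trans (by simp)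
  refine ⟨t + 1 - Fintype.card β, Fintype.card β, by omega, by omega, by omega, by omega, ?_⟩
  refine bip_of_types (α := α) (β := β) G _ (Sum.elim (fun i => φ (Sum.inl i.1)) fun i => φ (Sum.inr i.1))
    ?_ ?_ ?_ ?_ _ _ (by omega) le_rfl
  · rintro (i | i) x hx hxK
    · exact i.2 (by simp only [bad, Finset.mem_filter]; exact ⟨Finset.mem_univ _, x, hx, hxK⟩)
    · exact i.2 (by simp only [bad, Finset.mem_filter]; exact ⟨Finset.mem_univ _, x, hx, hxK⟩)
  · rintro (i | i) <;> exact h2 _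
  · rintro (i | i) (j | j) hij
    · exact h3 (fun h => hij (by rw [Subtype.ext (Sum.inl_injective h)]))
    · exact h3 (by simp)
    · exact h3 (by simp)
    · exact h3 (fun h => hij (by rw [Subtype.ext (Sum.inr_injective h)]))
  · intro i j
    exact h4 _ _ (by simp)

/-- Replace the graph on `T` by `J`, keeping `K` dominating. -/
def repl {V : Type} (G : SimpleGraph V) (K T : Finset V) (J : SimpleGraph V) : SimpleGraph V where
  Adj u v := u ≠ v ∧ ((u ∈ T ∧ v ∈ T ∧ J.Adj u v) ∨ (u ∉ T ∧ v ∉ T ∧ G.Adj u v) ∨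
    (u ∈ T ∧ v ∈ K) ∨ (u ∈ K ∧ v ∈ T))
  symm := ⟨by
    intro u v h
    refine ⟨h.1.symm, ?_⟩
    rcases h.2 with h | h | h | h
    · exact Or.inl ⟨h.2.1, h.1, h.2.2.symm⟩
    · exact Or.inr (Or.inl ⟨h.2.1, h.1, h.2.2.symm⟩)
    · exact Or.inr (Or.inr (Or.inr ⟨h.2, h.1⟩))
    · exact Or.inr (Or.inr (Or.inl ⟨h.2, h.1⟩))⟩
  loopless := ⟨fun u h => h.1 rfl⟩

theorem repl_dom {V : Type} {G : SimpleGraph V} {K T : Finset V} (J : SimpleGraph V)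
    (hK : DomK G K) (hT : Disjoint K T) : DomK (repl G K T J) K := by
  have hkt : ∀ u ∈ K, u ∉ T := fun u hu => Finset.disjoint_left.1 hT hu
  refine ⟨fun u hu v hv huv => ⟨huv, Or.inr (Or.inl ⟨hkt u hu, hkt v hv, hK.1 hu hv huv⟩)⟩, ?_⟩
  intro v hv u hu
  have huv : u ≠ v := by rintro rfl; exact hv hu
  refine ⟨huv, ?_⟩
  by_cases hvT : v ∈ T
  · exact Or.inr (Or.inr (Or.inr ⟨hu, hvT⟩))
  · exact Or.inr (Or.inl ⟨hkt u hu, hvT, hK.2 v hv u hu⟩)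

theorem repl_adj_in {V : Type} {G : SimpleGraph V} {K T : Finset V} {J : SimpleGraph V}
    (hT : Disjoint K T) {u v : V} (hu : u ∈ T) (hv : v ∈ T) :
    (repl G K T J).Adj u v ↔ J.Adj u v := by
  have h1 : u ∉ K := fun h => Finset.disjoint_left.1 hT h hu
  have h2 : v ∉ K := fun h => Finset.disjoint_left.1 hT h hv
  simp only [repl, hu, hv, h1, h2, true_and, not_true, false_and, or_false, and_false]
  exact ⟨fun h => h.2, fun h => ⟨h.ne, h⟩⟩

theorem repl_adj_out {V : Type} {G : SimpleGraph V} {K T : Finset V} {J : SimpleGraph V}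
    {u v : V} (hu : u ∉ T) (hv : v ∉ T) :
    (repl G K T J).Adj u v ↔ G.Adj u v := by
  simp only [repl, hu, hv, false_and, or_false, and_false, false_or, not_false_eq_true, true_and]
  exact ⟨fun h => h.2, fun h => ⟨h.ne, h⟩⟩

theorem repl_adj_cross {V : Type} {G : SimpleGraph V} {K T : Finset V} {J : SimpleGraph V}
    {u v : V} (huK : u ∉ K) (hvK : v ∉ K) (h : (repl G K T J).Adj u v) : u ∈ T ↔ v ∈ T := by
  simp only [repl, huK, hvK, false_and, or_false, and_false] at h
  tauto

theorem repl_free {V : Type} {G : SimpleGraph V} {K T : Finset V} {J : SimpleGraph V} {s t : ℕ}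
    (hs : 1 ≤ s) (hst : s ≤ t) (hcard : K.card = s - 1)
    (hK : DomK G K) (hT : Disjoint K T)
    (hG : ¬ MinorOf (completeBipartiteGraph (Fin s) (Fin t)) G)
    (hJ : ∀ a b, 1 ≤ a → a ≤ s → 1 ≤ b → a + b = t + 1 → ¬ Bip J ↑T a b) :
    ¬ MinorOf (completeBipartiteGraph (Fin s) (Fin t)) (repl G K T J) := by
  intro h
  obtain ⟨a, b, ha, has, hb, hab, hB⟩ := bip_of_minor hs hst hcard h
  obtain ⟨i, hi⟩ := bip_fiber (fun v => v ∈ T) (fun u hu v hv huv =>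
    propext (repl_adj_cross (by simpa using hu) (by simpa using hv) huv)) ha hb hB
  by_cases hp : i
  · refine hJ a b ha has hb hab (bip_mono ?_ ?_ hi)
    · rintro v ⟨-, hv⟩
      have : (v ∈ T) = i := hv
      simpa [this] using hp
    · rintro u ⟨-, hu⟩ v ⟨-, hv⟩ huv
      have hu : (u ∈ T) = i := hu
      have hv : (v ∈ T) = i := hv
      exact (repl_adj_in hT (hu ▸ hp) (hv ▸ hp)).1 huv
  · refine hG (minor_of_bip hK hcard ha has hb hab (bip_mono Set.inter_subset_left ?_ hi))
    rintro u ⟨-, hu⟩ v ⟨-, hv⟩ huv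
    have hu : (u ∈ T) = i := hu
    have hv : (v ∈ T) = i := hv
    exact (repl_adj_out (hu ▸ hp) (hv ▸ hp)).1 huv

end CT
open SimpleGraph

namespace CT

theorem quad_eq {V : Type} [Fintype V] (G : SimpleGraph V) (y : V → ℝ) [DecidableRel G.Adj] :
    y ⬝ᵥ (adjMat G).mulVec y = ∑ u, ∑ v, if G.Adj u v then y u * y v else 0 := by
  have : adjMat G = G.adjMatrix ℝ := by
    ext u v
    simp [adjMat, SimpleGraph.adjMatrix_apply]
  rw [this]
  simp only [dotProduct, Matrix.mulVec, SimpleGraph.adjMatrix_apply, Finset.mul_sum]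
  refine Finset.sum_congr rfl fun u _ => Finset.sum_congr rfl fun v _ => ?_
  split_ifs <;> simp

theorem mulVec_eq {V : Type} [Fintype V] (G : SimpleGraph V) (y : V → ℝ) [DecidableRel G.Adj]
    (u : V) : (adjMat G).mulVec y u = ∑ v, if G.Adj u v then y v else 0 := by
  have : adjMat G = G.adjMatrix ℝ := by
    ext u v
    simp [adjMat, SimpleGraph.adjMatrix_apply]
  rw [this]
  simp only [dotProduct, Matrix.mulVec, SimpleGraph.adjMatrix_apply]
  refine Finset.sum_congr rfl fun v _ => ?_
  split_ifs <;> simp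

theorem rayleigh {V : Type} [Fintype V] [DecidableEq V] (G : SimpleGraph V) (y : V → ℝ)
    [DecidableRel G.Adj] :
    (∑ u, ∑ v, if G.Adj u v then y u * y v else 0) ≤ specRad G * ∑ u, y u ^ 2 := by
  have hA := adjMat_herm G
  have hle : ∀ i, hA.eigenvalues i ≤ specRad G := fun i =>
    le_ciSup (f := hA.eigenvalues) (Set.finite_range _).bddAbove i
  have hB : (algebraMap ℝ (Matrix V V ℝ) (specRad G) - adjMat G).IsHermitian := by
    refine Matrix.IsHermitian.sub ?_ hA
    rw [Algebra.algebraMap_eq_smul_one, Matrix.IsHermitian]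
    simp
  have hpsd : (algebraMap ℝ (Matrix V V ℝ) (specRad G) - adjMat G).PosSemidef := by
    rw [hB.posSemidef_iff_eigenvalues_nonneg]
    intro i
    have h1 := hB.eigenvalues_mem_spectrum_real i
    rw [← spectrum.singleton_sub_eq] at h1
    obtain ⟨a, ha, b, hb, hab⟩ := Set.mem_sub.1 h1
    rw [hA.spectrum_real_eq_range_eigenvalues] at hb
    obtain ⟨j, rfl⟩ := hb
    have : a = specRad G := ha
    have h2 := hle j
    show 0 ≤ hB.eigenvalues i
    rw [← hab]
    linarith
  have h := hpsd.dotProduct_mulVec_nonneg y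
  rw [star_trivial, Matrix.sub_mulVec, dotProduct_sub, quad_eq, Algebra.algebraMap_eq_smul_one,
    Matrix.smul_mulVec, Matrix.one_mulVec, dotProduct_smul] at h
  have h3 : y ⬝ᵥ y = ∑ u, y u ^ 2 := by simp [dotProduct, sq]
  rw [h3, smul_eq_mul] at h
  linarith

theorem exists_eigvec {V : Type} [Fintype V] [DecidableEq V] [Nonempty V] (G : SimpleGraph V)
    [DecidableRel G.Adj] :
    ∃ x : V → ℝ, x ≠ 0 ∧ ∀ u, (∑ v, if G.Adj u v then x v else 0) = specRad G * x u := by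
  have hA := adjMat_herm G
  obtain ⟨i, hi⟩ := exists_eq_ciSup_of_finite (f := hA.eigenvalues)
  refine ⟨hA.eigenvectorBasis i, ?_, ?_⟩
  · intro h
    have h1 := hA.eigenvectorBasis.orthonormal.ne_zero i
    apply h1
    ext j
    exact congrFun h j
  · intro u
    have h := congrFun (hA.mulVec_eigenvectorBasis i) u
    rw [mulVec_eq] at h
    rw [h]
    have : hA.eigenvalues i = specRad G := hi
    rw [← this]
    rfl

end CT
open SimpleGraph

namespace CT

open Classical in
/-- adjacency weight -/
noncomputable def aw {V : Type} (G : SimpleGraph V) (u v : V) : ℝ := if G.Adj u v then 1 else 0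

theorem aw_nonneg {V : Type} (G : SimpleGraph V) (u v : V) : 0 ≤ aw G u v := by
  unfold aw; split_ifs <;> norm_num

theorem aw_le_one {V : Type} (G : SimpleGraph V) (u v : V) : aw G u v ≤ 1 := by
  unfold aw; split_ifs <;> norm_num

theorem aw_congr {V V' : Type} {G : SimpleGraph V} {G' : SimpleGraph V'} {u v : V} {u' v' : V'}
    (h : G.Adj u v ↔ G'.Adj u' v') : aw G u v = aw G' u' v' := by
  unfold aw; by_cases h1 : G.Adj u v
  · rw [if_pos h1, if_pos (h.1 h1)]
  · rw [if_neg h1, if_neg (fun h2 => h1 (h.2 h2))]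

theorem aw_symm {V : Type} (G : SimpleGraph V) (u v : V) : aw G u v = aw G v u :=
  aw_congr (G.adj_comm u v)

theorem aw_self {V : Type} (G : SimpleGraph V) (u : V) : aw G u u = 0 := by
  unfold aw; simp

theorem aw_adj {V : Type} {G : SimpleGraph V} {u v : V} (h : G.Adj u v) : aw G u v = 1 := by
  unfold aw; simp [h]

theorem aw_not {V : Type} {G : SimpleGraph V} {u v : V} (h : ¬ G.Adj u v) : aw G u v = 0 := by
  unfold aw; simp [h]

theorem rayleigh' {V : Type} [Fintype V] [DecidableEq V] (G : SimpleGraph V) (y : V → ℝ) :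
    (∑ u, ∑ v, aw G u v * (y u * y v)) ≤ specRad G * ∑ u, y u ^ 2 := by
  classical
  refine le_trans (le_of_eq ?_) (rayleigh G y)
  refine Finset.sum_congr rfl fun u _ => Finset.sum_congr rfl fun v _ => ?_
  unfold aw
  split_ifs <;> simp

theorem exists_eigvec' {V : Type} [Fintype V] [DecidableEq V] [Nonempty V] (G : SimpleGraph V) :
    ∃ x : V → ℝ, x ≠ 0 ∧ ∀ u, (∑ v, aw G u v * x v) = specRad G * x u := by
  classical
  obtain ⟨x, hx, h⟩ := exists_eigvec G
  refine ⟨x, hx, fun u => ?_⟩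
  rw [← h u]
  refine Finset.sum_congr rfl fun v _ => ?_
  unfold aw
  split_ifs <;> simp

theorem sum_split {V : Type} [Fintype V] {K R : Finset V} (hR : ∀ v, v ∈ R ↔ v ∉ K) (f : V → ℝ) :
    ∑ v, f v = ∑ v ∈ K, f v + ∑ v ∈ R, f v := by
  classical
  have : R = Kᶜ := by ext v; simp [hR]
  rw [this, Finset.sum_add_sum_compl]

theorem rho_lower {V : Type} [Fintype V] [DecidableEq V] {G : SimpleGraph V} {K : Finset V}
    (hK : DomK G K) (hKne : K.Nonempty) (h1 : 1 < Fintype.card V) :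
    Real.sqrt (Fintype.card V - 1) ≤ specRad G := by
  obtain ⟨u0, hu0⟩ := hKne
  set q := Real.sqrt (Fintype.card V - 1) with hq
  have hcard : (0:ℝ) < Fintype.card V - 1 := by
    have : (1:ℝ) < Fintype.card V := by exact_mod_cast h1
    linarith
  have hq2 : q ^ 2 = Fintype.card V - 1 := Real.sq_sqrt hcard.le
  have hqpos : 0 < q := Real.sqrt_pos.2 hcard
  let y : V → ℝ := fun v => if v = u0 then q else 1
  have hy0 : y u0 = q := by simp [y]
  have hy1 : ∀ v, v ≠ u0 → y v = 1 := by intro v hv; simp [y, hv]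
  have hypos : ∀ v, 0 ≤ y v := by intro v; simp only [y]; split_ifs <;> positivity
  have hcardE : ((Finset.univ.erase u0).card : ℝ) = q^2 := by
    rw [hq2, Finset.card_erase_of_mem (Finset.mem_univ _), Finset.card_univ, Nat.cast_sub h1.le]
    simp
  have hsq : ∑ u, y u ^ 2 = 2 * q ^ 2 := by
    rw [← Finset.add_sum_erase _ _ (Finset.mem_univ u0), hy0,
      Finset.sum_congr rfl (g := fun _ => (1:ℝ)) (fun v hv => by
        rw [hy1 v (Finset.ne_of_mem_erase hv)]; norm_num)]
    rw [Finset.sum_const, nsmul_eq_mul, hcardE]; ring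
  have hr := rayleigh' G y
  have hlow : 2 * q ^ 3 ≤ ∑ u, ∑ v, aw G u v * (y u * y v) := by
    rw [← Finset.add_sum_erase _ _ (Finset.mem_univ u0)]
    have e1 : q ^ 3 ≤ ∑ v, aw G u0 v * (y u0 * y v) := by
      rw [← Finset.add_sum_erase _ _ (Finset.mem_univ u0), aw_self,
        Finset.sum_congr rfl (g := fun _ => q) (fun v hv => by
        rw [hy1 v (Finset.ne_of_mem_erase hv), hy0, aw_adj (hK.adj hu0 (Finset.ne_of_mem_erase hv).symm)]; ring)]
      rw [Finset.sum_const, nsmul_eq_mul, hcardE]; linarith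
    have e2 : q ^ 3 ≤ ∑ u ∈ Finset.univ.erase u0, ∑ v, aw G u v * (y u * y v) := by
      have : ∑ u ∈ Finset.univ.erase u0, q ≤ ∑ u ∈ Finset.univ.erase u0, ∑ v, aw G u v * (y u * y v) := by
        refine Finset.sum_le_sum fun u hu => ?_
        refine le_trans ?_ (Finset.single_le_sum (f := fun v => aw G u v * (y u * y v))
          (fun v _ => mul_nonneg (aw_nonneg _ _ _) (mul_nonneg (hypos u) (hypos v))) (Finset.mem_univ u0))
        have hne := Finset.ne_of_mem_erase hu
        rw [hy1 u hne, hy0, aw_adj (hK.adj hu0 hne.symm).symm]; linarith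
      rw [Finset.sum_const, nsmul_eq_mul, hcardE] at this
      linarith
    linarith
  rw [hsq] at hr
  have : q * (2 * q^2) ≤ specRad G * (2 * q^2) := by nlinarith
  exact le_of_mul_le_mul_right this (by positivity)

/-- Normalised weights from the Perron vector. -/
structure Wts {V : Type} (G : SimpleGraph V) (K R : Finset V) (ρ D : ℝ) (x : V → ℝ) : Prop where
  eig : ∀ v ∈ R, ρ * x v = 1 + ∑ w ∈ R, aw G v w * x w
  low : ∀ v ∈ R, 1 / ρ ≤ x v
  upp : ∀ v ∈ R, x v ≤ 1 / (ρ - D)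
  tot : ρ = (K.card - 1) + K.card * ∑ v ∈ R, x v

theorem exists_wts {V : Type} [Fintype V] [DecidableEq V] {G : SimpleGraph V} {K R : Finset V}
    (hR : ∀ v, v ∈ R ↔ v ∉ K)
    (hK : DomK G K) (hKne : K.Nonempty) {D : ℝ} (hD : 0 ≤ D)
    (hdeg : ∀ v ∈ R, ∑ w ∈ R, aw G v w ≤ D) (hρ : D < specRad G) :
    ∃ x : V → ℝ, Wts G K R (specRad G) D x := by
  obtain ⟨u0, hu0⟩ := hKne
  have : Nonempty V := ⟨u0⟩
  obtain ⟨x, hx0, hx⟩ := exists_eigvec' G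
  set ρ := specRad G with hρdef
  have hρpos : 0 < ρ := lt_of_le_of_lt hD hρ
  set c := x u0 with hc
  have hsumK : ∀ u ∈ K, (ρ + 1) * x u = ∑ v, x v := by
    intro u hu
    have h1 : ∑ v, aw G u v * x v = ∑ v, x v - x u := by
      rw [← Finset.add_sum_erase _ _ (Finset.mem_univ u), ← Finset.add_sum_erase _ x (Finset.mem_univ u), aw_self]
      rw [Finset.sum_congr rfl (g := x) (fun v hv => by
        rw [aw_adj (hK.adj hu (Finset.ne_of_mem_erase hv).symm), one_mul])]
      ring
    have := hx u
    linarith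
  have hKc : ∀ u ∈ K, x u = c := by
    intro u hu
    have h1 := hsumK u hu
    have h2 := hsumK u0 hu0
    have : (ρ + 1) * x u = (ρ+1) * c := by rw [h1, h2]
    exact mul_left_cancel₀ (by positivity) this
  have hsumKx : ∑ v ∈ K, x v = K.card * c := by
    rw [Finset.sum_congr rfl hKc, Finset.sum_const, nsmul_eq_mul]
  have hRx : ∀ v ∈ R, ρ * x v = K.card * c + ∑ w ∈ R, aw G v w * x w := by
    intro v hv
    rw [← hx v, sum_split hR, ← hsumKx]
    congr 1
    refine Finset.sum_congr rfl fun u hu => ?_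
    rw [aw_adj (hK.2 v ((hR v).1 hv) u hu).symm, one_mul]
  have hc0 : c ≠ 0 := by
    intro h0
    apply hx0
    funext v
    by_cases hvK : v ∈ K
    · rw [hKc v hvK, h0]; rfl
    · have hvR := (hR v).2 hvK
      obtain ⟨m, hm, hmax⟩ := Finset.exists_max_image R (fun v => |x v|) ⟨v, hvR⟩
      have h1 := hRx m hm
      rw [h0, mul_zero, zero_add] at h1
      have h2 : ρ * |x m| ≤ D * |x m| := by
        calc ρ * |x m| = |ρ * x m| := by rw [abs_mul, abs_of_pos hρpos]
          _ ≤ ∑ w ∈ R, |aw G m w * x w| := by rw [h1]; exact Finset.abs_sum_le_sum_abs _ _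
          _ ≤ ∑ w ∈ R, aw G m w * |x m| := by
            refine Finset.sum_le_sum fun w hw => ?_
            rw [abs_mul, abs_of_nonneg (aw_nonneg _ _ _)]
            exact mul_le_mul_of_nonneg_left (hmax w hw) (aw_nonneg _ _ _)
          _ ≤ D * |x m| := by
            rw [← Finset.sum_mul]
            exact mul_le_mul_of_nonneg_right (hdeg m hm) (abs_nonneg _)
      have h3 : |x m| ≤ 0 := by
        by_contra h
        push Not at h
        nlinarith
      have h4 : |x v| ≤ 0 := (hmax v hvR).trans h3
      simpa using h4
  have hk : (0:ℝ) < K.card := by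
    have : 0 < K.card := Finset.card_pos.2 ⟨u0, hu0⟩
    exact_mod_cast this
  have hkc : (K.card : ℝ) * c ≠ 0 := mul_ne_zero hk.ne' hc0
  let z : V → ℝ := fun v => x v / (K.card * c)
  have hz : ∀ v ∈ R, ρ * z v = 1 + ∑ w ∈ R, aw G v w * z w := by
    intro v hv
    have : ∑ w ∈ R, aw G v w * z w = (∑ w ∈ R, aw G v w * x w) / (K.card * c) := by
      rw [Finset.sum_div]
      refine Finset.sum_congr rfl fun w _ => ?_
      simp only [z]; ring
    rw [this]
    simp only [z]
    rw [← mul_div_assoc, hRx v hv, add_div, div_self hkc]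
  have hz0 : ∀ v ∈ R, 0 ≤ z v := by
    intro v hv
    obtain ⟨m, hm, hmin⟩ := Finset.exists_min_image R z ⟨v, hv⟩
    refine le_trans ?_ (hmin v hv)
    by_contra hneg
    push Not at hneg
    have h1 := hz m hm
    have h2 : (∑ w ∈ R, aw G m w) * z m ≤ ∑ w ∈ R, aw G m w * z w := by
      rw [Finset.sum_mul]
      exact Finset.sum_le_sum fun w hw => mul_le_mul_of_nonneg_left (hmin w hw) (aw_nonneg _ _ _)
    have h3 : D * z m ≤ (∑ w ∈ R, aw G m w) * z m := mul_le_mul_of_nonpos_right (hdeg m hm) hneg.le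
    nlinarith
  refine ⟨z, hz, ?_, ?_, ?_⟩
  · intro v hv
    rw [div_le_iff₀ hρpos, mul_comm, hz v hv]
    have : 0 ≤ ∑ w ∈ R, aw G v w * z w :=
      Finset.sum_nonneg fun w hw => mul_nonneg (aw_nonneg _ _ _) (hz0 w hw)
    linarith
  · intro v hv
    obtain ⟨m, hm, hmax⟩ := Finset.exists_max_image R z ⟨v, hv⟩
    refine le_trans (hmax v hv) ?_
    rw [le_div_iff₀ (by linarith)]
    have h1 := hz m hm
    have h2 : ∑ w ∈ R, aw G m w * z w ≤ (∑ w ∈ R, aw G m w) * z m := by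
      rw [Finset.sum_mul]
      exact Finset.sum_le_sum fun w hw => mul_le_mul_of_nonneg_left (hmax w hw) (aw_nonneg _ _ _)
    have h3 := mul_le_mul_of_nonneg_right (hdeg m hm) (hz0 m hm)
    nlinarith
  · have h1 := hsumK u0 hu0
    rw [sum_split hR, hsumKx] at h1
    have h2 : (K.card : ℝ) * ∑ v ∈ R, z v = (∑ v ∈ R, x v) / c := by
      simp only [z]
      rw [← Finset.sum_div]
      field_simp
    rw [h2]
    have h3 : ∑ v ∈ R, x v = (ρ + 1 - K.card) * c := by rw [← hc] at h1; linarith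
    rw [h3, mul_div_cancel_right₀ _ hc0]; ring

theorem test_ineq {V : Type} [Fintype V] [DecidableEq V] {G G' : SimpleGraph V} {K R : Finset V}
    (hR : ∀ v, v ∈ R ↔ v ∉ K)
    (hK' : DomK G' K) (hKne : K.Nonempty) {D ρ : ℝ} {x : V → ℝ} (hx : Wts G K R ρ D x)
    (hle : specRad G' ≤ ρ) (z : V → ℝ) :
    ∑ v ∈ R, (2 * z v - ρ * z v ^ 2) + ∑ v ∈ R, ∑ w ∈ R, aw G' v w * (z v * z w) ≤
      ∑ v ∈ R, x v := by
  have hk : (0:ℝ) < K.card := by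
    have : 0 < K.card := Finset.card_pos.2 hKne
    exact_mod_cast this
  set k : ℝ := (K.card : ℝ) with hkdef
  let y : V → ℝ := fun v => if v ∈ K then 1 else k * z v
  have hyK : ∀ v ∈ K, y v = 1 := fun v hv => by simp [y, hv]
  have hyR : ∀ v ∈ R, y v = k * z v := fun v hv => by simp [y, (hR v).1 hv]
  have hr := rayleigh' G' y
  have hsq : ∑ u, y u ^ 2 = k + k ^ 2 * ∑ v ∈ R, z v ^ 2 := by
    rw [sum_split hR, Finset.sum_congr rfl (g := fun _ => (1:ℝ)) (fun v hv => by rw [hyK v hv]; norm_num),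
      Finset.sum_congr (s₁ := R) rfl (g := fun v => k^2 * z v ^2) (fun v hv => by rw [hyR v hv]; ring),
      ← Finset.mul_sum, Finset.sum_const, nsmul_eq_mul, mul_one]
  have hrow1 : ∀ u ∈ K, ∑ v, aw G' u v * (y u * y v) = (k - 1) + k * ∑ v ∈ R, z v := by
    intro u hu
    rw [sum_split hR, ← Finset.add_sum_erase _ _ hu, aw_self]
    rw [Finset.sum_congr rfl (g := fun _ => (1:ℝ)) (fun v hv => by
      rw [hyK u hu, hyK v (Finset.mem_of_mem_erase hv), aw_adj (hK'.adj hu (Finset.ne_of_mem_erase hv).symm)]; norm_num),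
      Finset.sum_congr (s₁ := R) rfl (g := fun v => k * z v) (fun v hv => by
        rw [hyR v hv, hyK u hu, aw_adj (hK'.2 v ((hR v).1 hv) u hu)]; ring),
      ← Finset.mul_sum, Finset.sum_const, nsmul_eq_mul, mul_one, Finset.card_erase_of_mem hu,
      Nat.cast_sub (Finset.card_pos.2 ⟨u, hu⟩)]
    push_cast
    ring
  have hrow2 : ∀ u ∈ R, ∑ v, aw G' u v * (y u * y v) = k^2 * z u + k^2 * ∑ v ∈ R, aw G' u v * (z u * z v) := by
    intro u hu
    rw [sum_split hR]
    rw [Finset.sum_congr rfl (g := fun _ => k * z u) (fun v hv => by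
      rw [hyK v hv, hyR u hu, aw_adj (hK'.2 u ((hR u).1 hu) v hv).symm]; ring),
      Finset.sum_congr (s₁ := R) rfl (g := fun v => k^2 * (aw G' u v * (z u * z v))) (fun v hv => by
        rw [hyR v hv, hyR u hu]; ring),
      Finset.sum_const, ← Finset.mul_sum, nsmul_eq_mul, ← hkdef]
    ring
  rw [hsq, sum_split hR, Finset.sum_congr rfl hrow1, Finset.sum_congr (s₁ := R) rfl hrow2,
    Finset.sum_const, Finset.sum_add_distrib, nsmul_eq_mul, ← Finset.mul_sum, ← Finset.mul_sum, ← hkdef] at hr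
  have hpos : 0 ≤ k + k ^ 2 * ∑ v ∈ R, z v ^ 2 := by
    have : 0 ≤ ∑ v ∈ R, z v ^ 2 := Finset.sum_nonneg fun v _ => sq_nonneg _
    positivity
  have hr2 := hr.trans (mul_le_mul_of_nonneg_right hle hpos)
  have ht := hx.tot
  rw [← hkdef] at ht
  have e : ∑ v ∈ R, (2 * z v - ρ * z v ^ 2) = 2 * ∑ v ∈ R, z v - ρ * ∑ v ∈ R, z v ^2 := by
    rw [Finset.sum_sub_distrib, Finset.mul_sum, Finset.mul_sum]
  rw [e]
  have h5 : ρ * k = (k - 1) * k + k^2 * ∑ v ∈ R, x v := by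
    conv_lhs => rw [ht]
    ring
  have h6 : k^2 * (2 * ∑ v ∈ R, z v - ρ * ∑ v ∈ R, z v ^2 + ∑ v ∈ R, ∑ w ∈ R, aw G' v w * (z v * z w)) ≤
      k^2 * ∑ v ∈ R, x v := by linarith
  exact le_of_mul_le_mul_left h6 (by positivity)

theorem wts_energy {V : Type} {G : SimpleGraph V} {K R : Finset V} {D ρ : ℝ} {x : V → ℝ}
    (hx : Wts G K R ρ D x) {T : Finset V} (hT : T ⊆ R) :
    ∑ v ∈ T, (2 * x v - ρ * x v ^ 2) + ∑ v ∈ T, ∑ w ∈ R, aw G v w * (x v * x w) = ∑ v ∈ T, x v := by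
  rw [← Finset.sum_add_distrib]
  refine Finset.sum_congr rfl fun v hv => ?_
  have h := hx.eig v (hT hv)
  have e : ∑ w ∈ R, aw G v w * (x v * x w) = x v * ∑ w ∈ R, aw G v w * x w := by
    rw [Finset.mul_sum]
    exact Finset.sum_congr rfl fun w _ => by ring
  rw [e]
  have h2 : ∑ w ∈ R, aw G v w * x w = ρ * x v - 1 := by linarith
  rw [h2]; ring

/-- Local replacement inequality. -/
theorem repl_ineq {V : Type} [Fintype V] [DecidableEq V] {G J : SimpleGraph V} {K R T : Finset V}
    (hR : ∀ v, v ∈ R ↔ v ∉ K) (hK : DomK G K) (hKne : K.Nonempty) {D ρ : ℝ} {x : V → ℝ}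
    (hx : Wts G K R ρ D x) (hT : T ⊆ R) (hle : specRad (repl G K T J) ≤ ρ) (z : V → ℝ) :
    ∑ v ∈ T, (2 * z v - ρ * z v ^ 2) + ∑ v ∈ T, ∑ w ∈ T, aw J v w * (z v * z w) ≤
      ∑ v ∈ T, x v + ∑ v ∈ R \ T, ∑ w ∈ T, aw G v w * (x v * x w) := by
  have hKT : Disjoint K T := by
    rw [Finset.disjoint_right]
    intro v hv
    exact (hR v).1 (hT hv)
  let z' : V → ℝ := fun v => if v ∈ T then z v else x v
  have hzT : ∀ v ∈ T, z' v = z v := fun v hv => by simp [z', hv]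
  have hzO : ∀ v ∈ R \ T, z' v = x v := fun v hv => by simp [z', (Finset.mem_sdiff.1 hv).2]
  have h := test_ineq hR (repl_dom J hK hKT) hKne hx hle z'
  have hsp : ∀ f : V → ℝ, ∑ v ∈ R, f v = ∑ v ∈ T, f v + ∑ v ∈ R \ T, f v := by
    intro f
    rw [add_comm, Finset.sum_sdiff hT]
  have hnK : ∀ v ∈ R, v ∉ K := fun v hv => (hR v).1 hv
  have e1 : ∀ v ∈ T, ∑ w ∈ R, aw (repl G K T J) v w * (z' v * z' w) = ∑ w ∈ T, aw J v w * (z v * z w) := by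
    intro v hv
    rw [hsp]
    rw [Finset.sum_congr (s₁ := R \ T) rfl (g := fun _ => (0:ℝ)), Finset.sum_const_zero, add_zero]
    · refine Finset.sum_congr rfl fun w hw => ?_
      rw [hzT v hv, hzT w hw]
      congr 1
      exact aw_congr (repl_adj_in hKT hv hw)
    · intro w hw
      rw [Finset.mem_sdiff] at hw
      rw [aw_not, zero_mul]
      intro hadj
      exact hw.2 ((repl_adj_cross (hnK v (hT hv)) (hnK w hw.1) hadj).1 hv)
  have e2 : ∀ v ∈ R \ T, ∑ w ∈ R, aw (repl G K T J) v w * (z' v * z' w) =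
      ∑ w ∈ R, aw G v w * (x v * x w) - ∑ w ∈ T, aw G v w * (x v * x w) := by
    intro v hv
    have hv' := Finset.mem_sdiff.1 hv
    rw [hsp, hsp]
    rw [Finset.sum_congr (s₁ := T) rfl (g := fun _ => (0:ℝ)), Finset.sum_const_zero, zero_add, add_sub_cancel_left]
    · refine Finset.sum_congr rfl fun w hw => ?_
      have hw' := Finset.mem_sdiff.1 hw
      rw [hzO v hv, hzO w hw]
      congr 1
      exact aw_congr (repl_adj_out hv'.2 hw'.2)
    · intro w hw
      rw [aw_not, zero_mul]
      intro hadj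
      exact hv'.2 ((repl_adj_cross (hnK v hv'.1) (hnK w (hT hw)) hadj).2 hw)
  rw [hsp, hsp, Finset.sum_congr (s₁ := T) rfl e1, Finset.sum_congr (s₁ := R \ T) rfl e2, hsp x,
    Finset.sum_congr (s₁ := T) rfl (fun v hv => by rw [hzT v hv] : ∀ v ∈ T, 2 * z' v - ρ * z' v ^2 = 2 * z v - ρ * z v ^2),
    Finset.sum_congr (s₁ := R \ T) rfl (fun v hv => by rw [hzO v hv] : ∀ v ∈ R \ T, 2 * z' v - ρ * z' v ^2 = 2 * x v - ρ * x v ^2),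
    Finset.sum_sub_distrib (s := R \ T) (fun v => ∑ w ∈ R, aw G v w * (x v * x w))] at h
  have h2 := wts_energy hx (T := R \ T) Finset.sdiff_subset
  linarith

end CT
open SimpleGraph

namespace CT

/-- edges of the Petersen graph on `Fin 10` -/
def pedge : List (Fin 10 × Fin 10) :=
  [(0,1),(0,2),(0,3),(1,4),(1,5),(2,6),(2,7),(3,8),(3,9),(4,6),(4,8),(5,7),(5,9),(6,9),(7,8)]

def padj (i j : Fin 10) : Bool := (i, j) ∈ pedge ∨ (j, i) ∈ pedge

def plab : Fin 10 → {s : Finset (Fin 5) // s.card = 2} :=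
  ![⟨{0,1}, by decide⟩, ⟨{2,3}, by decide⟩, ⟨{2,4}, by decide⟩, ⟨{3,4}, by decide⟩, ⟨{0,4}, by decide⟩,
    ⟨{1,4}, by decide⟩, ⟨{1,3}, by decide⟩, ⟨{0,3}, by decide⟩, ⟨{1,2}, by decide⟩, ⟨{0,2}, by decide⟩]

theorem plab_bij : Function.Bijective plab := by
  rw [Fintype.bijective_iff_injective_and_card]
  exact ⟨by decide, by decide⟩

theorem plab_adj (i j : Fin 10) : petersen.Adj (plab i) (plab j) ↔ padj i j = true := by
  simp only [petersen, SimpleGraph.fromRel_adj]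
  revert i j
  decide

theorem padj_comm : ∀ i j, i ≠ j → padj i j = false → ∃ k, padj i k = true ∧ padj j k = true := by
  decide

theorem padj_ne : ∀ i, padj i i = false := by decide

theorem petersen_of_table {V : Type} [Fintype V] (F : SimpleGraph V) (hcard : Fintype.card V = 10)
    (tri : ∀ p q r, F.Adj p q → F.Adj q r → F.Adj p r → False) (g : Fin 10 → V)
    (hsurj : Function.Surjective g) (hE : ∀ e ∈ pedge, F.Adj (g e.1) (g e.2)) :
    Nonempty (F ≃g petersen) := by
  have hbij : Function.Bijective g := by
    rw [Fintype.bijective_iff_surjective_and_card]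
    exact ⟨hsurj, by simp [hcard]⟩
  have hg : ∀ i j, padj i j = true → F.Adj (g i) (g j) := by
    intro i j h
    simp only [padj, decide_eq_true_eq] at h
    rcases h with h | h
    · exact hE _ h
    · exact (hE _ h).symm
  have hg2 : ∀ i j, F.Adj (g i) (g j) ↔ padj i j = true := by
    intro i j
    refine ⟨fun h => ?_, hg i j⟩
    by_contra hn
    have hn' : padj i j = false := by simpa using hn
    have hij : i ≠ j := by rintro rfl; exact F.loopless.irrefl _ h
    obtain ⟨k, h1, h2⟩ := padj_comm i j hij hn'
    exact tri _ _ _ h (hg _ _ h2) (hg _ _ h1)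
  let e1 := Equiv.ofBijective g hbij
  let e2 := Equiv.ofBijective plab plab_bij
  refine ⟨⟨e1.symm.trans e2, ?_⟩⟩
  intro a b
  obtain ⟨i, rfl⟩ := e1.surjective a
  obtain ⟨j, rfl⟩ := e1.surjective b
  simp only [Equiv.trans_apply, Equiv.symm_apply_apply]
  exact (plab_adj i j).trans (hg2 i j).symm

theorem petersen_of_srg {V : Type} [Fintype V] [DecidableEq V] (F : SimpleGraph V)
    [DecidableRel F.Adj] (hcard : Fintype.card V = 10)
    (hreg : ∀ v, F.degree v = 3)
    (tri : ∀ p q r, F.Adj p q → F.Adj q r → F.Adj p r → False)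
    (ex : ∀ p q, p ≠ q → ¬ F.Adj p q → ∃ r, F.Adj p r ∧ F.Adj q r)
    (uniq : ∀ p q r r', p ≠ q → F.Adj p r → F.Adj q r → F.Adj p r' → F.Adj q r' → r = r') :
    Nonempty (F ≃g petersen) := by
  have : Nonempty V := Fintype.card_pos_iff.1 (by omega)
  obtain ⟨v⟩ := this
  have hN3 : ∀ v, ∃ a b c, a ≠ b ∧ a ≠ c ∧ b ≠ c ∧ ∀ w, F.Adj v w ↔ w = a ∨ w = b ∨ w = c := by
    intro v
    have h := hreg v
    rw [← card_neighborFinset_eq_degree, Finset.card_eq_three] at h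
    obtain ⟨a, b, c, hab, hac, hbc, h⟩ := h
    refine ⟨a, b, c, hab, hac, hbc, fun w => ?_⟩
    rw [← mem_neighborFinset, h]; simp
  obtain ⟨x1, x2, x3, h12, h13, h23, hv⟩ := hN3 v
  have hother : ∀ x y, F.Adj v x → F.Adj x y → y ≠ v → ∃ z, F.Adj x z ∧ z ≠ v ∧ z ≠ y ∧
      ∀ w, F.Adj x w → w = v ∨ w = y ∨ w = z := by
    intro x y hx hy hyv
    obtain ⟨a, b, c, hab, hac, hbc, h⟩ := hN3 x
    have h1 := (h v).1 hx.symm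
    have h2 := (h y).1 hy
    rcases h1 with rfl | rfl | rfl <;> rcases h2 with rfl | rfl | rfl <;> try exact absurd rfl hyv
    · exact ⟨c, (h c).2 (by simp), hac.symm, hbc.symm, fun w hw => by have := (h w).1 hw; tauto⟩
    · exact ⟨b, (h b).2 (by simp), hab.symm, hbc, fun w hw => by have := (h w).1 hw; tauto⟩
    · exact ⟨c, (h c).2 (by simp), hbc.symm, hac.symm, fun w hw => by have := (h w).1 hw; tauto⟩
    · exact ⟨a, (h a).2 (by simp), hab, hac, fun w hw => by have := (h w).1 hw; tauto⟩
    · exact ⟨b, (h b).2 (by simp), hbc, hab.symm, fun w hw => by have := (h w).1 hw; tauto⟩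
    · exact ⟨a, (h a).2 (by simp), hac, hab, fun w hw => by have := (h w).1 hw; tauto⟩
  have hv1 := (hv x1).2 (by simp)
  have hv2 := (hv x2).2 (by simp)
  have hv3 := (hv x3).2 (by simp)
  -- first child of x1
  obtain ⟨a1, ha1, ha1v⟩ : ∃ a1, F.Adj x1 a1 ∧ a1 ≠ v := by
    obtain ⟨a, b, c, hab, hac, hbc, h⟩ := hN3 x1
    by_cases hav : a = v
    · exact ⟨b, (h b).2 (by simp), fun hb => hab (hav.trans hb.symm)⟩
    · exact ⟨a, (h a).2 (by simp), hav⟩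
  -- children of x are nonadjacent to the other neighbours of v
  have hch : ∀ x x' a, F.Adj v x → F.Adj v x' → x ≠ x' → F.Adj x a → a ≠ v → a ≠ x' ∧ ¬ F.Adj a x' := by
    intro x x' a hx hx' hne ha hav
    refine ⟨?_, fun h => hav (uniq x x' a v hne ha h.symm hx.symm hx'.symm)⟩
    rintro rfl
    exact tri v x a hx ha hx'
  have hcm : ∀ x x' a, F.Adj v x → F.Adj v x' → x ≠ x' → F.Adj x a → a ≠ v →
      ∃ a', F.Adj a a' ∧ F.Adj x' a' ∧ a' ≠ v := by
    intro x x' a hx hx' hne ha hav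
    obtain ⟨h1, h2⟩ := hch x x' a hx hx' hne ha hav
    obtain ⟨r, hr1, hr2⟩ := ex a x' h1 h2
    refine ⟨r, hr1, hr2, ?_⟩
    rintro rfl
    exact tri r x a hx ha hr1.symm
  obtain ⟨b1, hb1, hb1v, hb1a, hx1⟩ := hother x1 a1 hv1 ha1 ha1v
  obtain ⟨a2, h46, ha2, ha2v⟩ := hcm x1 x2 a1 hv1 hv2 h12 ha1 ha1v
  obtain ⟨a3, h48, ha3, ha3v⟩ := hcm x1 x3 a1 hv1 hv3 h13 ha1 ha1v
  obtain ⟨b2, hb2, hb2v, hb2a, hx2⟩ := hother x2 a2 hv2 ha2 ha2v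
  obtain ⟨b3, hb3, hb3v, hb3a, hx3⟩ := hother x3 a3 hv3 ha3 ha3v
  have hax : ∀ x x' a, F.Adj v x → F.Adj v x' → x ≠ x' → F.Adj x a → a ≠ v → a ≠ x' :=
    fun x x' a hx hx' hne ha hav => (hch x x' a hx hx' hne ha hav).1
  have h57 : F.Adj b1 b2 := by
    obtain ⟨r, hr1, hr2, hrv⟩ := hcm x1 x2 b1 hv1 hv2 h12 hb1 hb1v
    rcases hx2 r hr2 with rfl | rfl | rfl
    · exact absurd rfl hrv
    · exact absurd (uniq a1 b1 x1 r hb1a.symm ha1.symm hb1.symm h46 hr1)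
        (hax x2 x1 r hv2 hv1 h12.symm ha2 ha2v).symm
    · exact hr1
  have h59 : F.Adj b1 b3 := by
    obtain ⟨r, hr1, hr2, hrv⟩ := hcm x1 x3 b1 hv1 hv3 h13 hb1 hb1v
    rcases hx3 r hr2 with rfl | rfl | rfl
    · exact absurd rfl hrv
    · exact absurd (uniq a1 b1 x1 r hb1a.symm ha1.symm hb1.symm h48 hr1)
        (hax x3 x1 r hv3 hv1 h13.symm ha3 ha3v).symm
    · exact hr1
  have h69 : F.Adj a2 b3 := by
    obtain ⟨r, hr1, hr2, hrv⟩ := hcm x2 x3 a2 hv2 hv3 h23 ha2 ha2v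
    rcases hx3 r hr2 with rfl | rfl | rfl
    · exact absurd rfl hrv
    · exact (tri a1 a2 r h46 hr1 h48).elim
    · exact hr1
  have h78 : F.Adj b2 a3 := by
    obtain ⟨r, hr1, hr2, hrv⟩ := hcm x2 x3 b2 hv2 hv3 h23 hb2 hb2v
    rcases hx3 r hr2 with rfl | rfl | rfl
    · exact absurd rfl hrv
    · exact hr1
    · exact (tri b1 b2 r h57 hr1 h59).elim
  refine petersen_of_table F hcard tri ![v, x1, x2, x3, a1, b1, a2, b2, a3, b3] ?_ ?_
  · intro w
    by_cases hwv : w = v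
    · exact ⟨0, hwv.symm⟩
    by_cases hadj : F.Adj v w
    · rcases (hv w).1 hadj with rfl | rfl | rfl
      · exact ⟨1, rfl⟩
      · exact ⟨2, rfl⟩
      · exact ⟨3, rfl⟩
    · obtain ⟨r, hr1, hr2⟩ := ex v w (Ne.symm hwv) hadj
      rcases (hv r).1 hr1 with rfl | rfl | rfl
      · rcases hx1 w hr2.symm with h | rfl | rfl
        · exact absurd h hwv
        · exact ⟨4, rfl⟩
        · exact ⟨5, rfl⟩
      · rcases hx2 w hr2.symm with h | rfl | rfl
        · exact absurd h hwv
        · exact ⟨6, rfl⟩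
        · exact ⟨7, rfl⟩
      · rcases hx3 w hr2.symm with h | rfl | rfl
        · exact absurd h hwv
        · exact ⟨8, rfl⟩
        · exact ⟨9, rfl⟩
  · intro e he
    simp only [pedge, List.mem_cons, List.not_mem_nil, or_false] at he
    rcases he with rfl | rfl | rfl | rfl | rfl | rfl | rfl | rfl | rfl | rfl | rfl | rfl | rfl | rfl | rfl <;>
      assumption

/-- All degrees at least three: the Petersen graph. -/
theorem comb_deg3 {V : Type} [Fintype V] [DecidableEq V] (F : SimpleGraph V)
    [DecidableRel F.Adj] (hmin : ∀ v, 3 ≤ F.degree v)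
    (ex : ∀ p q, p ≠ q → ¬ F.Adj p q → ∃ r, F.Adj p r ∧ F.Adj q r)
    (hsum : ∑ v, F.degree v + 10 ≤ 4 * Fintype.card V) :
    Fintype.card V = 10 ∧ Nonempty (F ≃g petersen) := by
  -- key local fact
  have key : ∀ v, F.degree v = 3 → (∀ w, w ≠ v → ¬ F.Adj v w → F.degree w = 3 ∧
      (F.neighborFinset v ∩ F.neighborFinset w).card = 1) ∧
      (∀ x ∈ F.neighborFinset v, ∀ y ∈ F.neighborFinset v, ¬ F.Adj x y) := by
    intro v hv
    set N := F.neighborFinset v with hN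
    have hNc : N.card = 3 := by rw [hN, card_neighborFinset_eq_degree, hv]
    set O := Finset.univ.filter (fun w => w ≠ v ∧ ¬ F.Adj v w) with hO
    have hvN : v ∉ N := by simp [hN]
    -- partition
    have hpart : ∀ f : V → ℕ, ∑ w, f w = f v + ∑ w ∈ N, f w + ∑ w ∈ O, f w := by
      intro f
      have h1 : (Finset.univ : Finset V) = insert v (N ∪ O) := by
        ext w; simp only [hN, hO, Finset.mem_univ, Finset.mem_insert, Finset.mem_union, mem_neighborFinset, Finset.mem_filter, true_and, true_iff]
        tauto
      rw [h1, Finset.sum_insert, Finset.sum_union, add_assoc]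
      · rw [Finset.disjoint_left]; intro w h1 h2
        simp only [hN, hO, mem_neighborFinset, Finset.mem_filter] at h1 h2
        exact h2.2.2 h1
      · simp [hN, hO]
    have hcardV : Fintype.card V = 4 + O.card := by
      have := hpart (fun _ => 1)
      simp only [Finset.sum_const, smul_eq_mul, mul_one, Finset.card_univ, hNc] at this
      omega
    have hdegcount : ∀ x, F.degree x = ∑ w, if F.Adj x w then 1 else 0 := by
      intro x
      rw [← card_neighborFinset_eq_degree, neighborFinset_eq_filter, Finset.card_filter]
    have hxs : ∑ x ∈ N, F.degree x = 3 + ∑ x ∈ N, (∑ y ∈ N, if F.Adj x y then 1 else 0) +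
        ∑ w ∈ O, (N ∩ F.neighborFinset w).card := by
      have h1 : ∀ x ∈ N, F.degree x = 1 + (∑ y ∈ N, if F.Adj x y then 1 else 0) + ∑ w ∈ O, if F.Adj x w then 1 else 0 := by
        intro x hx
        rw [hdegcount, hpart, if_pos]
        rw [hN, mem_neighborFinset] at hx
        exact hx.symm
      rw [Finset.sum_congr rfl h1, Finset.sum_add_distrib, Finset.sum_add_distrib, Finset.sum_const, hNc]
      congr 1
      rw [Finset.sum_comm]
      refine Finset.sum_congr rfl fun w _ => ?_
      rw [← Finset.card_filter]
      congr 1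
      ext y; simp [F.adj_comm]
    have hO1 : ∀ w ∈ O, 1 ≤ (N ∩ F.neighborFinset w).card := by
      intro w hw
      rw [hO, Finset.mem_filter] at hw
      obtain ⟨r, h1, h2⟩ := ex v w hw.2.1.symm hw.2.2
      exact Finset.card_pos.2 ⟨r, by simp [hN, h1, h2]⟩
    have hO2 : ∀ w ∈ O, 4 ≤ F.degree w + (N ∩ F.neighborFinset w).card := by
      intro w hw
      have := hO1 w hw
      have := hmin w
      omega
    have htot : ∑ w, F.degree w = 6 + ∑ x ∈ N, (∑ y ∈ N, if F.Adj x y then 1 else 0) +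
        ∑ w ∈ O, (F.degree w + (N ∩ F.neighborFinset w).card) := by
      rw [hpart, hxs, hv, Finset.sum_add_distrib]; ring
    have hlow : ∑ w ∈ O, 4 ≤ ∑ w ∈ O, (F.degree w + (N ∩ F.neighborFinset w).card) :=
      Finset.sum_le_sum hO2
    have hlow' : O.card * 4 ≤ ∑ w ∈ O, (F.degree w + (N ∩ F.neighborFinset w).card) := by
      simpa using hlow
    have heq : ∑ w ∈ O, 4 = ∑ w ∈ O, (F.degree w + (N ∩ F.neighborFinset w).card) := by
      rw [Finset.sum_const, smul_eq_mul]; omega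
    have hz : ∑ x ∈ N, (∑ y ∈ N, if F.Adj x y then 1 else 0) = 0 := by omega
    rw [Finset.sum_eq_sum_iff_of_le hO2] at heq
    constructor
    · intro w hw1 hw2
      have hwO : w ∈ O := by rw [hO]; simp [hw1, hw2]
      have h1 := heq w hwO
      have h2 := hO1 w hwO
      have h3 := hmin w
      omega
    · intro x hx y hy hxy
      rw [Finset.sum_eq_zero_iff] at hz
      have := hz x hx
      rw [Finset.sum_eq_zero_iff] at this
      have := this y hy
      simp [hxy] at this
  -- some vertex of degree three
  obtain ⟨v, hv⟩ : ∃ v, F.degree v = 3 := by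
    by_contra h
    push Not at h
    have : ∑ v : V, 4 ≤ ∑ v, F.degree v := Finset.sum_le_sum fun v _ => by
      have := hmin v; have := h v; omega
    simp only [Finset.sum_const, Finset.card_univ, smul_eq_mul] at this
    omega
  have hreg : ∀ w, F.degree w = 3 := by
    intro x
    by_cases hxv : x = v
    · rw [hxv, hv]
    by_cases hadj : F.Adj v x
    swap
    · exact ((key v hv).1 x hxv hadj).1
    -- another neighbour of v
    obtain ⟨x', hx', hne⟩ : ∃ x' ∈ F.neighborFinset v, x' ≠ x := by
      apply Finset.exists_mem_ne
      rw [card_neighborFinset_eq_degree, hv]; norm_num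
    have hx'v : F.Adj v x' := by simpa using hx'
    obtain ⟨w, hw, hwv⟩ : ∃ w ∈ F.neighborFinset x', w ≠ v := by
      apply Finset.exists_mem_ne
      rw [card_neighborFinset_eq_degree]; have := hmin x'; omega
    have hwx' : F.Adj x' w := by simpa using hw
    have hvw : ¬ F.Adj v w := fun h => (key v hv).2 x' hx' w (by simpa using h) hwx'
    obtain ⟨hw3, hw1⟩ := (key v hv).1 w hwv hvw
    have hwx : ¬ F.Adj w x := by
      intro h
      rw [Finset.card_eq_one] at hw1
      obtain ⟨a, ha⟩ := hw1
      have h1 : x ∈ ({a} : Finset V) := by rw [← ha]; simp [hadj, h]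
      have h2 : x' ∈ ({a} : Finset V) := by rw [← ha]; simp [hx'v, hwx'.symm]
      simp only [Finset.mem_singleton] at h1 h2
      exact hne (h2.trans h1.symm)
    have hne2 : x ≠ w := by
      rintro rfl
      exact hvw hadj
    exact ((key w hw3).1 x hne2 hwx).1
  have hcard : Fintype.card V = 10 := by
    have hs : ∑ v, F.degree v = Fintype.card V * 3 := by
      rw [Finset.sum_congr rfl (fun v _ => hreg v)]; simp
    have h1 : (F.neighborFinset v).card = 3 := by rw [card_neighborFinset_eq_degree, hv]
    obtain ⟨x, hx⟩ : (F.neighborFinset v).Nonempty := Finset.card_pos.1 (by omega)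
    have htot : ∑ w, F.degree w = 4 * Fintype.card V - 10 ∧ 10 ≤ 4 * Fintype.card V := by
      refine ⟨?_, by omega⟩
      -- recompute the lower bound
      set N := F.neighborFinset v with hN
      have hlow : Fintype.card V ≤ 10 := by
        have hcov : (Finset.univ : Finset V) ⊆ insert v N ∪ N.biUnion (fun x => (F.neighborFinset x).erase v) := by
          intro w _
          by_cases hwv : w = v
          · simp [hwv]
          by_cases hadj : F.Adj v w
          · simp [hN, hadj]
          · obtain ⟨r, h1, h2⟩ := ex v w (Ne.symm hwv) hadj
            refine Finset.mem_union_right _ (Finset.mem_biUnion.2 ⟨r, by simp [hN, h1], ?_⟩)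
            simp [hwv, h2.symm]
        have h2 := Finset.card_le_card hcov
        have h3 := Finset.card_union_le (insert v N) (N.biUnion (fun x => (F.neighborFinset x).erase v))
        have h4 := Finset.card_insert_le v N
        have h5 : (N.biUnion (fun x => (F.neighborFinset x).erase v)).card ≤ N.card * 2 := by
          apply Finset.card_biUnion_le_card_mul
          intro x hx
          have hvx : v ∈ F.neighborFinset x := by
            rw [hN, mem_neighborFinset] at hx
            simpa using hx.symm
          rw [Finset.card_erase_of_mem hvx, card_neighborFinset_eq_degree, hreg]
        rw [Finset.card_univ] at h2
        omega
      omega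
    omega
  refine ⟨hcard, petersen_of_srg F hcard hreg ?_ ex ?_⟩
  · intro p q r hpq hqr hpr
    exact (key p (hreg p)).2 q (by simpa using hpq) r (by simpa using hpr) hqr
  · intro p q r r' hpq h1 h2 h3 h4
    have hn : ¬ F.Adj p q := fun h => (key p (hreg p)).2 q (by simpa using h) r (by simpa using h1) h2
    have hc := ((key p (hreg p)).1 q hpq.symm hn).2
    rw [Finset.card_eq_one] at hc
    obtain ⟨a, ha⟩ := hc
    have e1 : r ∈ ({a} : Finset V) := by rw [← ha]; simp [h1, h2]
    have e2 : r' ∈ ({a} : Finset V) := by rw [← ha]; simp [h3, h4]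
    simp only [Finset.mem_singleton] at e1 e2
    exact e1.trans e2.symm

end CT
open SimpleGraph

namespace CT

/-- blow-up of a small pattern -/
def c5 (i j : Fin 5) : Bool := (i, j) ∈ [((0:Fin 5),(1:Fin 5)),(1,0),(1,4),(4,1),(4,2),(2,4),(2,3),(3,2),(3,0),(0,3)]

def c7 (i j : Fin 7) : Bool := (i, j) ∈ [((1:Fin 7),(2:Fin 7)),(1,3),(2,3),(0,4),(0,5),(0,6),(1,4),(2,5),(3,6),
  (2,1),(3,1),(3,2),(4,0),(5,0),(6,0),(4,1),(5,2),(6,3)]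

structure F1 {V : Type} (F : SimpleGraph V) (f : V → Fin 5) : Prop where
  adj : ∀ u v, F.Adj u v ↔ c5 (f u) (f v) = true
  h0 : ∃! v, f v = 0
  h1 : ∃! v, f v = 1
  h2 : ∃! v, f v = 2

structure F2 {V : Type} (F : SimpleGraph V) (f : V → Fin 7) : Prop where
  adj : ∀ u v, F.Adj u v ↔ c7 (f u) (f v) = true
  h0 : ∃! v, f v = 0
  h1 : ∃! v, f v = 1
  h2 : ∃! v, f v = 2
  h3 : ∃! v, f v = 3

theorem parent_lemma {V : Type} [DecidableEq V] (F : SimpleGraph V) [DecidableRel F.Adj]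
    (R0 D : Finset V) (r : V) (hrR : r ∈ R0) (hD : D ⊆ R0) (hrD : r ∉ D)
    (h : ∀ d ∈ D, F.Adj d r ∨ ∃ w ∈ R0, F.Adj d w ∧ F.Adj w r) :
    ∃ par : V → V, (∀ d ∈ D, F.Adj d r → par d = r) ∧
      (∀ d ∈ D, ¬ F.Adj d r → par d ∈ R0 ∧ F.Adj d (par d) ∧ F.Adj (par d) r) ∧
      2 * D.card ≤ ((R0 ×ˢ R0).filter (fun e => F.Adj e.1 e.2)).card ∧
      (((R0 ×ˢ R0).filter (fun e => F.Adj e.1 e.2)).card ≤ 2 * D.card →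
        ∀ p ∈ R0, ∀ q ∈ R0, F.Adj p q → (p ∈ D ∧ par p = q) ∨ (q ∈ D ∧ par q = p)) := by
  have hex : ∀ d, ∃ w, d ∈ D → (F.Adj d r → w = r) ∧ (¬ F.Adj d r → w ∈ R0 ∧ F.Adj d w ∧ F.Adj w r) := by
    intro d
    by_cases hd : d ∈ D
    · by_cases hr : F.Adj d r
      · exact ⟨r, fun _ => ⟨fun _ => rfl, fun h => absurd hr h⟩⟩
      · rcases h d hd with h | ⟨w, h1, h2, h3⟩
        · exact absurd h hr
        · exact ⟨w, fun _ => ⟨fun h => absurd h hr, fun _ => ⟨h1, h2, h3⟩⟩⟩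
    · exact ⟨r, fun h => absurd h hd⟩
  choose par hpar using hex
  set E := (R0 ×ˢ R0).filter (fun e => F.Adj e.1 e.2) with hE
  let E1 := D.image (fun d => (d, par d))
  let E2 := D.image (fun d => (par d, d))
  have hadj : ∀ d ∈ D, par d ∈ R0 ∧ F.Adj d (par d) := by
    intro d hd
    by_cases hr : F.Adj d r
    · rw [(hpar d hd).1 hr]; exact ⟨hrR, hr⟩
    · exact ⟨((hpar d hd).2 hr).1, ((hpar d hd).2 hr).2.1⟩
  have c1 : E1.card = D.card := Finset.card_image_of_injective _ (fun a b h => (Prod.mk.inj h).1)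
  have c2 : E2.card = D.card := Finset.card_image_of_injective _ (fun a b h => (Prod.mk.inj h).2)
  have hdis : Disjoint E1 E2 := by
    rw [Finset.disjoint_left]
    intro e h1 h2
    obtain ⟨d, hd, rfl⟩ := Finset.mem_image.1 h1
    obtain ⟨d', hd', he⟩ := Finset.mem_image.1 h2
    obtain ⟨e1, e2⟩ := Prod.mk.inj he
    by_cases hr : F.Adj d r
    · rw [(hpar d hd).1 hr] at e2
      exact hrD (e2 ▸ hd')
    · have h3 := ((hpar d hd).2 hr).2.2
      rw [← e2] at h3
      rw [(hpar d' hd').1 h3] at e1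
      exact hrD (e1 ▸ hd)
  have hsub : E1 ∪ E2 ⊆ E := by
    intro e he
    rcases Finset.mem_union.1 he with he | he
    · obtain ⟨d, hd, rfl⟩ := Finset.mem_image.1 he
      simp [hE, hD hd, hadj d hd]
    · obtain ⟨d, hd, rfl⟩ := Finset.mem_image.1 he
      simp [hE, hD hd, hadj d hd, (hadj d hd).2.symm]
  have hcu : (E1 ∪ E2).card = 2 * D.card := by
    rw [Finset.card_union_of_disjoint hdis, c1, c2]; ring
  refine ⟨par, fun d hd => (hpar d hd).1, fun d hd => (hpar d hd).2, ?_, ?_⟩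
  · rw [← hcu]; exact Finset.card_le_card hsub
  · intro hle p hp q hq hpq
    have heq := Finset.eq_of_subset_of_card_le hsub (by omega)
    have : (p, q) ∈ E1 ∪ E2 := by rw [heq, hE]; simp [hp, hq, hpq]
    rcases Finset.mem_union.1 this with he | he
    · obtain ⟨d, hd, he⟩ := Finset.mem_image.1 he
      obtain ⟨rfl, rfl⟩ := Prod.mk.inj he
      exact Or.inl ⟨hd, rfl⟩
    · obtain ⟨d, hd, he⟩ := Finset.mem_image.1 he
      obtain ⟨rfl, rfl⟩ := Prod.mk.inj he
      exact Or.inr ⟨hd, rfl⟩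

set_option maxHeartbeats 4000000 in
theorem deg2_main {V : Type} [Fintype V] [DecidableEq V] (F : SimpleGraph V)
    [DecidableRel F.Adj]
    (ex : ∀ p q, p ≠ q → ¬ F.Adj p q → ∃ r, F.Adj p r ∧ F.Adj q r)
    (v x y : V) (hxy : x ≠ y) (hv : ∀ w, F.Adj v w ↔ w = x ∨ w = y)
    (R0 B C : Finset V) (hR0 : ∀ w, w ∈ R0 ↔ w ≠ v ∧ w ≠ x ∧ w ≠ y)
    (hB : ∀ w, w ∈ B ↔ w ∈ R0 ∧ ¬ F.Adj y w) (hC : ∀ w, w ∈ C ↔ w ∈ R0 ∧ ¬ F.Adj x w)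
    (hcnt : ((R0 ×ˢ R0).filter (fun e => F.Adj e.1 e.2)).card + (if F.Adj x y then 2 else 0) + 2 ≤
      2 * (B.card + C.card))
    (hCne : C.Nonempty)
    (b0 : V) (hb0 : b0 ∈ B) (hb0d : (R0.filter (fun w => F.Adj b0 w)).card ≤ 1) :
    (∃ f, F1 F f) ∨ ∃ f, F2 F f := by
  have hvx : v ≠ x := by rintro rfl; exact F.loopless.irrefl _ ((hv v).2 (Or.inl rfl))
  have hvy : v ≠ y := by rintro rfl; exact F.loopless.irrefl _ ((hv v).2 (Or.inr rfl))
  have hnv : ∀ w ∈ R0, ¬ F.Adj w v := by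
    intro w hw h
    have := (hv w).1 h.symm
    have := (hR0 w).1 hw
    tauto
  have hdich : ∀ w ∈ R0, F.Adj x w ∨ F.Adj y w := by
    intro w hw
    obtain ⟨r, h1, h2⟩ := ex v w ((hR0 w).1 hw).1.symm (fun h => hnv w hw h.symm)
    rcases (hv r).1 h1 with rfl | rfl
    · exact Or.inl h2.symm
    · exact Or.inr h2.symm
  have hBR : ∀ w ∈ B, w ∈ R0 := fun w hw => ((hB w).1 hw).1
  have hCR : ∀ w ∈ C, w ∈ R0 := fun w hw => ((hC w).1 hw).1
  have hBy : ∀ w ∈ B, ¬ F.Adj y w := fun w hw => ((hB w).1 hw).2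
  have hCx : ∀ w ∈ C, ¬ F.Adj x w := fun w hw => ((hC w).1 hw).2
  have hBx : ∀ w ∈ B, F.Adj x w := fun w hw => (hdich w (hBR w hw)).resolve_right (hBy w hw)
  have hCy : ∀ w ∈ C, F.Adj y w := fun w hw => (hdich w (hCR w hw)).resolve_left (hCx w hw)
  have hBC : Disjoint B C := Finset.disjoint_left.2 fun w h1 h2 => hCx w h2 (hBx w h1)
  have hR0mem : ∀ w, w ≠ v → w ≠ x → w ≠ y → w ∈ R0 := fun w h1 h2 h3 => (hR0 w).2 ⟨h1, h2, h3⟩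
  have hBCadj : ∀ b ∈ B, ∀ c ∈ C, F.Adj b c ∨ ∃ w ∈ R0, F.Adj b w ∧ F.Adj w c := by
    intro b hb c hc
    by_cases hbc : F.Adj b c
    · exact Or.inl hbc
    right
    obtain ⟨w, h1, h2⟩ := ex b c (fun h => Finset.disjoint_left.1 hBC hb (h ▸ hc)) hbc
    refine ⟨w, hR0mem w ?_ ?_ ?_, h1, h2.symm⟩
    · rintro rfl; exact hnv b (hBR b hb) h1
    · rintro rfl; exact hCx c hc h2.symm
    · rintro rfl; exact hBy b hb h1.symm
  -- the unique neighbour of b0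
  obtain ⟨u, huR, hub0, hu⟩ : ∃ u ∈ R0, F.Adj b0 u ∧ ∀ w ∈ R0, F.Adj b0 w → w = u := by
    obtain ⟨c, hc⟩ := hCne
    have : ∃ u ∈ R0, F.Adj b0 u := by
      rcases hBCadj b0 hb0 c hc with h | ⟨w, h1, h2, h3⟩
      · exact ⟨c, hCR c hc, h⟩
      · exact ⟨w, h1, h2⟩
    obtain ⟨u, h1, h2⟩ := this
    refine ⟨u, h1, h2, fun w hw hbw => ?_⟩
    exact Finset.card_le_one.1 hb0d w (by simp [hw, hbw]) u (by simp [h1, h2])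
  have huC : ∀ c ∈ C, c ≠ u → F.Adj c u := by
    intro c hc hcu
    rcases hBCadj b0 hb0 c hc with h | ⟨w, h1, h2, h3⟩
    · exact absurd (hu c (hCR c hc) h) hcu
    · rw [hu w h1 h2] at h3; exact h3.symm
  have hBCcard : (B ∪ C).card = B.card + C.card := Finset.card_union_of_disjoint hBC
  have huinC : u ∈ C := by
    by_contra huC'
    obtain ⟨c0, hc0⟩ := hCne
    have hc0u : c0 ≠ u := fun h => huC' (h ▸ hc0)
    let D := insert u ((B ∪ C).erase c0)
    have hDdist : ∀ d ∈ D, F.Adj d c0 ∨ ∃ w ∈ R0, F.Adj d w ∧ F.Adj w c0 := by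
      intro d hd
      rcases Finset.mem_insert.1 hd with rfl | hd
      · exact Or.inl (huC c0 hc0 hc0u).symm
      · obtain ⟨hne, hd⟩ := Finset.mem_erase.1 hd
        rcases Finset.mem_union.1 hd with hd | hd
        · exact hBCadj d hd c0 hc0
        · have hdu : d ≠ u := fun h => huC' (h ▸ hd)
          exact Or.inr ⟨u, huR, huC d hd hdu, (huC c0 hc0 hc0u).symm⟩
    have hDR : D ⊆ R0 := by
      intro d hd
      rcases Finset.mem_insert.1 hd with rfl | hd
      · exact huR
      · rcases Finset.mem_union.1 (Finset.mem_of_mem_erase hd) with hd | hd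
        · exact hBR d hd
        · exact hCR d hd
    have hcD : c0 ∉ D := by simp [D, hc0u]
    obtain ⟨par, -, -, hle, -⟩ := parent_lemma F R0 D c0 (hCR c0 hc0) hDR hcD hDdist
    have hec : ((B ∪ C).erase c0).card = B.card + C.card - 1 := by
      rw [Finset.card_erase_of_mem (Finset.mem_union_right _ hc0), hBCcard]
    by_cases huB : u ∈ B
    · have hDc : D = (B ∪ C).erase c0 := Finset.insert_eq_of_mem (by simp [huB, hc0u.symm])
      rw [hDc, hec] at hle
      have hnxy : ¬ F.Adj x y := by
        intro h
        rw [if_pos h] at hcnt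
        omega
      have hb0y : b0 ≠ y := ((hR0 b0).1 (hBR b0 hb0)).2.2
      obtain ⟨w, h1, h2⟩ := ex b0 y hb0y (fun h => hBy b0 hb0 h.symm)
      have hwx : w ≠ x := by rintro rfl; exact hnxy h2.symm
      have hwv : w ≠ v := by rintro rfl; exact hnv b0 (hBR b0 hb0) h1
      have hwy : w ≠ y := by rintro rfl; exact F.loopless.irrefl _ h2
      have hwu := hu w (hR0mem w hwv hwx hwy) h1
      rw [hwu] at h2
      exact hBy u huB h2
    · have hDc : D.card = B.card + C.card - 1 + 1 := by
        rw [← hec]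
        exact Finset.card_insert_of_notMem (by simp [huB, huC'])
      have : 0 < C.card := Finset.card_pos.2 ⟨c0, hc0⟩
      rw [hDc] at hle
      omega
  -- main structure
  let D := (B ∪ C).erase u
  have hDmem : ∀ d, d ∈ D ↔ d ≠ u ∧ (d ∈ B ∨ d ∈ C) := by intro d; simp [D]
  have hDR : D ⊆ R0 := by
    intro d hd
    rcases ((hDmem d).1 hd).2 with hd | hd
    · exact hBR d hd
    · exact hCR d hd
  have hDdist : ∀ d ∈ D, F.Adj d u ∨ ∃ w ∈ R0, F.Adj d w ∧ F.Adj w u := by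
    intro d hd
    obtain ⟨hne, hd | hd⟩ := (hDmem d).1 hd
    · exact hBCadj d hd u huinC
    · exact Or.inl (huC d hd hne)
  obtain ⟨par, hp1, hp2, hle, heq⟩ := parent_lemma F R0 D u huR hDR (by simp [D]) hDdist
  have hDc : D.card = B.card + C.card - 1 := by
    rw [← hBCcard]
    exact Finset.card_erase_of_mem (Finset.mem_union_right _ huinC)
  have hCpos : 0 < C.card := Finset.card_pos.2 ⟨u, huinC⟩
  have hnxy : ¬ F.Adj x y := by
    intro h
    rw [if_pos h] at hcnt
    omega
  have hedge := heq (by rw [if_neg hnxy] at hcnt; omega)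
  have huB : u ∉ B := fun h => Finset.disjoint_left.1 hBC h huinC
  have hparC : ∀ c ∈ C, c ≠ u → par c = u := fun c hc hcu =>
    hp1 c ((hDmem c).2 ⟨hcu, Or.inr hc⟩) (huC c hc hcu)
  -- A has no edges inside R0
  have hA : ∀ a ∈ R0, a ∉ B → a ∉ C → ∀ q ∈ R0, ¬ F.Adj a q := by
    intro a ha haB haC q hq haq
    have haD : a ∉ D := fun h => by rcases ((hDmem a).1 h).2 with h | h <;> contradiction
    have hau : ¬ F.Adj a u := by
      intro h
      rcases hedge a ha u huR h with h | h
      · exact haD h.1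
      · exact ((hDmem u).1 h.1).1 rfl
    rcases hedge a ha q hq haq with h | ⟨hqD, hpq⟩
    · exact haD h.1
    · by_cases hqu : F.Adj q u
      · rw [hp1 q hqD hqu] at hpq
        exact haC (hpq ▸ huinC)
      · have := (hp2 q hqD hqu).2.2
        rw [hpq] at this
        exact hau this
  -- every b in B has a neighbour in C
  have hBnC : ∀ b ∈ B, ∃ c ∈ C, F.Adj b c := by
    intro b hb
    have hby : b ≠ y := ((hR0 b).1 (hBR b hb)).2.2
    obtain ⟨w, h1, h2⟩ := ex b y hby (fun h => hBy b hb h.symm)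
    have hwx : w ≠ x := by rintro rfl; exact hnxy h2.symm
    have hwv : w ≠ v := by rintro rfl; exact hnv b (hBR b hb) h1
    have hwy : w ≠ y := by rintro rfl; exact F.loopless.irrefl _ h2
    have hwR := hR0mem w hwv hwx hwy
    by_cases hwC : w ∈ C
    · exact ⟨w, hwC, h1⟩
    by_cases hwB : w ∈ B
    · exact absurd h2 (hBy w hwB)
    · exact absurd h1.symm (hA w hwR hwB hwC b (hBR b hb))
  have hCnB : ∀ c ∈ C, ∃ b ∈ B, F.Adj c b := by
    intro c hc
    have hcx : c ≠ x := ((hR0 c).1 (hCR c hc)).2.1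
    obtain ⟨w, h1, h2⟩ := ex c x hcx (fun h => hCx c hc h.symm)
    have hwx : w ≠ x := by rintro rfl; exact F.loopless.irrefl _ h2
    have hwv : w ≠ v := by rintro rfl; exact hnv c (hCR c hc) h1
    have hwy : w ≠ y := by rintro rfl; exact hnxy h2
    have hwR := hR0mem w hwv hwx hwy
    by_cases hwB : w ∈ B
    · exact ⟨w, hwB, h1⟩
    by_cases hwC : w ∈ C
    · exact absurd h2 (hCx w hwC)
    · exact absurd h1.symm (hA w hwR hwB hwC c (hCR c hc))
  have hBD : ∀ b ∈ B, b ∈ D := fun b hb => (hDmem b).2 ⟨fun h => huB (h ▸ hb), Or.inl hb⟩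
  have hedgeBC : ∀ b ∈ B, ∀ c ∈ C, F.Adj b c → par b = c := by
    intro b hb c hc hbc
    rcases hedge b (hBR b hb) c (hCR c hc) hbc with h | ⟨hcD, h⟩
    · exact h.2
    · have hcu : c ≠ u := ((hDmem c).1 hcD).1
      rw [hparC c hc hcu] at h
      exact absurd (h ▸ hb) huB
  have hparB : ∀ b ∈ B, par b ∈ C ∧ F.Adj b (par b) := by
    intro b hb
    obtain ⟨c, hc, hbc⟩ := hBnC b hb
    rw [hedgeBC b hb c hc hbc]
    exact ⟨hc, hbc⟩
  have hBedge : ∀ b ∈ B, ∀ w ∈ R0, F.Adj b w → w = par b := by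
    intro b hb w hw hbw
    rcases hedge b (hBR b hb) w hw hbw with h | ⟨hwD, h⟩
    · exact h.2.symm
    · rcases ((hDmem w).1 hwD).2 with hw' | hw'
      · have := (hparB w hw').1
        rw [h] at this
        exact absurd this (fun h' => Finset.disjoint_left.1 hBC hb h')
      · exact (hedgeBC b hb w hw' hbw).symm
  have hCone : ∀ c ∈ C, ∀ c' ∈ C, c ≠ u → c' ≠ u → c = c' := by
    intro c hc c' hc' hcu hc'u
    by_contra hne
    obtain ⟨b, hb, hcb⟩ := hCnB c hc
    have hpb := hedgeBC b hb c hc hcb.symm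
    rcases hBCadj b hb c' hc' with h | ⟨w, hw, h1, h2⟩
    · exact hne (hpb.symm.trans (hedgeBC b hb c' hc' h))
    · have hwp := hBedge b hb w hw h1
      rw [hwp, hpb] at h2
      rcases hedge c (hCR c hc) c' (hCR c' hc') h2 with h | h
      · rw [hparC c hc hcu] at h; exact hc'u h.2.symm
      · rw [hparC c' hc' hc'u] at h; exact hcu h.2.symm
  -- full description of adjacency
  have hx_adj : ∀ w, F.Adj x w ↔ w = v ∨ (w ∈ R0 ∧ w ∉ C) := by
    intro w
    constructor
    · intro h
      by_cases hwv : w = v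
      · exact Or.inl hwv
      have hwx : w ≠ x := by rintro rfl; exact F.loopless.irrefl _ h
      have hwy : w ≠ y := by rintro rfl; exact hnxy h
      exact Or.inr ⟨hR0mem w hwv hwx hwy, fun hc => hCx w hc h⟩
    · rintro (rfl | ⟨h1, h2⟩)
      · exact ((hv x).2 (Or.inl rfl)).symm
      · by_contra h
        exact h2 ((hC w).2 ⟨h1, h⟩)
  have hy_adj : ∀ w, F.Adj y w ↔ w = v ∨ (w ∈ R0 ∧ w ∉ B) := by
    intro w
    constructor
    · intro h
      by_cases hwv : w = v
      · exact Or.inl hwv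
      have hwy : w ≠ y := by rintro rfl; exact F.loopless.irrefl _ h
      have hwx : w ≠ x := by rintro rfl; exact hnxy h.symm
      exact Or.inr ⟨hR0mem w hwv hwx hwy, fun hc => hBy w hc h⟩
    · rintro (rfl | ⟨h1, h2⟩)
      · exact ((hv y).2 (Or.inr rfl)).symm
      · by_contra h
        exact h2 ((hB w).2 ⟨h1, h⟩)
  have hxR : x ∉ R0 := fun h => ((hR0 x).1 h).2.1 rfl
  have hyR : y ∉ R0 := fun h => ((hR0 y).1 h).2.2 rfl
  have hvR : v ∉ R0 := fun h => ((hR0 v).1 h).1 rfl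
  have hux : u ≠ x := fun h => hxR (h ▸ huR)
  have huy : u ≠ y := fun h => hyR (h ▸ huR)
  have huv : u ≠ v := fun h => hvR (h ▸ huR)
  by_cases hCu : ∃ c ∈ C, c ≠ u
  · right
    obtain ⟨c, hc, hcu⟩ := hCu
    have hCeq : ∀ w, w ∈ C ↔ w = u ∨ w = c := by
      intro w
      constructor
      · intro hw
        by_cases hwu : w = u
        · exact Or.inl hwu
        · exact Or.inr (hCone w hw c hc hwu hcu)
      · rintro (rfl | rfl) <;> assumption
    have hcR := hCR c hc
    have hcx : c ≠ x := fun h => hxR (h ▸ hcR)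
    have hcy : c ≠ y := fun h => hyR (h ▸ hcR)
    have hcv : c ≠ v := fun h => hvR (h ▸ hcR)
    have hcB : c ∉ B := fun h => Finset.disjoint_left.1 hBC h hc
    have hcuadj := huC c hc hcu
    let f : V → Fin 7 := fun w => if w = x then 0 else if w = y then 1 else if w = u then 2 else
      if w = c then 3 else if w ∈ B then (if par w = u then 5 else 6) else 4
    have hfx : f x = 0 := by simp [f]
    have hfy : f y = 1 := by simp [f, hxy.symm]
    have hfu : f u = 2 := by simp [f, hux, huy]
    have hfc : f c = 3 := by simp [f, hcx, hcy, hcu]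
    have hcase : ∀ w, w = x ∨ w = y ∨ w = u ∨ w = c ∨ (w ∈ B ∧ par w = u ∧ f w = 5) ∨
        (w ∈ B ∧ par w = c ∧ f w = 6) ∨ (w = v ∧ f w = 4) ∨ (w ∈ R0 ∧ w ∉ B ∧ w ∉ C ∧ f w = 4) := by
      intro w
      by_cases h1 : w = x; · exact Or.inl h1
      by_cases h2 : w = y; · exact Or.inr (Or.inl h2)
      by_cases h3 : w = u; · exact Or.inr (Or.inr (Or.inl h3))
      by_cases h4 : w = c; · exact Or.inr (Or.inr (Or.inr (Or.inl h4)))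
      by_cases h5 : w ∈ B
      · have := (hCeq _).1 (hparB w h5).1
        rcases this with h6 | h6
        · have : f w = 5 := by simp [f, h1, h2, h3, h4, h5, h6]
          exact Or.inr (Or.inr (Or.inr (Or.inr (Or.inl ⟨h5, h6, this⟩))))
        · have : f w = 6 := by simp [f, h1, h2, h3, h4, h5, h6, hcu]
          exact Or.inr (Or.inr (Or.inr (Or.inr (Or.inr (Or.inl ⟨h5, h6, this⟩)))))
      · have h7 : f w = 4 := by simp [f, h1, h2, h3, h4, h5]
        by_cases h6 : w = v
        · exact Or.inr (Or.inr (Or.inr (Or.inr (Or.inr (Or.inr (Or.inl ⟨h6, h7⟩))))))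
        · have := hR0mem w h6 h1 h2
          have hwC : w ∉ C := by rw [hCeq]; exact not_or.2 ⟨h3, h4⟩
          exact Or.inr (Or.inr (Or.inr (Or.inr (Or.inr (Or.inr (Or.inr (⟨this, h5, hwC, h7⟩)))))))
    have hvB : v ∉ B := fun h => hvR (hBR v h)
    have hvC : v ∉ C := fun h => hvR (hCR v h)
    have hxC : x ∉ C := fun h => hxR (hCR x h)
    have hyB : y ∉ B := fun h => hyR (hBR y h)
    -- adjacency from each type, one side at a time
    have h0 : ∀ w, F.Adj x w ↔ c7 0 (f w) = true := by
      intro w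
      rw [hx_adj]
      rcases hcase w with rfl | rfl | rfl | rfl | ⟨h1, h2, h3⟩ | ⟨h1, h2, h3⟩ | ⟨rfl, h3⟩ | ⟨h1, h2, h2', h3⟩
      · rw [hfx]; simp [hvx.symm, hxR, c7]
      · rw [hfy]; simp [hvy.symm, hyR, c7]
      · rw [hfu]; simp [huv, huinC, c7]
      · rw [hfc]; simp [hcv, hc, c7]
      · rw [h3]; simp [hBR w h1, fun h => Finset.disjoint_left.1 hBC h1 h, c7]
      · rw [h3]; simp [hBR w h1, fun h => Finset.disjoint_left.1 hBC h1 h, c7]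
      · rw [h3]; simp [c7]
      · rw [h3]; simp [h1, h2', c7]
    have h1' : ∀ w, F.Adj y w ↔ c7 1 (f w) = true := by
      intro w
      rw [hy_adj]
      rcases hcase w with rfl | rfl | rfl | rfl | ⟨h1, h2, h3⟩ | ⟨h1, h2, h3⟩ | ⟨rfl, h3⟩ | ⟨h1, h2, h2', h3⟩
      · rw [hfx]; simp [hvx.symm, hxR, c7]
      · rw [hfy]; simp [hvy.symm, hyR, c7]
      · rw [hfu]; simp [huR, huB, c7]
      · rw [hfc]; simp [hcR, hcB, c7]
      · rw [h3]; have hwv : w ≠ v := (fun h => hvB (h ▸ h1)); simp [h1, hwv, c7]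
      · rw [h3]; have hwv : w ≠ v := (fun h => hvB (h ▸ h1)); simp [h1, hwv, c7]
      · rw [h3]; simp [c7]
      · rw [h3]; simp [h1, h2, c7]
    have hBnu : ∀ b ∈ B, ∀ d ∈ C, F.Adj b d ↔ par b = d := by
      intro b hb d hd
      refine ⟨hedgeBC b hb d hd, ?_⟩
      rintro rfl
      exact (hparB b hb).2
    have h2' : ∀ w, F.Adj u w ↔ c7 2 (f w) = true := by
      intro w
      rcases hcase w with rfl | rfl | rfl | rfl | ⟨h1, h2, h3⟩ | ⟨h1, h2, h3⟩ | ⟨rfl, h3⟩ | ⟨h1, h2, h2', h3⟩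
      · rw [hfx, F.adj_comm]; simp [hCx u huinC, c7]
      · rw [hfy, F.adj_comm]; simp [hCy u huinC, c7]
      · rw [hfu]; simp [c7]
      · rw [hfc, F.adj_comm]; simp [hcuadj, c7]
      · rw [h3, F.adj_comm, hBnu w h1 u huinC]; simp [h2, c7]
      · rw [h3, F.adj_comm, hBnu w h1 u huinC]; simp [h2, hcu, c7]
      · rw [h3]; simp [hnv u huR, c7]
      · rw [h3, F.adj_comm]; simp [hA w h1 h2 h2' u huR, c7]
    have h3' : ∀ w, F.Adj c w ↔ c7 3 (f w) = true := by
      intro w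
      rcases hcase w with rfl | rfl | rfl | rfl | ⟨h1, h2, h3⟩ | ⟨h1, h2, h3⟩ | ⟨rfl, h3⟩ | ⟨h1, h2, h2', h3⟩
      · rw [hfx, F.adj_comm]; simp [hCx c hc, c7]
      · rw [hfy, F.adj_comm]; simp [hCy c hc, c7]
      · rw [hfu]; simp [hcuadj, c7]
      · rw [hfc]; simp [c7]
      · rw [h3, F.adj_comm, hBnu w h1 c hc]; simp [h2, hcu.symm, c7]
      · rw [h3, F.adj_comm, hBnu w h1 c hc]; simp [h2, c7]
      · rw [h3]; simp [hnv c hcR, c7]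
      · rw [h3, F.adj_comm]; simp [hA w h1 h2 h2' c hcR, c7]
    have hcsym : ∀ i j, c7 i j = c7 j i := by decide
    have hbig : ∀ w w', w ∉ ({x, y, u, c} : Finset V) → w' ∉ ({x, y, u, c} : Finset V) → ¬ F.Adj w w' := by
      intro w w' hw hw' hadj
      simp only [Finset.mem_insert, Finset.mem_singleton, not_or] at hw hw'
      have hw'C : w' ∉ C := by rw [hCeq]; exact not_or.2 hw'.2.2
      by_cases hwv : w = v
      · rw [hwv, hv] at hadj; exact hadj.elim hw'.1 hw'.2.1
      by_cases hwv' : w' = v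
      · rw [hwv', F.adj_comm, hv] at hadj; exact hadj.elim hw.1 hw.2.1
      have hwR := hR0mem w hwv hw.1 hw.2.1
      have hwR' := hR0mem w' hwv' hw'.1 hw'.2.1
      by_cases hwB : w ∈ B
      · have := hBedge w hwB w' hwR' hadj
        exact hw'C (this ▸ (hparB w hwB).1)
      · have hwC : w ∉ C := by rw [hCeq]; exact not_or.2 hw.2.2
        exact hA w hwR hwB hwC w' hwR' hadj
    refine ⟨f, ⟨?_, ?_, ?_, ?_, ?_⟩⟩
    · intro p q
      by_cases hpx : p = x; · rw [hpx, hfx]; exact h0 q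
      by_cases hpy : p = y; · rw [hpy, hfy]; exact h1' q
      by_cases hpu : p = u; · rw [hpu, hfu]; exact h2' q
      by_cases hpc : p = c; · rw [hpc, hfc]; exact h3' q
      by_cases hqx : q = x; · rw [hqx, hfx, F.adj_comm, hcsym]; exact h0 p
      by_cases hqy : q = y; · rw [hqy, hfy, F.adj_comm, hcsym]; exact h1' p
      by_cases hqu : q = u; · rw [hqu, hfu, F.adj_comm, hcsym]; exact h2' p
      by_cases hqc : q = c; · rw [hqc, hfc, F.adj_comm, hcsym]; exact h3' p
      have hn := hbig p q (by simp only [Finset.mem_insert, Finset.mem_singleton, hpx, hpy, hpu, hpc, or_self, not_false_eq_true]) (by simp only [Finset.mem_insert, Finset.mem_singleton, hqx, hqy, hqu, hqc, or_self, not_false_eq_true])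
      have hfp : f p = 4 ∨ f p = 5 ∨ f p = 6 := by have := hcase p; clear * - this hpx hpy hpu hpc; tauto
      have hfq : f q = 4 ∨ f q = 5 ∨ f q = 6 := by have := hcase q; clear * - this hqx hqy hqu hqc; tauto
      have : c7 (f p) (f q) = false := by
        rcases hfp with h | h | h <;> rcases hfq with h' | h' | h' <;> rw [h, h'] <;> decide
      simp [hn, this]
    · refine ⟨x, hfx, fun w hw => ?_⟩
      rcases hcase w with rfl | rfl | rfl | rfl | ⟨h1, h2, h3⟩ | ⟨h1, h2, h3⟩ | ⟨rfl, h3⟩ | ⟨h1, h2, h2', h3⟩ <;> first | rfl | (exfalso; revert hw; beta_reduce; first | (rw [hfx]; decide) | (rw [hfy]; decide) | (rw [hfu]; decide) | (rw [hfc]; decide) | (rw [h3]; decide))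
    · refine ⟨y, hfy, fun w hw => ?_⟩
      rcases hcase w with rfl | rfl | rfl | rfl | ⟨h1, h2, h3⟩ | ⟨h1, h2, h3⟩ | ⟨rfl, h3⟩ | ⟨h1, h2, h2', h3⟩ <;> first | rfl | (exfalso; revert hw; beta_reduce; first | (rw [hfx]; decide) | (rw [hfy]; decide) | (rw [hfu]; decide) | (rw [hfc]; decide) | (rw [h3]; decide))
    · refine ⟨u, hfu, fun w hw => ?_⟩
      rcases hcase w with rfl | rfl | rfl | rfl | ⟨h1, h2, h3⟩ | ⟨h1, h2, h3⟩ | ⟨rfl, h3⟩ | ⟨h1, h2, h2', h3⟩ <;> first | rfl | (exfalso; revert hw; beta_reduce; first | (rw [hfx]; decide) | (rw [hfy]; decide) | (rw [hfu]; decide) | (rw [hfc]; decide) | (rw [h3]; decide))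
    · refine ⟨c, hfc, fun w hw => ?_⟩
      rcases hcase w with rfl | rfl | rfl | rfl | ⟨h1, h2, h3⟩ | ⟨h1, h2, h3⟩ | ⟨rfl, h3⟩ | ⟨h1, h2, h2', h3⟩ <;> first | rfl | (exfalso; revert hw; beta_reduce; first | (rw [hfx]; decide) | (rw [hfy]; decide) | (rw [hfu]; decide) | (rw [hfc]; decide) | (rw [h3]; decide))
  · left
    push Not at hCu
    have hCeq : ∀ w, w ∈ C ↔ w = u := by
      intro w
      exact ⟨hCu w, fun h => h ▸ huinC⟩
    let f : V → Fin 5 := fun w => if w = y then 0 else if w = u then 1 else if w = x then 2 else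
      if w ∈ B then 4 else 3
    have hfx : f x = 2 := by simp [f, hxy, hux.symm]
    have hfy : f y = 0 := by simp [f]
    have hfu : f u = 1 := by simp [f, huy]
    have hcase : ∀ w, w = x ∨ w = y ∨ w = u ∨ (w ∈ B ∧ par w = u ∧ f w = 4) ∨
        (w = v ∧ f w = 3) ∨ (w ∈ R0 ∧ w ∉ B ∧ w ∉ C ∧ f w = 3) := by
      intro w
      by_cases h1 : w = x; · exact Or.inl h1
      by_cases h2 : w = y; · exact Or.inr (Or.inl h2)
      by_cases h3 : w = u; · exact Or.inr (Or.inr (Or.inl h3))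
      by_cases h5 : w ∈ B
      · have h6 := (hCeq _).1 (hparB w h5).1
        have : f w = 4 := by simp [f, h1, h2, h3, h5]
        exact Or.inr (Or.inr (Or.inr (Or.inl ⟨h5, h6, this⟩)))
      · have h7 : f w = 3 := by simp [f, h1, h2, h3, h5]
        by_cases h6 : w = v
        · exact Or.inr (Or.inr (Or.inr (Or.inr (Or.inl ⟨h6, h7⟩))))
        · have := hR0mem w h6 h1 h2
          have hwC : w ∉ C := by rw [hCeq]; exact h3
          exact Or.inr (Or.inr (Or.inr (Or.inr (Or.inr (⟨this, h5, hwC, h7⟩)))))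
    have hvB : v ∉ B := fun h => hvR (hBR v h)
    have h0 : ∀ w, F.Adj x w ↔ c5 2 (f w) = true := by
      intro w
      rw [hx_adj]
      rcases hcase w with rfl | rfl | rfl | ⟨h1, h2, h3⟩ | ⟨rfl, h3⟩ | ⟨h1, h2, h2', h3⟩
      · rw [hfx]; simp [hvx.symm, hxR, c5]
      · rw [hfy]; simp [hvy.symm, hyR, c5]
      · rw [hfu]; simp [huv, huinC, c5]
      · rw [h3]; simp [hBR w h1, fun h => Finset.disjoint_left.1 hBC h1 h, c5]
      · rw [h3]; simp [c5]
      · rw [h3]; simp [h1, h2', c5]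
    have h1' : ∀ w, F.Adj y w ↔ c5 0 (f w) = true := by
      intro w
      rw [hy_adj]
      rcases hcase w with rfl | rfl | rfl | ⟨h1, h2, h3⟩ | ⟨rfl, h3⟩ | ⟨h1, h2, h2', h3⟩
      · rw [hfx]; simp [hvx.symm, hxR, c5]
      · rw [hfy]; simp [hvy.symm, hyR, c5]
      · rw [hfu]; simp [huR, huB, c5]
      · rw [h3]; have hwv : w ≠ v := (fun h => hvB (h ▸ h1)); simp [h1, hwv, c5]
      · rw [h3]; simp [c5]
      · rw [h3]; simp [h1, h2, c5]
    have hBnu : ∀ b ∈ B, ∀ d ∈ C, F.Adj b d ↔ par b = d := by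
      intro b hb d hd
      refine ⟨hedgeBC b hb d hd, ?_⟩
      rintro rfl
      exact (hparB b hb).2
    have h2' : ∀ w, F.Adj u w ↔ c5 1 (f w) = true := by
      intro w
      rcases hcase w with rfl | rfl | rfl | ⟨h1, h2, h3⟩ | ⟨rfl, h3⟩ | ⟨h1, h2, h2', h3⟩
      · rw [hfx, F.adj_comm]; simp [hCx u huinC, c5]
      · rw [hfy, F.adj_comm]; simp [hCy u huinC, c5]
      · rw [hfu]; simp [c5]
      · rw [h3, F.adj_comm, hBnu w h1 u huinC]; simp [h2, c5]
      · rw [h3]; simp [hnv u huR, c5]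
      · rw [h3, F.adj_comm]; simp [hA w h1 h2 h2' u huR, c5]
    have hcsym : ∀ i j, c5 i j = c5 j i := by decide
    have hbig : ∀ w w', w ∉ ({x, y, u} : Finset V) → w' ∉ ({x, y, u} : Finset V) → ¬ F.Adj w w' := by
      intro w w' hw hw' hadj
      simp only [Finset.mem_insert, Finset.mem_singleton, not_or] at hw hw'
      have hw'C : w' ∉ C := by rw [hCeq]; exact hw'.2.2
      by_cases hwv : w = v
      · rw [hwv, hv] at hadj; exact hadj.elim hw'.1 hw'.2.1
      by_cases hwv' : w' = v
      · rw [hwv', F.adj_comm, hv] at hadj; exact hadj.elim hw.1 hw.2.1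
      have hwR := hR0mem w hwv hw.1 hw.2.1
      have hwR' := hR0mem w' hwv' hw'.1 hw'.2.1
      by_cases hwB : w ∈ B
      · have := hBedge w hwB w' hwR' hadj
        exact hw'C (this ▸ (hparB w hwB).1)
      · have hwC : w ∉ C := by rw [hCeq]; exact hw.2.2
        exact hA w hwR hwB hwC w' hwR' hadj
    refine ⟨f, ⟨?_, ?_, ?_, ?_⟩⟩
    · intro p q
      by_cases hpx : p = x; · rw [hpx, hfx]; exact h0 q
      by_cases hpy : p = y; · rw [hpy, hfy]; exact h1' q
      by_cases hpu : p = u; · rw [hpu, hfu]; exact h2' q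
      by_cases hqx : q = x; · rw [hqx, hfx, F.adj_comm, hcsym]; exact h0 p
      by_cases hqy : q = y; · rw [hqy, hfy, F.adj_comm, hcsym]; exact h1' p
      by_cases hqu : q = u; · rw [hqu, hfu, F.adj_comm, hcsym]; exact h2' p
      have hn := hbig p q (by simp only [Finset.mem_insert, Finset.mem_singleton, hpx, hpy, hpu, or_self, not_false_eq_true]) (by simp only [Finset.mem_insert, Finset.mem_singleton, hqx, hqy, hqu, or_self, not_false_eq_true])
      have hfp : f p = 3 ∨ f p = 4 := by have := hcase p; clear * - this hpx hpy hpu; tauto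
      have hfq : f q = 3 ∨ f q = 4 := by have := hcase q; clear * - this hqx hqy hqu; tauto
      have : c5 (f p) (f q) = false := by
        rcases hfp with h | h <;> rcases hfq with h' | h' <;> rw [h, h'] <;> decide
      simp [hn, this]
    · refine ⟨y, hfy, fun w hw => ?_⟩
      rcases hcase w with rfl | rfl | rfl | ⟨h1, h2, h3⟩ | ⟨rfl, h3⟩ | ⟨h1, h2, h2', h3⟩ <;> first | rfl | (exfalso; revert hw; beta_reduce; first | (rw [hfx]; decide) | (rw [hfy]; decide) | (rw [hfu]; decide) | (rw [h3]; decide))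
    · refine ⟨u, hfu, fun w hw => ?_⟩
      rcases hcase w with rfl | rfl | rfl | ⟨h1, h2, h3⟩ | ⟨rfl, h3⟩ | ⟨h1, h2, h2', h3⟩ <;> first | rfl | (exfalso; revert hw; beta_reduce; first | (rw [hfx]; decide) | (rw [hfy]; decide) | (rw [hfu]; decide) | (rw [h3]; decide))
    · refine ⟨x, hfx, fun w hw => ?_⟩
      rcases hcase w with rfl | rfl | rfl | ⟨h1, h2, h3⟩ | ⟨rfl, h3⟩ | ⟨h1, h2, h2', h3⟩ <;> first | rfl | (exfalso; revert hw; beta_reduce; first | (rw [hfx]; decide) | (rw [hfy]; decide) | (rw [hfu]; decide) | (rw [h3]; decide))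

end CT
open SimpleGraph

namespace CT

theorem side_nonempty {V : Type} [Fintype V] [DecidableEq V] (F : SimpleGraph V)
    [DecidableRel F.Adj]
    (ex : ∀ p q, p ≠ q → ¬ F.Adj p q → ∃ r, F.Adj p r ∧ F.Adj q r)
    (nodom : ∀ p, ∃ q, q ≠ p ∧ ¬ F.Adj p q)
    (v x y : V) (hv : ∀ w, F.Adj v w ↔ w = x ∨ w = y)
    (R0 B C : Finset V) (hR0 : ∀ w, w ∈ R0 ↔ w ≠ v ∧ w ≠ x ∧ w ≠ y)
    (hB : ∀ w, w ∈ B ↔ w ∈ R0 ∧ ¬ F.Adj y w) (hC : ∀ w, w ∈ C ↔ w ∈ R0 ∧ ¬ F.Adj x w)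
    (hcnt : ((R0 ×ˢ R0).filter (fun e => F.Adj e.1 e.2)).card + (if F.Adj x y then 2 else 0) + 2 ≤
      2 * (B.card + C.card)) : B.Nonempty := by
  by_cases hxy : F.Adj x y
  · obtain ⟨q, hq, hqy⟩ := nodom y
    refine ⟨q, (hB q).2 ⟨(hR0 q).2 ⟨?_, ?_, hq⟩, hqy⟩⟩
    · rintro rfl; exact hqy ((hv y).2 (Or.inr rfl)).symm
    · rintro rfl; exact hqy hxy.symm
  · by_contra hBe
    rw [Finset.not_nonempty_iff_eq_empty] at hBe
    have hw : ∀ c, ∃ w, c ∈ C → w ∈ R0 ∧ w ∉ C ∧ F.Adj c w := by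
      intro c
      by_cases hc : c ∈ C
      · have h1 := (hC c).1 hc
        have h2 := (hR0 c).1 h1.1
        obtain ⟨w, h3, h4⟩ := ex c x h2.2.1 (fun h => h1.2 h.symm)
        refine ⟨w, fun _ => ⟨(hR0 w).2 ⟨?_, ?_, ?_⟩, fun h => ((hC w).1 h).2 h4, h3⟩⟩
        · rintro rfl
          rcases (hv c).1 h3.symm with h | h
          · exact h2.2.1 h
          · exact h2.2.2 h
        · rintro rfl; exact F.loopless.irrefl _ h4
        · rintro rfl; exact hxy h4
      · exact ⟨c, fun h => absurd h hc⟩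
    choose w hw using hw
    have hdis : Disjoint (C.image fun c => (c, w c)) (C.image fun c => (w c, c)) := by
      rw [Finset.disjoint_left]
      intro e h1 h2
      obtain ⟨c, hc, rfl⟩ := Finset.mem_image.1 h1
      obtain ⟨d, hd, he⟩ := Finset.mem_image.1 h2
      have := (Prod.mk.inj he).1
      exact (hw d hd).2.1 (this ▸ hc)
    have hsub : (C.image fun c => (c, w c)) ∪ (C.image fun c => (w c, c)) ⊆
        (R0 ×ˢ R0).filter (fun e => F.Adj e.1 e.2) := by
      intro e he
      rcases Finset.mem_union.1 he with he | he
      · obtain ⟨c, hc, rfl⟩ := Finset.mem_image.1 he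
        simp [((hC c).1 hc).1, hw c hc]
      · obtain ⟨c, hc, rfl⟩ := Finset.mem_image.1 he
        simp [((hC c).1 hc).1, hw c hc, (hw c hc).2.2.symm]
    have := Finset.card_le_card hsub
    rw [Finset.card_union_of_disjoint hdis,
      Finset.card_image_of_injective _ (fun a b h => (Prod.mk.inj h).1),
      Finset.card_image_of_injective _ (fun a b h => (Prod.mk.inj h).2)] at this
    rw [if_neg hxy, hBe, Finset.card_empty] at hcnt
    omega

theorem deg2_count {V : Type} [Fintype V] [DecidableEq V] (F : SimpleGraph V)
    [DecidableRel F.Adj]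
    (hsum : ∑ v, F.degree v + 10 ≤ 4 * Fintype.card V)
    (v x y : V) (hxy : x ≠ y) (hv : ∀ w, F.Adj v w ↔ w = x ∨ w = y)
    (R0 B C : Finset V) (hR0 : ∀ w, w ∈ R0 ↔ w ≠ v ∧ w ≠ x ∧ w ≠ y)
    (hB : ∀ w, w ∈ B ↔ w ∈ R0 ∧ ¬ F.Adj y w) (hC : ∀ w, w ∈ C ↔ w ∈ R0 ∧ ¬ F.Adj x w) :
    ((R0 ×ˢ R0).filter (fun e => F.Adj e.1 e.2)).card + (if F.Adj x y then 2 else 0) + 2 ≤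
      2 * (B.card + C.card) := by
  have hvx : v ≠ x := by rintro rfl; exact F.loopless.irrefl _ ((hv v).2 (Or.inl rfl))
  have hvy : v ≠ y := by rintro rfl; exact F.loopless.irrefl _ ((hv v).2 (Or.inr rfl))
  have hxR : x ∉ R0 := fun h => ((hR0 x).1 h).2.1 rfl
  have hyR : y ∉ R0 := fun h => ((hR0 y).1 h).2.2 rfl
  have hvR : v ∉ R0 := fun h => ((hR0 v).1 h).1 rfl
  have huniv : (Finset.univ : Finset V) = insert v (insert x (insert y R0)) := by
    ext w; simp [hR0]; tauto
  have hsplit : ∀ g : V → ℕ, ∑ w, g w = g v + (g x + (g y + ∑ w ∈ R0, g w)) := by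
    intro g
    rw [huniv, Finset.sum_insert (by simp [hvx, hvy, hvR]), Finset.sum_insert (by simp [hxy, hxR]),
      Finset.sum_insert hyR]
  let i : V → V → ℕ := fun u w => if F.Adj u w then 1 else 0
  have hdeg : ∀ u, F.degree u = ∑ w, i u w := by
    intro u
    rw [← F.card_neighborFinset_eq_degree, Finset.card_eq_sum_ones, SimpleGraph.neighborFinset_eq_filter,
      Finset.sum_filter]
  have hsym : ∀ u w, i u w = i w u := by intro u w; simp [i, F.adj_comm]
  have hE : ((R0 ×ˢ R0).filter (fun e => F.Adj e.1 e.2)).card = ∑ u ∈ R0, ∑ w ∈ R0, i u w := by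
    rw [Finset.card_filter, Finset.sum_product]
  have hcard : Fintype.card V = R0.card + 3 := by
    rw [← Finset.card_univ, huniv, Finset.card_insert_of_notMem (by simp [hvx, hvy, hvR]),
      Finset.card_insert_of_notMem (by simp [hxy, hxR]), Finset.card_insert_of_notMem hyR]
  have hxs : ∑ w ∈ R0, i x w + C.card = R0.card := by
    have : C = R0.filter (fun w => ¬ F.Adj x w) := by ext w; simp [hC]
    rw [this, ← Finset.card_filter, Finset.card_filter_add_card_filter_not]
  have hys : ∑ w ∈ R0, i y w + B.card = R0.card := by
    have : B = R0.filter (fun w => ¬ F.Adj y w) := by ext w; simp [hB]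
    rw [this, ← Finset.card_filter, Finset.card_filter_add_card_filter_not]
  have hself : ∀ u, i u u = 0 := by intro u; simp [i]
  have h1 : i v x = 1 := by simp [i, hv]
  have h2 : i v y = 1 := by simp [i, hv]
  have hxy' : 2 * i x y = if F.Adj x y then 2 else 0 := by simp [i]
  simp only [hdeg] at hsum
  rw [hsplit] at hsum
  simp only [hsplit] at hsum
  rw [Finset.sum_add_distrib, Finset.sum_add_distrib, Finset.sum_add_distrib, hself, hself, hself, hcard] at hsum
  have e1 : ∑ u ∈ R0, i u x = ∑ u ∈ R0, i x u := Finset.sum_congr rfl fun u _ => hsym _ _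
  have e2 : ∑ u ∈ R0, i u y = ∑ u ∈ R0, i y u := Finset.sum_congr rfl fun u _ => hsym _ _
  rw [e1, e2, hsym x v, hsym y v, hsym y x, h1, h2] at hsum
  rw [hE, ← hxy']
  omega

theorem deg2_all {V : Type} [Fintype V] [DecidableEq V] (F : SimpleGraph V)
    [DecidableRel F.Adj]
    (ex : ∀ p q, p ≠ q → ¬ F.Adj p q → ∃ r, F.Adj p r ∧ F.Adj q r)
    (nodom : ∀ p, ∃ q, q ≠ p ∧ ¬ F.Adj p q)
    (hsum : ∑ v, F.degree v + 10 ≤ 4 * Fintype.card V) (v : V) (hd : F.degree v = 2) :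
    (∃ f, F1 F f) ∨ ∃ f, F2 F f := by
  rw [← F.card_neighborFinset_eq_degree, Finset.card_eq_two] at hd
  obtain ⟨x, y, hxy, hnb⟩ := hd
  have hv : ∀ w, F.Adj v w ↔ w = x ∨ w = y := by
    intro w; rw [← F.mem_neighborFinset, hnb]; simp
  let R0 : Finset V := Finset.univ.filter (fun w => w ≠ v ∧ w ≠ x ∧ w ≠ y)
  let B : Finset V := R0.filter (fun w => ¬ F.Adj y w)
  let C : Finset V := R0.filter (fun w => ¬ F.Adj x w)
  have hR0 : ∀ w, w ∈ R0 ↔ w ≠ v ∧ w ≠ x ∧ w ≠ y := by intro w; simp [R0]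
  have hB : ∀ w, w ∈ B ↔ w ∈ R0 ∧ ¬ F.Adj y w := by intro w; simp [B]
  have hC : ∀ w, w ∈ C ↔ w ∈ R0 ∧ ¬ F.Adj x w := by intro w; simp [C]
  clear_value R0 B C
  have hcnt := deg2_count F hsum v x y hxy hv R0 B C hR0 hB hC
  have hv' : ∀ w, F.Adj v w ↔ w = y ∨ w = x := fun w => (hv w).trans or_comm
  have hR0' : ∀ w, w ∈ R0 ↔ w ≠ v ∧ w ≠ y ∧ w ≠ x := fun w => (hR0 w).trans (and_congr_right fun _ => and_comm)
  have hcnt' : ((R0 ×ˢ R0).filter (fun e => F.Adj e.1 e.2)).card + (if F.Adj y x then 2 else 0) + 2 ≤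
      2 * (C.card + B.card) := by simpa [F.adj_comm, add_comm] using hcnt
  have hBne := side_nonempty F ex nodom v x y hv R0 B C hR0 hB hC hcnt
  have hCne := side_nonempty F ex nodom v y x hv' R0 C B hR0' hC hB hcnt'
  have hvx : v ≠ x := by rintro rfl; exact F.loopless.irrefl _ ((hv v).2 (Or.inl rfl))
  have hvy : v ≠ y := by rintro rfl; exact F.loopless.irrefl _ ((hv v).2 (Or.inr rfl))
  have hdich : ∀ w ∈ R0, F.Adj x w ∨ F.Adj y w := by
    intro w hw
    obtain ⟨r, h1, h2⟩ := ex v w ((hR0 w).1 hw).1.symm (fun h => by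
      rcases (hv w).1 h with h' | h'
      · exact ((hR0 w).1 hw).2.1 h'
      · exact ((hR0 w).1 hw).2.2 h')
    rcases (hv r).1 h1 with rfl | rfl
    · exact Or.inl h2.symm
    · exact Or.inr h2.symm
  have hBC : Disjoint B C := Finset.disjoint_left.2 fun w h1 h2 => by
    rcases hdich w ((hB w).1 h1).1 with h | h
    · exact ((hC w).1 h2).2 h
    · exact ((hB w).1 h1).2 h
  have hlow : ∃ w ∈ B ∪ C, (R0.filter (fun z => F.Adj w z)).card ≤ 1 := by
    by_contra hcon
    push Not at hcon
    have hsub : B ∪ C ⊆ R0 := by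
      intro w hw
      rcases Finset.mem_union.1 hw with h | h
      · exact ((hB w).1 h).1
      · exact ((hC w).1 h).1
    have h1 : ((R0 ×ˢ R0).filter (fun e => F.Adj e.1 e.2)).card
        = ∑ u ∈ R0, (R0.filter (fun z => F.Adj u z)).card := by
      rw [Finset.card_filter, Finset.sum_product]
      exact Finset.sum_congr rfl fun u _ => (Finset.card_filter _ _).symm
    have h2 : ∑ u ∈ B ∪ C, 2 ≤ ∑ u ∈ B ∪ C, (R0.filter (fun z => F.Adj u z)).card :=
      Finset.sum_le_sum fun u hu => hcon u hu
    have h3 : ∑ u ∈ B ∪ C, (R0.filter (fun z => F.Adj u z)).card ≤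
      ∑ u ∈ R0, (R0.filter (fun z => F.Adj u z)).card :=
      Finset.sum_le_sum_of_subset hsub
    rw [Finset.sum_const, Finset.card_union_of_disjoint hBC, smul_eq_mul] at h2
    omega
  obtain ⟨w, hw, hwd⟩ := hlow
  rcases Finset.mem_union.1 hw with hw | hw
  · exact deg2_main F ex v x y hxy hv R0 B C hR0 hB hC hcnt hCne w hw hwd
  · exact deg2_main F ex v y x hxy.symm hv' R0 C B hR0' hC hB hcnt' hBne w hw hwd

theorem comb {V : Type} [Fintype V] [DecidableEq V] (F : SimpleGraph V)
    [DecidableRel F.Adj] (hmin : ∀ v, 2 ≤ F.degree v)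
    (ex : ∀ p q, p ≠ q → ¬ F.Adj p q → ∃ r, F.Adj p r ∧ F.Adj q r)
    (nodom : ∀ p, ∃ q, q ≠ p ∧ ¬ F.Adj p q)
    (hsum : ∑ v, F.degree v + 10 ≤ 4 * Fintype.card V) :
    (∃ f, F1 F f) ∨ (∃ f, F2 F f) ∨ (Fintype.card V = 10 ∧ Nonempty (F ≃g petersen)) := by
  by_cases h : ∃ v, F.degree v = 2
  · obtain ⟨v, hv⟩ := h
    rcases deg2_all F ex nodom hsum v hv with h | h
    · exact Or.inl h
    · exact Or.inr (Or.inl h)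
  · push Not at h
    refine Or.inr (Or.inr (comb_deg3 F (fun v => ?_) ex hsum))
    have := hmin v; have := h v; omega

end CT
open SimpleGraph

namespace CT

theorem bip_star {V : Type} (H : SimpleGraph V) (S : Set V) (P Q : Finset V)
    (hS : (H.induce S).Connected) (hSP : ∀ p ∈ P, p ∉ S) (hSQ : ∀ p ∈ Q, p ∉ S) (hPQ : Disjoint P Q)
    (h1 : ∀ q ∈ Q, ∃ x ∈ S, H.Adj x q) (h2 : ∀ p ∈ P, ∀ q ∈ Q, H.Adj p q) :
    Bip H Set.univ (P.card + 1) Q.card := by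
  classical
  let φ : (Option {p // p ∈ P}) ⊕ {q // q ∈ Q} → Set V :=
    Sum.elim (fun o => o.elim S (fun p => {p.1})) (fun q => {q.1})
  refine bip_of_types H Set.univ φ (fun i => Set.subset_univ _) ?_ ?_ ?_ _ _ (by simp) (by simp)
  · rintro ((_ | p) | q)
    · exact hS
    · exact induce_singleton_connected _ _
    · exact induce_singleton_connected _ _
  · rintro ((_ | p) | q) ((_ | p') | q') hne <;> simp only [φ, Sum.elim_inl, Sum.elim_inr, Option.elim, Set.disjoint_singleton_left, Set.disjoint_singleton_right, Set.mem_singleton_iff]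
    · exact absurd rfl hne
    · exact hSP _ p'.2
    · exact hSQ _ q'.2
    · exact hSP _ p.2
    · intro h; exact hne (by rw [Subtype.ext h])
    · intro h; exact Finset.disjoint_left.1 hPQ (h ▸ p.2) q'.2
    · exact hSQ _ q.2
    · intro h; exact Finset.disjoint_left.1 hPQ p'.2 (h ▸ q.2)
    · intro h; exact hne (by rw [Subtype.ext h])
  · rintro (_ | p) q
    · obtain ⟨x, hx, h⟩ := h1 q.1 q.2
      exact ⟨x, hx, q.1, rfl, h⟩
    · exact ⟨p.1, rfl, q.1, rfl, h2 _ p.2 _ q.2⟩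

/-- The basic hypotheses on a component. -/
def Free {V : Type} (H : SimpleGraph V) (s t : ℕ) : Prop :=
  ∀ a b, 1 ≤ a → a ≤ s → 1 ≤ b → a + b = t + 1 → ¬ Bip H Set.univ a b

theorem n3 {V : Type} [Fintype V] [DecidableEq V] (H : SimpleGraph V) {s t : ℕ}
    (hcard : Fintype.card V = t + 2) (hf : Free H s t) (P : Finset V) (x y : V) (hxy : H.Adj x y)
    (hP : ∀ w, w ∈ P ↔ w ≠ x ∧ w ≠ y ∧ ¬ H.Adj x w ∧ ¬ H.Adj y w)
    (hQ : ∃ w, w ∉ P ∧ w ≠ x ∧ w ≠ y)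
    (hPQ : ∀ p ∈ P, ∀ q, q ∉ P → q ≠ x → q ≠ y → H.Adj p q) : s ≤ P.card := by
  by_contra hlt
  let Q : Finset V := Finset.univ.filter (fun w => w ∉ P ∧ w ≠ x ∧ w ≠ y)
  have hxP : x ∉ P := fun h => ((hP x).1 h).1 rfl
  have hyP : y ∉ P := fun h => ((hP y).1 h).2.1 rfl
  have hb := bip_star H {x, y} P Q (induce_pair_connected' H hxy)
    (fun p hp => by have := (hP p).1 hp; simp; tauto) (fun q hq => by simp [Q] at hq ⊢; tauto)
    (Finset.disjoint_left.2 fun w h1 h2 => by simp [Q] at h2; tauto)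
    (fun q hq => by
      simp only [Q, Finset.mem_filter, Finset.mem_univ, true_and] at hq
      have h := (hP q).not.1 hq.1
      by_cases h1 : H.Adj x q
      · exact ⟨x, by simp, h1⟩
      · refine ⟨y, by simp, ?_⟩
        by_contra h2
        exact h ⟨hq.2.1, hq.2.2, h1, h2⟩)
    (fun p hp q hq => by
      simp only [Q, Finset.mem_filter, Finset.mem_univ, true_and] at hq
      exact hPQ p hp q hq.1 hq.2.1 hq.2.2)
  have hun : (Finset.univ : Finset V) = insert x (insert y (P ∪ Q)) := by
    ext w; simp [Q]; tauto
  have hc : t + 2 = P.card + Q.card + 2 := by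
    rw [← hcard, ← Finset.card_univ, hun, Finset.card_insert_of_notMem (by simp [hxy.ne, hxP, Q]),
      Finset.card_insert_of_notMem (by simp [hyP, Q]), Finset.card_union_of_disjoint
      (Finset.disjoint_left.2 fun w h1 h2 => by simp [Q] at h2; tauto)]
  obtain ⟨w, hw⟩ := hQ
  have : 0 < Q.card := Finset.card_pos.2 ⟨w, by simpa [Q] using hw⟩
  exact hf _ _ (by omega) (by omega) (by omega) (by omega) hb

theorem h_degree {V : Type} [Fintype V] [DecidableEq V] (H : SimpleGraph V) [DecidableRel H.Adj] {s t : ℕ}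
    (hs : 1 ≤ s) (ht : 1 ≤ t) (hf : Free H s t) (v : V) : H.degree v + 1 ≤ t := by
  by_contra hlt
  obtain ⟨Q, hQ, hQc⟩ := Finset.exists_subset_card_eq (s := H.neighborFinset v) (n := t)
    (by rw [H.card_neighborFinset_eq_degree]; omega)
  have hb := bip_star H {v} ∅ Q (induce_singleton_connected H v) (by simp)
    (fun q hq h => by
      have := (H.mem_neighborFinset v q).1 (hQ hq)
      rw [Set.mem_singleton_iff.1 h] at this
      exact H.loopless.irrefl _ this) (by simp)
    (fun q hq => ⟨v, rfl, (H.mem_neighborFinset v q).1 (hQ hq)⟩) (by simp)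
  rw [hQc] at hb
  exact hf _ _ (by simp) (by simpa using hs) ht (by simp; omega) hb

theorem compl_facts {V : Type} [Fintype V] [DecidableEq V] (H : SimpleGraph V) [DecidableRel H.Adj]
    {s t : ℕ} (hs : 1 ≤ s) (ht : 1 ≤ t)
    (hcard : Fintype.card V = t + 2) (hconn : H.Connected) (hf : Free H s t) :
    (∀ v, 2 ≤ Hᶜ.degree v) ∧ (∀ p q, p ≠ q → ¬ Hᶜ.Adj p q → ∃ r, Hᶜ.Adj p r ∧ Hᶜ.Adj q r) ∧
    (∀ p, ∃ q, q ≠ p ∧ ¬ Hᶜ.Adj p q) := by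
  refine ⟨fun v => ?_, fun p q hpq hn => ?_, fun p => ?_⟩
  · have := h_degree H hs ht hf v
    rw [H.degree_compl, hcard]; omega
  · have hpq' : H.Adj p q := by
      by_contra h; exact hn ((H.compl_adj p q).2 ⟨hpq, h⟩)
    by_contra hcon
    push Not at hcon
    have hw : ∃ w, w ≠ p ∧ w ≠ q := by
      by_contra h
      push Not at h
      have : (Finset.univ : Finset V) ⊆ {p, q} := fun w _ => by
        by_cases h' : w = p
        · simp [h']
        · simp [h w h']
      have := (Finset.card_le_card this).trans Finset.card_le_two
      rw [Finset.card_univ, hcard] at this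
      omega
    have := n3 H hcard hf ∅ p q hpq' (fun w => by
        simp only [Finset.notMem_empty, false_iff]
        rintro ⟨h1, h2, h3, h4⟩
        exact hcon w ((H.compl_adj _ _).2 ⟨h1.symm, h3⟩) ((H.compl_adj _ _).2 ⟨h2.symm, h4⟩))
      (by simpa using hw) (by simp)
    simp at this; omega
  · have : Nontrivial V := Fintype.one_lt_card_iff_nontrivial.1 (by omega)
    obtain ⟨q, hq⟩ := hconn.preconnected.exists_adj_of_nontrivial p
    exact ⟨q, hq.ne', by simp [H.compl_adj, hq]⟩

end CT
open SimpleGraph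

namespace CT

def fib {V ι : Type} [Fintype V] [DecidableEq ι] (f : V → ι) (i : ι) : Finset V :=
  Finset.univ.filter (fun v => f v = i)

theorem mem_fib {V ι : Type} [Fintype V] [DecidableEq ι] (f : V → ι) (i : ι) (v : V) :
    v ∈ fib f i ↔ f v = i := by simp [fib]

theorem fib_card_one {V ι : Type} [Fintype V] [DecidableEq ι] (f : V → ι) (i : ι)
    (h : ∃! v, f v = i) : (fib f i).card = 1 := by
  obtain ⟨v, hv, hu⟩ := h
  rw [Finset.card_eq_one]
  refine ⟨v, ?_⟩
  ext w
  rw [mem_fib, Finset.mem_singleton]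
  exact ⟨hu w, fun h => h ▸ hv⟩

theorem fib_sum {V ι : Type} [Fintype V] [Fintype ι] [DecidableEq ι] (f : V → ι) :
    Fintype.card V = ∑ i, (fib f i).card := by
  rw [← Finset.card_univ]
  exact Finset.card_eq_sum_card_fiberwise (fun v _ => Finset.mem_coe.2 (Finset.mem_univ _))

theorem n3_pat {V ι : Type} [Fintype V] [DecidableEq V] [DecidableEq ι] (H : SimpleGraph V) {s t : ℕ}
    (hcard : Fintype.card V = t + 2) (hf : Free H s t) (f : V → ι) (c : ι → ι → Bool)
    (adj : ∀ u v, Hᶜ.Adj u v ↔ c (f u) (f v) = true) (i j k l0 : ι) (hij : i ≠ j)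
    (hi : ∃! v, f v = i) (hj : ∃! v, f v = j) (hl0 : ∃ v, f v = l0)
    (cij : c i j = false) (hk : ∀ l, (c i l = true ∧ c j l = true) ↔ l = k)
    (hkl : ∀ l, l ≠ k → l ≠ i → l ≠ j → c k l = false) (h0 : l0 ≠ i ∧ l0 ≠ j ∧ l0 ≠ k) :
    s ≤ (fib f k).card := by
  obtain ⟨x, hx, hxu⟩ := hi
  obtain ⟨y, hy, hyu⟩ := hj
  obtain ⟨w0, hw0⟩ := hl0
  have hH : ∀ u v, u ≠ v → (c (f u) (f v) = false) → H.Adj u v := by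
    intro u v huv h
    by_contra h'
    have := (adj u v).1 ((H.compl_adj u v).2 ⟨huv, h'⟩)
    rw [h] at this; exact absurd this (by decide)
  have hxy : x ≠ y := by rintro rfl; exact hij (hx.symm.trans hy)
  refine n3 H hcard hf (fib f k) x y (hH x y hxy (by rw [hx, hy, cij])) ?_ ?_ ?_
  · intro w
    rw [mem_fib, ← hk, ← hx, ← hy, ← adj, ← adj, H.compl_adj, H.compl_adj]
    constructor
    · rintro ⟨⟨h1, h2⟩, h3, h4⟩
      exact ⟨h1.symm, h3.symm, h2, h4⟩
    · rintro ⟨h1, h2, h3, h4⟩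
      exact ⟨⟨h1.symm, h3⟩, h2.symm, h4⟩
  · refine ⟨w0, ?_, ?_, ?_⟩
    · rw [mem_fib, hw0]; exact h0.2.2
    · rintro rfl; exact h0.1 (hw0.symm.trans hx)
    · rintro rfl; exact h0.2.1 (hw0.symm.trans hy)
  · intro p hp q hq hqx hqy
    rw [mem_fib] at hp hq
    refine hH p q (by rintro rfl; exact hq hp) ?_
    rw [hp]
    exact hkl _ hq (fun h => hqx (hxu q h)) (fun h => hqy (hyu q h))

theorem f1_sizes {V : Type} [Fintype V] [DecidableEq V] (H : SimpleGraph V) {s t : ℕ}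
    (hcard : Fintype.card V = t + 2) (hf : Free H s t) (f : V → Fin 5) (h : F1 Hᶜ f) :
    s ≤ (fib f 3).card ∧ s ≤ (fib f 4).card ∧ (fib f 3).card + (fib f 4).card + 1 = t := by
  refine ⟨?_, ?_, ?_⟩
  · exact n3_pat H hcard hf f c5 h.adj 0 2 3 1 (by decide) h.h0 h.h2 h.h1.exists (by decide) (by decide) (by decide) (by decide)
  · exact n3_pat H hcard hf f c5 h.adj 1 2 4 0 (by decide) h.h1 h.h2 h.h0.exists (by decide) (by decide) (by decide) (by decide)
  · have := fib_sum f
    rw [Fin.sum_univ_five, fib_card_one f 0 h.h0, fib_card_one f 1 h.h1, fib_card_one f 2 h.h2] at this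
    omega

theorem f2_sizes {V : Type} [Fintype V] [DecidableEq V] (H : SimpleGraph V) {s t : ℕ}
    (hcard : Fintype.card V = t + 2) (hf : Free H s t) (f : V → Fin 7) (h : F2 Hᶜ f) :
    3 * s + 2 ≤ t := by
  have h4 : s ≤ (fib f 4).card :=
    n3_pat H hcard hf f c7 h.adj 0 1 4 2 (by decide) h.h0 h.h1 h.h2.exists (by decide) (by decide) (by decide) (by decide)
  have h5 : s ≤ (fib f 5).card :=
    n3_pat H hcard hf f c7 h.adj 0 2 5 1 (by decide) h.h0 h.h2 h.h1.exists (by decide) (by decide) (by decide) (by decide)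
  have h6 : s ≤ (fib f 6).card :=
    n3_pat H hcard hf f c7 h.adj 0 3 6 1 (by decide) h.h0 h.h3 h.h1.exists (by decide) (by decide) (by decide) (by decide)
  have := fib_sum f
  rw [Fin.sum_univ_seven, fib_card_one f 0 h.h0, fib_card_one f 1 h.h1, fib_card_one f 2 h.h2, fib_card_one f 3 h.h3] at this
  omega

theorem fiber_equiv {V V' ι : Type} [Fintype V] [Fintype V'] [DecidableEq ι] (f : V → ι) (f' : V' → ι)
    (h : ∀ i, (fib f i).card = (fib f' i).card) : ∃ e : V ≃ V', ∀ v, f' (e v) = f v := by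
  classical
  have hc : ∀ i, Nonempty ({v // f v = i} ≃ {v // f' v = i}) := by
    intro i
    refine ⟨Fintype.equivOfCardEq ?_⟩
    rw [Fintype.card_subtype, Fintype.card_subtype]
    exact h i
  let g := fun i => (hc i).some
  refine ⟨((Equiv.sigmaFiberEquiv f).symm.trans (Equiv.sigmaCongrRight g)).trans (Equiv.sigmaFiberEquiv f'), ?_⟩
  intro v
  simp [Equiv.sigmaFiberEquiv]
  exact (g (f v) ⟨v, rfl⟩).2

end CT
open SimpleGraph

namespace CT

theorem bip_mapOn {V V' : Type} {G : SimpleGraph V} {G' : SimpleGraph V'} (f : V → V') {W : Set V}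
    (hf : Set.InjOn f W) (hG : ∀ u ∈ W, ∀ v ∈ W, G.Adj u v → G'.Adj (f u) (f v)) {W' : Set V'}
    (hW : ∀ u ∈ W, f u ∈ W') {a b : ℕ} (hb : Bip G W a b) : Bip G' W' a b := by
  obtain ⟨φ, h1, h2, h3, h4⟩ := hb
  refine ⟨fun i => f '' φ i, ?_, ?_, ?_, ?_⟩
  · rintro i _ ⟨u, hu, rfl⟩
    exact hW u (h1 i hu)
  · intro i
    refine (h2 i).map (f := ⟨fun u => ⟨f u.1, u.1, u.2, rfl⟩, ?_⟩) ?_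
    · intro u v huv
      exact hG _ (h1 i u.2) _ (h1 i v.2) huv
    · rintro ⟨_, u, hu, rfl⟩
      exact ⟨⟨u, hu⟩, rfl⟩
  · intro i j hij
    rw [Set.disjoint_left]
    rintro _ ⟨u, hu, rfl⟩ ⟨v, hv, huv⟩
    have := hf (h1 j hv) (h1 i hu) huv
    exact Set.disjoint_left.1 (h3 hij) hu (this ▸ hv)
  · intro i j
    obtain ⟨x, hx, y, hy, hxy⟩ := h4 i j
    exact ⟨f x, ⟨x, hx, rfl⟩, f y, ⟨y, hy, rfl⟩, hG _ (h1 _ hx) _ (h1 _ hy) hxy⟩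

theorem bip_card {V : Type} [Fintype V] {G : SimpleGraph V} {W : Finset V} {a b : ℕ}
    (h : Bip G ↑W a b) : a + b ≤ W.card := by
  classical
  obtain ⟨φ, h1, h2, h3, h4⟩ := h
  have hne : ∀ i, ∃ v, v ∈ φ i := fun i => by
    obtain ⟨v⟩ := (h2 i).nonempty
    exact ⟨v.1, v.2⟩
  choose g hg using hne
  have hinj : Function.Injective g := by
    intro i j hij
    by_contra hne
    exact Set.disjoint_left.1 (h3 hne) (hg i) (hij ▸ hg j)
  have := Finset.card_le_card_of_injOn (s := (Finset.univ : Finset (Fin a ⊕ Fin b))) (t := W) g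
    (fun i _ => h1 i (hg i)) hinj.injOn
  simpa using this

structure Ext {V : Type} [Fintype V] [DecidableEq V] (s t : ℕ) (G : SimpleGraph V) (K R : Finset V) : Prop where
  ht : 4 ≤ t
  hs : 2 ≤ s
  hst : s ≤ t
  card : K.card = s - 1
  dom : DomK G K
  free : ¬ MinorOf (completeBipartiteGraph (Fin s) (Fin t)) G
  mx : ∀ G' : SimpleGraph V, ¬ MinorOf (completeBipartiteGraph (Fin s) (Fin t)) G' → specRad G' ≤ specRad G
  hR : ∀ v, v ∈ R ↔ v ∉ K

theorem Ext.ne {V : Type} [Fintype V] [DecidableEq V] {s t : ℕ} {G : SimpleGraph V} {K R : Finset V}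
    (E : Ext s t G K R) : K.Nonempty := by
  have := E.card; have := E.hs
  exact Finset.card_pos.1 (by omega)

theorem deg_aw {V : Type} [Fintype V] (H : SimpleGraph V) [DecidableRel H.Adj] (v : V) :
    (H.degree v : ℝ) = ∑ w, aw H v w := by
  classical
  rw [← H.card_neighborFinset_eq_degree, SimpleGraph.neighborFinset_eq_filter, Finset.card_filter]
  push_cast
  refine Finset.sum_congr rfl fun w _ => ?_
  unfold aw
  split_ifs <;> rfl

theorem Ext.free_sub {V : Type} [Fintype V] [DecidableEq V] {s t : ℕ} {G : SimpleGraph V} {K R : Finset V}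
    (E : Ext s t G K R) (p : V → Prop) (hp : ∀ v, p v → v ∉ K) :
    Free (G.comap (Subtype.val : {v // p v} → V)) s t := by
  intro a b ha has hb hab h
  exact E.free (minor_of_bip E.dom E.card ha has hb hab
    (bip_map Subtype.val Subtype.val_injective (fun u v h => h) (fun u => by simpa using hp u.1 u.2) h))

theorem Ext.deg_le {V : Type} [Fintype V] [DecidableEq V] {s t : ℕ} {G : SimpleGraph V} {K R : Finset V}
    (E : Ext s t G K R) : ∀ v ∈ R, ∑ w ∈ R, aw G v w ≤ (t:ℝ) - 1 := by
  classical
  intro v hv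
  have h := h_degree (G.comap (Subtype.val : {v // v ∉ K} → V)) (s := s) (t := t) (by have := E.hs; omega)
    (by have := E.ht; omega) (E.free_sub _ fun v h => h) ⟨v, (E.hR v).1 hv⟩
  have h2 := deg_aw (G.comap (Subtype.val : {v // v ∉ K} → V)) ⟨v, (E.hR v).1 hv⟩
  rw [Finset.sum_subtype R E.hR]
  have h3 : ∑ a : {v // v ∉ K}, aw G v a = ∑ w, aw (G.comap (Subtype.val : {v // v ∉ K} → V)) ⟨v, (E.hR v).1 hv⟩ w :=
    Finset.sum_congr rfl fun w _ => aw_congr Iff.rfl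
  rw [h3, ← h2]
  have : ((SimpleGraph.degree (G.comap (Subtype.val : {v // v ∉ K} → V)) ⟨v, (E.hR v).1 hv⟩ + 1 : ℕ) : ℝ) ≤ t := by
    exact_mod_cast h
  push_cast at this
  linarith

theorem abs_ineq {V : Type} [Fintype V] [DecidableEq V] {s t : ℕ} {G : SimpleGraph V} {K R T : Finset V}
    (E : Ext s t G K R) {D : ℝ} {x : V → ℝ} (hx : Wts G K R (specRad G) D x) (hT : T ⊆ R)
    {U : Type} [Fintype U] (e : U ≃ {v // v ∈ T}) (J : SimpleGraph U) (hJ : Free J s t) (z : U → ℝ) :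
    ∑ u, (2 * z u - specRad G * z u ^ 2) + ∑ u, ∑ w, aw J u w * (z u * z w) ≤
      ∑ v ∈ T, x v + ∑ v ∈ R \ T, ∑ w ∈ T, aw G v w * (x v * x w) := by
  let g : U ↪ V := e.toEmbedding.trans (Function.Embedding.subtype _)
  let J' := J.map g
  let z' : V → ℝ := fun v => if h : v ∈ T then z (e.symm ⟨v, h⟩) else 0
  have hz' : ∀ u, z' (e u) = z u := by
    intro u
    simp [z', (e u).2]
  have hKT : Disjoint K T := by
    rw [Finset.disjoint_right]
    intro v hv
    exact (E.hR v).1 (hT hv)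
  have hadj : ∀ u w, J'.Adj (e u) (e w) ↔ J.Adj u w := by
    intro u w
    exact SimpleGraph.map_adj_apply (G := J) (f := g)
  have hle : specRad (repl G K T J') ≤ specRad G := by
    refine E.mx _ (repl_free (by have := E.hs; omega) E.hst E.card E.dom hKT E.free ?_)
    intro a b ha has hb hab h
    refine hJ a b ha has hb hab ?_
    by_cases hTne : T.Nonempty
    · have : Nonempty U := ⟨e.symm ⟨_, hTne.choose_spec⟩⟩
      refine bip_mapOn (fun v => if h : v ∈ T then e.symm ⟨v, h⟩ else Classical.arbitrary U) ?_ ?_ (W' := Set.univ) (fun _ _ => Set.mem_univ _) h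
      · intro u hu v hv huv
        have hu : u ∈ T := hu
        have hv : v ∈ T := hv
        simp only [hu, hv, dif_pos, EmbeddingLike.apply_eq_iff_eq, Subtype.mk.injEq] at huv
        exact huv
      · intro u hu v hv huv
        have hu : u ∈ T := hu
        have hv : v ∈ T := hv
        simp only [hu, hv, dif_pos]
        rw [← hadj]
        simpa using huv
    · rw [Finset.not_nonempty_iff_eq_empty] at hTne
      have := bip_card h
      rw [hTne] at this
      simp at this
      omega
  have h := repl_ineq E.hR E.dom E.ne hx hT hle z'
  refine le_trans (le_of_eq ?_) h
  have hsum : ∀ F : V → ℝ, ∑ v ∈ T, F v = ∑ u, F (e u) := by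
    intro F
    rw [Finset.sum_subtype T (fun _ => Iff.rfl), ← e.sum_comp]
  rw [hsum, hsum]
  congr 1
  · exact Finset.sum_congr rfl fun u _ => by rw [hz']
  · refine Finset.sum_congr rfl fun u _ => ?_
    rw [hsum]
    refine Finset.sum_congr rfl fun w _ => ?_
    rw [hz', hz', aw_congr (hadj u w)]

end CT
open SimpleGraph

namespace CT

theorem local_identity {W : Type} [Fintype W] (H : SimpleGraph W) [DecidableRel H.Adj]
    (ρ : ℝ) (y : W → ℝ) (hy : ∀ v, ρ * y v = 1 + ∑ w, aw H v w * y w)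
    (hd : ∀ v, (H.degree v : ℝ) < ρ) :
    ∑ v, 1 / (ρ - H.degree v) = ∑ v, y v + ∑ v, (ρ - H.degree v) * (y v - 1 / (ρ - H.degree v)) ^ 2
      + (1/2) * ∑ v, ∑ w, aw H v w * (y v - y w) ^ 2 := by
  have h1 : ∑ v, ∑ w, aw H v w * (y v - y w) ^ 2 =
      2 * ∑ v, H.degree v * y v ^ 2 - 2 * ∑ v, y v * ∑ w, aw H v w * y w := by
    have e1 : ∑ v, ∑ w, aw H v w * y w ^ 2 = ∑ v, ∑ w, aw H v w * y v ^ 2 := by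
      rw [Finset.sum_comm]
      exact Finset.sum_congr rfl fun v _ => Finset.sum_congr rfl fun w _ => by rw [aw_symm]
    have e2 : ∑ v, ∑ w, aw H v w * y v ^ 2 = ∑ v, H.degree v * y v ^ 2 := by
      refine Finset.sum_congr rfl fun v _ => ?_
      rw [← Finset.sum_mul, deg_aw]
    have e3 : ∀ v w, aw H v w * (y v - y w) ^ 2 = aw H v w * y v ^ 2 + aw H v w * y w ^ 2
        - 2 * (y v * (aw H v w * y w)) := by intros; ring
    simp only [e3, Finset.sum_sub_distrib, Finset.sum_add_distrib]
    rw [e1, e2]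
    simp only [← Finset.mul_sum]
    ring
  rw [h1]
  have h2 : ∀ v, y v * ∑ w, aw H v w * y w = ρ * y v ^ 2 - y v := by
    intro v
    have := hy v
    have e : ∑ w, aw H v w * y w = ρ * y v - 1 := by linarith
    rw [e]; ring
  simp only [h2]
  rw [Finset.mul_sum, Finset.mul_sum, ← Finset.sum_sub_distrib, Finset.mul_sum,
    ← Finset.sum_add_distrib, ← Finset.sum_add_distrib]
  refine Finset.sum_congr rfl fun v _ => ?_
  have : ρ - H.degree v ≠ 0 := by have := hd v; linarith
  field_simp
  ring

theorem local_upper {W : Type} [Fintype W] (H : SimpleGraph W) [DecidableRel H.Adj]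
    (ρ : ℝ) (y : W → ℝ) (hy : ∀ v, ρ * y v = 1 + ∑ w, aw H v w * y w)
    (hd : ∀ v, (H.degree v : ℝ) < ρ) :
    ∑ v, y v ≤ ∑ v, 1 / (ρ - H.degree v) := by
  rw [local_identity H ρ y hy hd]
  have h1 : 0 ≤ ∑ v, (ρ - H.degree v) * (y v - 1 / (ρ - H.degree v)) ^ 2 :=
    Finset.sum_nonneg fun v _ => mul_nonneg (by have := hd v; linarith) (sq_nonneg _)
  have h2 : 0 ≤ ∑ v, ∑ w, aw H v w * (y v - y w) ^ 2 :=
    Finset.sum_nonneg fun v _ => Finset.sum_nonneg fun w _ => mul_nonneg (aw_nonneg _ _ _) (sq_nonneg _)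
  linarith

theorem local_strict {W : Type} [Fintype W] (H : SimpleGraph W) [DecidableRel H.Adj]
    (ρ : ℝ) (y : W → ℝ) (hy : ∀ v, ρ * y v = 1 + ∑ w, aw H v w * y w)
    (hd : ∀ v, (H.degree v : ℝ) < ρ) (hc : H.Connected) (hne : ∃ u v, H.degree u ≠ H.degree v) :
    ∑ v, y v < ∑ v, 1 / (ρ - H.degree v) := by
  by_contra hlt
  have hid := local_identity H ρ y hy hd
  have n1 : ∀ v ∈ (Finset.univ : Finset W), 0 ≤ (ρ - H.degree v) * (y v - 1 / (ρ - H.degree v)) ^ 2 :=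
    fun v _ => mul_nonneg (by have := hd v; linarith) (sq_nonneg _)
  have n2 : ∀ v ∈ (Finset.univ : Finset W), 0 ≤ ∑ w, aw H v w * (y v - y w) ^ 2 :=
    fun v _ => Finset.sum_nonneg fun w _ => mul_nonneg (aw_nonneg _ _ _) (sq_nonneg _)
  have h1 := Finset.sum_nonneg n1
  have h2 := Finset.sum_nonneg n2
  have z1 := (Finset.sum_eq_zero_iff_of_nonneg n1).1 (by linarith)
  have z2 := (Finset.sum_eq_zero_iff_of_nonneg n2).1 (by linarith)
  have hyv : ∀ v, y v = 1 / (ρ - H.degree v) := by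
    intro v
    have h := z1 v (Finset.mem_univ v)
    have hp : ρ - H.degree v ≠ 0 := by have := hd v; linarith
    have := (mul_eq_zero.1 h).resolve_left hp
    have := pow_eq_zero_iff (two_ne_zero) |>.1 this
    linarith
  have hadj : ∀ u v, H.Adj u v → H.degree u = H.degree v := by
    intro u v huv
    have h := (Finset.sum_eq_zero_iff_of_nonneg (fun w _ => mul_nonneg (aw_nonneg H u w) (sq_nonneg (y u - y w)))).1
      (z2 u (Finset.mem_univ u)) v (Finset.mem_univ v)
    rw [aw_adj huv, one_mul] at h
    have h := pow_eq_zero_iff (two_ne_zero) |>.1 h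
    rw [hyv, hyv, sub_eq_zero] at h
    rw [one_div, one_div, inv_inj] at h
    have h3 : (H.degree u : ℝ) = H.degree v := by linarith
    exact_mod_cast h3
  obtain ⟨u, v, huv⟩ := hne
  apply huv
  obtain ⟨p⟩ := hc.preconnected u v
  clear huv
  induction p with
  | nil => rfl
  | cons h p ih => exact (hadj _ _ h).trans ih

theorem chord {ρ t d : ℝ} (ht : t - 1 < ρ) (h1 : 1 ≤ d) (h2 : d ≤ t - 1) :
    1 / (ρ - d) ≤ 1 / (ρ - 1) + (d - 1) / ((ρ - 1) * (ρ - t + 1)) := by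
  have p1 : 0 < ρ - 1 := by linarith
  have p2 : 0 < ρ - t + 1 := by linarith
  have p3 : 0 < ρ - d := by linarith
  have : 1 / (ρ - 1) + (d - 1) / ((ρ - 1) * (ρ - t + 1)) - 1 / (ρ - d) =
      (d - 1) * (t - 1 - d) / ((ρ - 1) * (ρ - t + 1) * (ρ - d)) := by
    field_simp; ring
  have h3 : 0 ≤ (d - 1) * (t - 1 - d) / ((ρ - 1) * (ρ - t + 1) * (ρ - d)) := by
    apply div_nonneg
    · exact mul_nonneg (by linarith) (by linarith)
    · positivity
  linarith

theorem chord_strict {ρ t d : ℝ} (ht : t - 1 < ρ) (h1 : 1 < d) (h2 : d < t - 1) :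
    1 / (ρ - d) < 1 / (ρ - 1) + (d - 1) / ((ρ - 1) * (ρ - t + 1)) := by
  have p1 : 0 < ρ - 1 := by linarith
  have p2 : 0 < ρ - t + 1 := by linarith
  have p3 : 0 < ρ - d := by linarith
  have : 1 / (ρ - 1) + (d - 1) / ((ρ - 1) * (ρ - t + 1)) - 1 / (ρ - d) =
      (d - 1) * (t - 1 - d) / ((ρ - 1) * (ρ - t + 1) * (ρ - d)) := by
    field_simp; ring
  have h3 : 0 < (d - 1) * (t - 1 - d) / ((ρ - 1) * (ρ - t + 1) * (ρ - d)) := by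
    apply div_pos
    · exact mul_pos (by linarith) (by linarith)
    · positivity
  linarith

/-- pure degree-sum comparison -/
theorem local_chord {W : Type} [Fintype W] (H : SimpleGraph W) [DecidableRel H.Adj]
    {t : ℕ} (ht : 4 ≤ t) (hcard : Fintype.card W = t + 2)
    (ρ : ℝ) (y : W → ℝ) (hy : ∀ v, ρ * y v = 1 + ∑ w, aw H v w * y w)
    (hρ : (t:ℝ) - 1 < ρ) (hdeg : ∀ v, H.degree v + 1 ≤ t) (hdeg1 : ∀ v, 1 ≤ H.degree v)
    (hc : H.Connected) (hsum : ∑ v, H.degree v ≤ t * (t - 1) + 2) :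
    ∑ v, y v < t / (ρ - t + 1) + 2 / (ρ - 1) := by
  have htR : (4:ℝ) ≤ t := by exact_mod_cast ht
  have hdR : ∀ v, (H.degree v : ℝ) ≤ t - 1 := fun v => by
    have : ((H.degree v + 1 : ℕ) : ℝ) ≤ t := by exact_mod_cast hdeg v
    push_cast at this; linarith
  have hdR1 : ∀ v, (1:ℝ) ≤ H.degree v := fun v => by exact_mod_cast hdeg1 v
  have hd : ∀ v, (H.degree v : ℝ) < ρ := fun v => lt_of_le_of_lt (hdR v) hρ
  have p1 : 0 < ρ - 1 := by linarith
  have p2 : 0 < ρ - t + 1 := by linarith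
  have hsumR : ∑ v, (H.degree v : ℝ) ≤ t * (t - 1) + 2 := by
    have : ((∑ v, H.degree v : ℕ) : ℝ) ≤ ((t * (t - 1) + 2 : ℕ) : ℝ) := by exact_mod_cast hsum
    push_cast [Nat.cast_sub (show 1 ≤ t by omega)] at this
    exact this
  have hA : ∑ v, (1 / (ρ - 1) + ((H.degree v : ℝ) - 1) / ((ρ - 1) * (ρ - t + 1))) =
      (t + 2) / (ρ - 1) + (∑ v, (H.degree v : ℝ) - (t + 2)) / ((ρ - 1) * (ρ - t + 1)) := by
    rw [Finset.sum_add_distrib, ← Finset.sum_div, ← Finset.sum_div, Finset.sum_sub_distrib]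
    simp [hcard]
  have hB : (t + 2) / (ρ - 1) + (t * (t - 1) + 2 - (t + 2)) / ((ρ - 1) * (ρ - t + 1)) =
      t / (ρ - t + 1) + 2 / (ρ - 1) := by
    field_simp; ring
  have hmono : ∀ S : ℝ, S ≤ t * (t - 1) + 2 → (t + 2) / (ρ - 1) + (S - (t + 2)) / ((ρ - 1) * (ρ - t + 1)) ≤
      t / (ρ - t + 1) + 2 / (ρ - 1) := by
    intro S hS
    rw [← hB]
    have := div_le_div_of_nonneg_right (show S - (t+2) ≤ t * (t - 1) + 2 - (t + 2) by linarith)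
      (show 0 ≤ (ρ - 1) * (ρ - t + 1) by positivity)
    linarith
  have hch : ∑ v, 1 / (ρ - H.degree v) ≤ ∑ v, (1 / (ρ - 1) + ((H.degree v : ℝ) - 1) / ((ρ - 1) * (ρ - t + 1))) :=
    Finset.sum_le_sum fun v _ => chord hρ (hdR1 v) (hdR v)
  by_cases hne : ∃ u v, H.degree u ≠ H.degree v
  · refine lt_of_lt_of_le (local_strict H ρ y hy hd hc hne) (hch.trans ?_)
    rw [hA]
    exact hmono _ hsumR
  · push Not at hne
    have hup := local_upper H ρ y hy hd
    obtain ⟨v0⟩ := hc.nonempty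
    have hconst : ∑ v, H.degree v = (t + 2) * H.degree v0 := by
      rw [Finset.sum_congr rfl fun v _ => hne v v0, Finset.sum_const, Finset.card_univ, hcard, smul_eq_mul]
    by_cases h1 : H.degree v0 = 1
    · refine lt_of_le_of_lt (hup.trans hch) ?_
      rw [hA, ← hB]
      have : (∑ v, (H.degree v : ℝ)) = t + 2 := by
        have h2 : ((∑ v, H.degree v : ℕ) : ℝ) = ((t + 2 : ℕ) : ℝ) := by rw [hconst, h1, mul_one]
        push_cast at h2
        exact h2
      rw [this]
      have h3 : (0:ℝ) < (t * (t - 1) + 2 - (t + 2)) / ((ρ - 1) * (ρ - t + 1)) := by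
        apply div_pos
        · nlinarith
        · positivity
      simp only [sub_self, zero_div]
      linarith
    · have h2 : H.degree v0 + 1 < t := by
        obtain ⟨k, rfl⟩ : ∃ k, t = k + 4 := ⟨t - 4, by omega⟩
        by_contra h
        have h3 : H.degree v0 = k + 3 := by have := hdeg v0; omega
        rw [hconst, h3] at hsum
        have : (k + 4 - 1) = k + 3 := by omega
        rw [this] at hsum
        nlinarith
      refine lt_of_le_of_lt hup (lt_of_lt_of_le ?_ ((le_of_eq hA).trans (hmono _ hsumR)))
      have h4 : ((H.degree v0 + 1 : ℕ) : ℝ) < t := by exact_mod_cast h2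
      push_cast at h4
      have h5 : (1:ℝ) < H.degree v0 := by
        have : 1 < H.degree v0 := by have := hdeg1 v0; omega
        exact_mod_cast this
      refine Finset.sum_lt_sum_of_nonempty ⟨v0, Finset.mem_univ _⟩ fun v _ => ?_
      rw [hne v v0]
      exact chord_strict hρ h5 (by linarith)

end CT
open SimpleGraph

namespace CT

abbrev lg {V : Type} (G : SimpleGraph V) (C : Finset V) : SimpleGraph {v // v ∈ C} :=
  G.comap (Subtype.val : {v // v ∈ C} → V)

structure Cmp {V : Type} (G : SimpleGraph V) (K C : Finset V) (t : ℕ) : Prop where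
  sub : ∀ v ∈ C, v ∉ K
  closed : ∀ u ∈ C, ∀ w, w ∉ K → G.Adj u w → w ∈ C
  conn : (lg G C).Connected
  card : C.card = t + 2

section
variable {V : Type} [Fintype V] [DecidableEq V] {s t : ℕ} {G : SimpleGraph V} {K R C : Finset V}

theorem Cmp.subR (hC : Cmp G K C t) (E : Ext s t G K R) : C ⊆ R := fun v hv => (E.hR v).2 (hC.sub v hv)

theorem Cmp.free (hC : Cmp G K C t) (E : Ext s t G K R) : Free (lg G C) s t := E.free_sub _ hC.sub

theorem Cmp.fcard (hC : Cmp G K C t) : Fintype.card {v // v ∈ C} = t + 2 := by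
  rw [Fintype.card_coe, hC.card]

theorem local_sum (hC : Cmp G K C t) (E : Ext s t G K R) (v : {v // v ∈ C}) (g : V → ℝ) :
    ∑ w ∈ R, aw G v w * g w = ∑ w : {v // v ∈ C}, aw (lg G C) v w * g w := by
  rw [← Finset.sum_subset (hC.subR E), Finset.sum_subtype C (fun _ => Iff.rfl)]
  · exact Finset.sum_congr rfl fun w _ => by
      have h : aw G v w = aw (lg G C) v w := aw_congr Iff.rfl
      rw [h]
  · intro w hw hwC
    rw [aw_not, zero_mul]
    intro h
    exact hwC (hC.closed v v.2 w ((E.hR w).1 hw) h)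

theorem local_eig (hC : Cmp G K C t) (E : Ext s t G K R) {ρ D : ℝ} {x : V → ℝ} (hx : Wts G K R ρ D x)
    (v : {v // v ∈ C}) : ρ * x v = 1 + ∑ w : {v // v ∈ C}, aw (lg G C) v w * x w := by
  rw [← local_sum hC E]
  exact hx.eig v (hC.subR E v.2)

theorem cross_zero (hC : Cmp G K C t) (E : Ext s t G K R) (x : V → ℝ) :
    ∑ v ∈ R \ C, ∑ w ∈ C, aw G v w * (x v * x w) = 0 := by
  refine Finset.sum_eq_zero fun v hv => Finset.sum_eq_zero fun w hw => ?_
  rw [Finset.mem_sdiff] at hv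
  rw [aw_not, zero_mul]
  intro h
  exact hv.2 (hC.closed w hw v ((E.hR v).1 hv.1) h.symm)

/-- Replacement inside a component. -/
theorem comp_ineq (hC : Cmp G K C t) (E : Ext s t G K R) {D : ℝ} {x : V → ℝ}
    (hx : Wts G K R (specRad G) D x) {U : Type} [Fintype U] (hU : Fintype.card U = t + 2)
    (J : SimpleGraph U) (hJ : Free J s t) (z : U → ℝ) :
    ∑ u, (2 * z u - specRad G * z u ^ 2) + ∑ u, ∑ w, aw J u w * (z u * z w) ≤
      ∑ v : {v // v ∈ C}, x v := by
  have e : U ≃ {v // v ∈ C} := Fintype.equivOfCardEq (by rw [hU, hC.fcard])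
  have := abs_ineq E hx (hC.subR E) e J hJ z
  rw [cross_zero hC E, add_zero, Finset.sum_subtype C (fun _ => Iff.rfl)] at this
  exact this

end

def KK (t : ℕ) : SimpleGraph (Fin t ⊕ Fin 2) where
  Adj u v := u ≠ v ∧ u.isLeft = v.isLeft
  symm := ⟨fun _ _ h => ⟨h.1.symm, h.2.symm⟩⟩
  loopless := ⟨fun _ h => h.1 rfl⟩

theorem KK_free {s t : ℕ} (ht : 4 ≤ t) : Free (KK t) s t := by
  intro a b ha has hb hab h
  obtain ⟨i, hi⟩ := bip_fiber (G := KK t) (fun u : Fin t ⊕ Fin 2 => u.isLeft)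
    (fun u _ v _ (huv : (KK t).Adj u v) => huv.2) ha hb h
  cases i
  · have : Bip (KK t) (↑((Finset.univ : Finset (Fin 2)).map (Function.Embedding.inr (α := Fin t)))) a b := by
      refine bip_mono ?_ (fun _ _ _ _ h => h) hi
      rintro (u | u) ⟨-, hu⟩ <;> simp at hu ⊢
    have := bip_card this
    simp at this; omega
  · have : Bip (KK t) (↑((Finset.univ : Finset (Fin t)).map (Function.Embedding.inl (β := Fin 2)))) a b := by
      refine bip_mono ?_ (fun _ _ _ _ h => h) hi
      rintro (u | u) ⟨-, hu⟩ <;> simp at hu ⊢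
    have := bip_card this
    simp at this; omega

theorem sum_ne_const {m : ℕ} (i : Fin m) (c : ℝ) : ∑ j : Fin m, (if i ≠ j then c else 0) = (m - 1) * c := by
  have : ∀ j : Fin m, (if i ≠ j then c else 0) = c - if i = j then c else 0 := by
    intro j; by_cases h : i = j <;> simp [h]
  simp only [this, Finset.sum_sub_distrib]
  simp; ring

theorem KK_val {t : ℕ} (ρ p q : ℝ) (hp : (ρ - t + 1) * p = 1) (hq : (ρ - 1) * q = 1) :
    ∑ u : Fin t ⊕ Fin 2, (2 * (Sum.elim (fun _ => p) (fun _ => q) u) - ρ * (Sum.elim (fun _ => p) (fun _ => q) u) ^ 2)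
     + ∑ u : Fin t ⊕ Fin 2, ∑ w, aw (KK t) u w * ((Sum.elim (fun _ => p) (fun _ => q) u) * (Sum.elim (fun _ => p) (fun _ => q) w))
     = t * p + 2 * q := by
  have h1 : ∀ i j : Fin t, aw (KK t) (Sum.inl i) (Sum.inl j) * (p * p) = if i ≠ j then p * p else 0 := by
    intro i j; by_cases h : i = j <;> simp [aw, KK, h]
  have h2 : ∀ i j : Fin 2, aw (KK t) (Sum.inr i) (Sum.inr j) * (q * q) = if i ≠ j then q * q else 0 := by
    intro i j; by_cases h : i = j <;> simp [aw, KK, h]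
  have h3 : ∀ (i : Fin t) (j : Fin 2), aw (KK t) (Sum.inl i) (Sum.inr j) = 0 := by
    intro i j; simp [aw, KK]
  have h4 : ∀ (i : Fin t) (j : Fin 2), aw (KK t) (Sum.inr j) (Sum.inl i) = 0 := by
    intro i j; simp [aw, KK]
  simp only [Fintype.sum_sum_type, Sum.elim_inl, Sum.elim_inr, h1, h2, h3, h4, zero_mul, Finset.sum_const_zero,
    add_zero, zero_add, sum_ne_const]
  simp only [Finset.sum_const, Finset.card_univ, Fintype.card_fin, nsmul_eq_mul]
  push_cast
  have e1 : p = (ρ - t + 1) * p * p := by rw [hp, one_mul]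
  have e2 : q = (ρ - 1) * q * q := by rw [hq, one_mul]
  linear_combination (t:ℝ) * e1 + 2 * e2

theorem c1_bound {V : Type} [Fintype V] [DecidableEq V] {s t : ℕ} {G : SimpleGraph V} {K R C : Finset V}
    (hC : Cmp G K C t) (E : Ext s t G K R) {D : ℝ} {x : V → ℝ} (hx : Wts G K R (specRad G) D x)
    (hρ : (t:ℝ) - 1 < specRad G) [DecidableRel (lg G C).Adj] :
    t * (t - 1) + 4 ≤ ∑ v, (lg G C).degree v := by
  have ht := E.ht
  have hs := E.hs
  have htR : (4:ℝ) ≤ t := by exact_mod_cast ht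
  have hlt : t * (t - 1) + 2 < ∑ v, (lg G C).degree v := by
    by_contra hcon
    push Not at hcon
    have hnt : Nontrivial {v // v ∈ C} := Fintype.one_lt_card_iff_nontrivial.1 (by rw [hC.fcard]; omega)
    have h1 := local_chord (lg G C) ht hC.fcard (specRad G) (fun v => x v) (local_eig hC E hx) hρ
      (h_degree (lg G C) (by omega) (by omega) (hC.free E))
      (fun v => hC.conn.preconnected.degree_pos_of_nontrivial v) hC.conn hcon
    have h2 := comp_ineq hC E hx (by simp) (KK t) (KK_free ht)
      (Sum.elim (fun _ => 1 / (specRad G - t + 1)) (fun _ => 1 / (specRad G - 1)))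
    rw [KK_val (specRad G) _ _ (mul_one_div_cancel (by linarith)) (mul_one_div_cancel (by linarith))] at h2
    rw [mul_one_div, mul_one_div] at h2
    linarith
  have hpar := (lg G C).sum_degrees_eq_twice_card_edges
  have : Even (t * (t - 1)) := Nat.even_mul_pred_self t
  obtain ⟨k, hk⟩ := this
  omega

end CT
open SimpleGraph

namespace CT

theorem pat_degree {V ι : Type} [Fintype V] [Fintype ι] [DecidableEq ι] (F : SimpleGraph V) [DecidableRel F.Adj]
    (f : V → ι) (c : ι → ι → Bool) (adj : ∀ u v, F.Adj u v ↔ c (f u) (f v) = true) (v : V) :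
    F.degree v = ∑ i, if c (f v) i = true then (fib f i).card else 0 := by
  rw [← F.card_neighborFinset_eq_degree,
    Finset.card_eq_sum_card_fiberwise (f := f) (t := Finset.univ) (fun v _ => Finset.mem_coe.2 (Finset.mem_univ _))]
  refine Finset.sum_congr rfl fun i _ => ?_
  split_ifs with h
  · congr 1
    ext w
    simp only [Finset.mem_filter, mem_neighborFinset, mem_fib, adj]
    constructor
    · exact fun h => h.2
    · rintro rfl; exact ⟨h, rfl⟩
  · rw [Finset.card_eq_zero]
    ext w
    simp only [Finset.mem_filter, mem_neighborFinset, adj, Finset.notMem_empty, iff_false, not_and]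
    rintro h1 rfl
    exact h h1

theorem pat_sum {V ι : Type} [Fintype V] [Fintype ι] [DecidableEq ι] (f : V → ι) (g : ι → ℕ) :
    ∑ v, g (f v) = ∑ i, (fib f i).card * g i := by
  rw [← Finset.sum_fiberwise Finset.univ f]
  refine Finset.sum_congr rfl fun i _ => ?_
  rw [Finset.sum_congr rfl (g := fun _ => g i) (fun v hv => by rw [(Finset.mem_filter.1 hv).2])]
  rw [Finset.sum_const, smul_eq_mul]; rfl

theorem f1_sum {V : Type} [Fintype V] (F : SimpleGraph V) [DecidableRel F.Adj] {t : ℕ}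
    (hcard : Fintype.card V = t + 2) (f : V → Fin 5) (h : F1 F f) : ∑ v, F.degree v + 2 = 4 * t := by
  have h1 := fib_sum f
  simp only [pat_degree F f c5 h.adj]
  rw [pat_sum f (fun k => ∑ i, if c5 k i = true then (fib f i).card else 0)]
  simp only [Fin.sum_univ_five, fib_card_one f 0 h.h0, fib_card_one f 1 h.h1, fib_card_one f 2 h.h2] at h1 ⊢
  simp [c5]
  omega

theorem f2_sum {V : Type} [Fintype V] (F : SimpleGraph V) [DecidableRel F.Adj] {t : ℕ}
    (hcard : Fintype.card V = t + 2) (f : V → Fin 7) (h : F2 F f) : ∑ v, F.degree v + 2 = 4 * t := by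
  have h1 := fib_sum f
  simp only [pat_degree F f c7 h.adj]
  rw [pat_sum f (fun k => ∑ i, if c7 k i = true then (fib f i).card else 0)]
  simp only [Fin.sum_univ_seven, fib_card_one f 0 h.h0, fib_card_one f 1 h.h1, fib_card_one f 2 h.h2,
    fib_card_one f 3 h.h3] at h1 ⊢
  simp [c7]
  omega

theorem pet_deg {V : Type} [Fintype V] (F : SimpleGraph V) [DecidableRel F.Adj]
    (e : F ≃g petersen) (v : V) : F.degree v = 3 := by
  classical
  rw [← e.degree_eq v]
  generalize e v = w
  obtain ⟨i, rfl⟩ := plab_bij.2 w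
  rw [← card_neighborFinset_eq_degree]
  have : petersen.neighborFinset (plab i) = (Finset.univ.filter (fun j => padj i j = true)).image plab := by
    ext w
    obtain ⟨j, rfl⟩ := plab_bij.2 w
    simp only [mem_neighborFinset, plab_adj, Finset.mem_image, Finset.mem_filter, Finset.mem_univ, true_and]
    constructor
    · exact fun h => ⟨j, h, rfl⟩
    · rintro ⟨k, hk, hkj⟩
      rw [plab_bij.1 hkj] at hk; exact hk
  rw [this, Finset.card_image_of_injective _ plab_bij.1]
  clear this
  revert i; decide

theorem compl_sum {V : Type} [Fintype V] [DecidableEq V] (H : SimpleGraph V) [DecidableRel H.Adj] {t : ℕ}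
    (hcard : Fintype.card V = t + 2) : ∑ v, H.degree v + ∑ v, Hᶜ.degree v = (t + 2) * (t + 1) := by
  rw [← Finset.sum_add_distrib]
  have : ∀ v, H.degree v + Hᶜ.degree v = t + 1 := by
    intro v
    have := H.degree_lt_card_verts v
    rw [H.degree_compl, hcard] at *; omega
  simp only [this, Finset.sum_const, Finset.card_univ, hcard, smul_eq_mul]

/-- All possible shapes. -/
theorem shapes {V : Type} [Fintype V] [DecidableEq V] {s t : ℕ} {G : SimpleGraph V} {K R C : Finset V}
    (hC : Cmp G K C t) (E : Ext s t G K R) {D : ℝ} {x : V → ℝ} (hx : Wts G K R (specRad G) D x)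
    (hρ : (t:ℝ) - 1 < specRad G) [DecidableRel (lg G C).Adj] :
    ((∃ f, F1 (lg G C)ᶜ f) ∨ (∃ f, F2 (lg G C)ᶜ f) ∨ (t = 8 ∧ Nonempty ((lg G C)ᶜ ≃g petersen))) ∧
    ∑ v, (lg G C).degree v = t * (t - 1) + 4 := by
  have ht := E.ht
  have hs := E.hs
  have h1 := c1_bound hC E hx hρ
  have h2 := compl_sum (lg G C) hC.fcard
  obtain ⟨a1, a2, a3⟩ := compl_facts (lg G C) (by omega) (by omega) hC.fcard hC.conn (hC.free E)
  have e : t * (t - 1) + 4 + (4 * t - 2) = (t + 2) * (t + 1) := by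
    obtain ⟨k, rfl⟩ : ∃ k, t = k + 1 := ⟨t - 1, by omega⟩
    have : 4 * (k + 1) - 2 = 4 * k + 2 := by omega
    rw [this, Nat.add_sub_cancel]; ring
  have h3 := comb (lg G C)ᶜ a1 a2 a3 (by rw [hC.fcard]; omega)
  rcases h3 with ⟨f, h⟩ | ⟨f, h⟩ | ⟨h, ⟨e'⟩⟩
  · refine ⟨Or.inl ⟨f, h⟩, ?_⟩
    have := f1_sum _ hC.fcard f h
    omega
  · refine ⟨Or.inr (Or.inl ⟨f, h⟩), ?_⟩
    have := f2_sum _ hC.fcard f h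
    omega
  · rw [hC.fcard] at h
    refine ⟨Or.inr (Or.inr ⟨by omega, ⟨e'⟩⟩), ?_⟩
    have : ∑ v, (lg G C)ᶜ.degree v = 3 * (t + 2) := by
      rw [Finset.sum_congr rfl (fun v _ => pet_deg _ e' v), Finset.sum_const, Finset.card_univ, hC.fcard, smul_eq_mul]; ring
    omega

end CT
open SimpleGraph

namespace CT

section
variable {W : Type} [Fintype W] [DecidableEq W]

open Classical in
noncomputable def touch (L : SimpleGraph W) (S : Finset W) : ℝ :=
  ∑ v, ∑ w, if v ∈ S ∨ w ∈ S then aw L v w else 0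

theorem touch_closed (L : SimpleGraph W) (S : Finset W) (hS : ∀ v ∈ S, ∀ w, L.Adj v w → w ∈ S) :
    touch L S = ∑ v ∈ S, ∑ w, aw L v w := by
  unfold touch
  rw [← Finset.sum_subset (Finset.subset_univ S)]
  · refine Finset.sum_congr rfl fun v hv => Finset.sum_congr rfl fun w _ => ?_
    simp [hv]
  · intro v _ hv
    refine Finset.sum_eq_zero fun w _ => ?_
    split_ifs with h
    · refine aw_not fun h' => ?_
      rcases h with h | h
      · exact hv h
      · exact hv (hS w h v h'.symm)
    · rfl

theorem touch_union (L : SimpleGraph W) (S T : Finset W) : touch L (S ∪ T) ≤ touch L S + touch L T := by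
  unfold touch
  rw [← Finset.sum_add_distrib]
  refine Finset.sum_le_sum fun v _ => ?_
  rw [← Finset.sum_add_distrib]
  refine Finset.sum_le_sum fun w _ => ?_
  have := aw_nonneg L v w
  simp only [Finset.mem_union]
  by_cases h1 : v ∈ S <;> by_cases h2 : v ∈ T <;> by_cases h3 : w ∈ S <;> by_cases h4 : w ∈ T <;>
    simp [h1, h2, h3, h4] <;> linarith

/-- BFS balls -/
noncomputable def ballF (L : SimpleGraph W) (u : W) : ℕ → Finset W
  | 0 => {u}
  | r + 1 => open Classical in ballF L u r ∪ Finset.univ.filter (fun v => ∃ w ∈ ballF L u r, L.Adj w v)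

theorem mem_ball_succ (L : SimpleGraph W) (u v : W) (r : ℕ) :
    v ∈ ballF L u (r+1) ↔ v ∈ ballF L u r ∨ ∃ w ∈ ballF L u r, L.Adj w v := by
  simp [ballF]

theorem ball_mono (L : SimpleGraph W) (u : W) {r r' : ℕ} (h : r ≤ r') : ballF L u r ⊆ ballF L u r' := by
  induction h with
  | refl => exact fun _ h => h
  | step _ ih => exact fun v hv => (mem_ball_succ L u v _).2 (Or.inl (ih hv))

theorem ball_card (L : SimpleGraph W) [DecidableRel L.Adj] (u : W) {t : ℕ} (hd : ∀ v, L.degree v + 1 ≤ t) (r : ℕ) :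
    (ballF L u r).card ≤ t ^ r := by
  induction r with
  | zero => simp [ballF]
  | succ r ih =>
    have : ballF L u (r+1) ⊆ (ballF L u r).biUnion (fun w => insert w (L.neighborFinset w)) := by
      intro v hv
      rw [mem_ball_succ] at hv
      rw [Finset.mem_biUnion]
      rcases hv with h | ⟨w, hw, h⟩
      · exact ⟨v, h, by simp⟩
      · exact ⟨w, hw, by simp [h]⟩
    calc _ ≤ _ := Finset.card_le_card this
      _ ≤ (ballF L u r).card * t := Finset.card_biUnion_le_card_mul _ _ _ (fun w _ =>
          (Finset.card_insert_le _ _).trans (by rw [L.card_neighborFinset_eq_degree]; exact hd w))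
      _ ≤ t ^ r * t := Nat.mul_le_mul_right _ ih
      _ = _ := by ring

def Lev (L : SimpleGraph W) (u : W) (i : ℕ) (v : W) : Prop := v ∈ ballF L u i ∧ ∀ j < i, v ∉ ballF L u j

theorem lev_path (L : SimpleGraph W) (u : W) (r : ℕ) : ∀ v, Lev L u r v →
    ∃ p : ℕ → W, p r = v ∧ (∀ i ≤ r, Lev L u i (p i)) ∧ ∀ i < r, L.Adj (p i) (p (i+1)) := by
  induction r with
  | zero =>
    intro v hv
    refine ⟨fun _ => v, rfl, fun i hi => ?_, fun i hi => absurd hi (by omega)⟩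
    rw [Nat.le_zero.1 hi]; exact hv
  | succ r ih =>
    intro v hv
    obtain ⟨h1, h2⟩ := hv
    rcases (mem_ball_succ L u v r).1 h1 with h | ⟨w, hw, hwv⟩
    · exact absurd h (h2 r (by omega))
    · have hl : Lev L u r w := by
        refine ⟨hw, fun j hj hwj => h2 (j+1) (by omega) ?_⟩
        exact (mem_ball_succ L u v j).2 (Or.inr ⟨w, hwj, hwv⟩)
      obtain ⟨p, hp1, hp2, hp3⟩ := ih w hl
      refine ⟨fun i => if i ≤ r then p i else v, by simp, fun i hi => ?_, fun i hi => ?_⟩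
      · dsimp only
        split_ifs with h
        · exact hp2 i h
        · have : i = r + 1 := by omega
          rw [this]; exact ⟨h1, h2⟩
      · dsimp only
        rw [if_pos (by omega)]
        split_ifs with h
        · exact hp3 i (by omega)
        · have : i = r := by omega
          rw [this, hp1]; exact hwv

theorem path_connected (L : SimpleGraph W) (p : ℕ → W) (r : ℕ) (h : ∀ i < r, L.Adj (p i) (p (i+1))) :
    (L.induce (↑((Finset.range (r+1)).image p) : Set W)).Connected := by
  induction r with
  | zero =>
    have e : (↑((Finset.range (0+1)).image p) : Set W) = {p 0} := by simp
    rw [e]; exact induce_singleton_connected L (p 0)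
  | succ r ih =>
    have h1 := ih (fun i hi => h i (by omega))
    have h2 := induce_pair_connected' L (h r (by omega))
    have h3 := induce_union_connected h1.preconnected h2.preconnected ⟨p r, by
      simp; exact ⟨r, by omega, rfl⟩⟩
    have e : (↑((Finset.range (r+1)).image p) : Set W) ∪ {p r, p (r+1)} = ↑((Finset.range (r+1+1)).image p) := by
      ext w
      simp only [Finset.coe_image, Set.mem_union, Set.mem_image, Finset.coe_range, Set.mem_Iio, Set.mem_insert_iff, Set.mem_singleton_iff]
      constructor
      · rintro (⟨i, hi, rfl⟩ | rfl | rfl)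
        · exact ⟨i, by omega, rfl⟩
        · exact ⟨r, by omega, rfl⟩
        · exact ⟨r+1, by omega, rfl⟩
      · rintro ⟨i, hi, rfl⟩
        by_cases hi' : i < r + 1
        · exact Or.inl ⟨i, hi', rfl⟩
        · have : i = r + 1 := by omega
          subst this; simp
    rw [e] at h3
    exact h3

theorem lev_uniq (L : SimpleGraph W) (u : W) {i j : ℕ} {v : W} (h : Lev L u i v) (h' : Lev L u j v) : i = j := by
  rcases lt_trichotomy i j with hh | hh | hh
  · exact absurd h.1 (h'.2 i hh)
  · exact hh
  · exact absurd h'.1 (h.2 j hh)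

theorem lev_adj (L : SimpleGraph W) (u : W) {i j : ℕ} {v w : W} (h : Lev L u i v) (h' : Lev L u j w)
    (ha : L.Adj v w) : j ≤ i + 1 := by
  by_contra hh
  exact h'.2 (i+1) (by omega) ((mem_ball_succ L u w i).2 (Or.inr ⟨v, h.1, ha⟩))

/-- A long geodesic touches few edges. -/
theorem path_touch (L : SimpleGraph W) {s t : ℕ} (hs : 1 ≤ s) (ht : 1 ≤ t) (hf : Free L s t) (u : W)
    (p : ℕ → W) (r : ℕ) (hp : ∀ i ≤ r, Lev L u i (p i)) (ha : ∀ i < r, L.Adj (p i) (p (i+1))) :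
    ((Finset.range (r+1)).image p).card = r + 1 ∧
    touch L ((Finset.range (r+1)).image p) ≤ 2 * (r+1) + 2 * (t * t) := by
  classical
  set S := (Finset.range (r+1)).image p with hS
  have hcard : S.card = r + 1 := by
    rw [hS, Finset.card_image_of_injOn, Finset.card_range]
    intro i hi j hj hij
    simp only [Finset.coe_range, Set.mem_Iio] at hi hj
    have h2 := hp j (by omega)
    rw [← hij] at h2
    exact lev_uniq L u (hp i (by omega)) h2
  refine ⟨hcard, ?_⟩
  let N := Finset.univ.filter (fun w => w ∉ S ∧ ∃ x ∈ S, L.Adj x w)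
  have hN : N.card ≤ t := by
    by_contra hlt
    obtain ⟨Q, hQ, hQc⟩ := Finset.exists_subset_card_eq (s := N) (n := t) (by omega)
    have hb := bip_star L ↑S ∅ Q (path_connected L p r ha) (by simp)
      (fun q hq => by have := hQ hq; simp only [N, Finset.mem_filter] at this; simpa using this.2.1) (by simp)
      (fun q hq => by have := hQ hq; simp only [N, Finset.mem_filter] at this; exact this.2.2) (by simp)
    rw [hQc] at hb
    exact hf _ _ (by simp) (by simpa using hs) ht (by simp; omega) hb
  have hdeg : ∀ v, ∑ w, aw L v w ≤ t := by
    intro v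
    rw [← deg_aw]
    have := h_degree L hs ht hf v
    exact_mod_cast (by omega : L.degree v ≤ t)
  have hin : ∀ v ∈ S, ∑ w ∈ S, aw L v w ≤ 2 := by
    intro v hv
    obtain ⟨i, hi, rfl⟩ := Finset.mem_image.1 hv
    rw [Finset.mem_range] at hi
    have hsub : ∑ w ∈ S, aw L (p i) w ≤ ∑ w ∈ ({p (i-1), p (i+1)} : Finset W), (1:ℝ) := by
      calc ∑ w ∈ S, aw L (p i) w = ∑ w ∈ S.filter (fun w => L.Adj (p i) w), aw L (p i) w := by
            rw [Finset.sum_filter]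
            exact Finset.sum_congr rfl fun w _ => by
              split_ifs with h
              · rfl
              · exact aw_not h
        _ ≤ ∑ w ∈ S.filter (fun w => L.Adj (p i) w), 1 := Finset.sum_le_sum fun w _ => aw_le_one _ _ _
        _ ≤ _ := by
          refine Finset.sum_le_sum_of_subset_of_nonneg ?_ (fun _ _ _ => zero_le_one)
          intro w hw
          rw [Finset.mem_filter] at hw
          obtain ⟨j, hj, rfl⟩ := Finset.mem_image.1 hw.1
          rw [Finset.mem_range] at hj
          have e1 := lev_adj L u (hp i (by omega)) (hp j (by omega)) hw.2
          have e2 := lev_adj L u (hp j (by omega)) (hp i (by omega)) hw.2.symm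
          have e3 : i ≠ j := by rintro rfl; exact L.loopless.irrefl _ hw.2
          have : j = i - 1 ∨ j = i + 1 := by omega
          rcases this with rfl | rfl <;> simp
    refine hsub.trans ?_
    rw [Finset.sum_const, nsmul_eq_mul, mul_one]
    exact_mod_cast Finset.card_le_two
  have hcross : ∑ w ∈ N, ∑ v, aw L w v ≤ t * t := by
    calc _ ≤ ∑ w ∈ N, (t:ℝ) := Finset.sum_le_sum fun w _ => hdeg w
      _ = N.card * t := by rw [Finset.sum_const, nsmul_eq_mul]
      _ ≤ t * t := by gcongr
  have key : ∀ v w, (if v ∈ S ∨ w ∈ S then aw L v w else 0) ≤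
      (if v ∈ S then if w ∈ S then aw L v w else 0 else 0) + (if v ∈ N then aw L v w else 0) + (if w ∈ N then aw L w v else 0) := by
    intro v w
    have h0 := aw_nonneg L v w
    have hsy := aw_symm L v w
    by_cases hA : L.Adj v w
    · by_cases h1 : v ∈ S <;> by_cases h2 : w ∈ S
      · simp only [h1, h2, true_or, if_true]
        split_ifs <;> linarith
      · have : w ∈ N := by simp only [N, Finset.mem_filter, Finset.mem_univ, true_and]; exact ⟨h2, v, h1, hA⟩
        simp only [h1, h2, this, true_or, if_true, if_false]
        split_ifs <;> linarith
      · have : v ∈ N := by simp only [N, Finset.mem_filter, Finset.mem_univ, true_and]; exact ⟨h1, w, h2, hA.symm⟩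
        simp only [h1, h2, this, or_true, if_true, if_false]
        split_ifs <;> linarith
      · simp only [h1, h2, or_self, if_false]
        split_ifs <;> linarith
    · rw [← hsy, aw_not hA]; simp
  have e1 : ∑ v, ∑ w, (if v ∈ S then if w ∈ S then aw L v w else 0 else 0) = ∑ v ∈ S, ∑ w ∈ S, aw L v w := by
    simp [← Finset.sum_filter, Finset.sum_ite_mem]
  have e2 : ∑ v, ∑ w, (if v ∈ N then aw L v w else 0) = ∑ v ∈ N, ∑ w, aw L v w := by
    rw [← Finset.sum_subset (Finset.subset_univ N)]
    · exact Finset.sum_congr rfl fun v hv => by simp [hv]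
    · intro v _ hv; simp [hv]
  have e3 : ∑ v, ∑ w, (if w ∈ N then aw L w v else 0) = ∑ v ∈ N, ∑ w, aw L v w := by
    rw [Finset.sum_comm]; exact e2
  calc touch L S ≤ ∑ v, ∑ w, ((if v ∈ S then if w ∈ S then aw L v w else 0 else 0) + (if v ∈ N then aw L v w else 0) + (if w ∈ N then aw L w v else 0)) :=
        Finset.sum_le_sum fun v _ => Finset.sum_le_sum fun w _ => key v w
    _ = ∑ v ∈ S, ∑ w ∈ S, aw L v w + ∑ v ∈ N, ∑ w, aw L v w + ∑ v ∈ N, ∑ w, aw L v w := by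
        simp only [Finset.sum_add_distrib]
        rw [e1, e2, e3]
    _ ≤ ∑ v ∈ S, (2:ℝ) + t * t + t * t := by
        have := Finset.sum_le_sum hin
        linarith
    _ = _ := by rw [Finset.sum_const, hcard, nsmul_eq_mul]; push_cast; ring

end
end CT
open SimpleGraph

namespace CT

def Mb (t : ℕ) : ℕ := t ^ (t * t)
def k0 (t : ℕ) : ℕ := Mb t + t
def N0 (t : ℕ) : ℕ := t + 2 + (Mb t + 1) * t * Mb t + 1

theorem big_set {W : Type} [Fintype W] [DecidableEq W] (L : SimpleGraph W) {s t : ℕ} (hs : 1 ≤ s) (ht : 8 ≤ t)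
    (hf : Free L s t) (C : Finset W) (hC : ∀ v ∈ C, ∀ w, L.Adj v w → w ∈ C) (hCc : C.card = t + 2)
    (hW : N0 t ≤ Fintype.card W) :
    ∃ (S : Finset W) (k : ℕ), Disjoint C S ∧ 1 ≤ k ∧ k ≤ k0 t ∧ S.card = k * t ∧
      touch L S ≤ k * t * ((t:ℝ) - 1) := by
  classical
  have htR : (8:ℝ) ≤ t := by exact_mod_cast ht
  by_cases hpath : ∃ u, u ∉ C ∧ ∃ v, Lev L u (t * t - 1) v
  · obtain ⟨u, huC, v, hv⟩ := hpath
    obtain ⟨p, hp1, hp2, hp3⟩ := lev_path L u _ v hv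
    obtain ⟨h1, h2⟩ := path_touch L hs (by omega) hf u p _ hp2 hp3
    have htt : t * t - 1 + 1 = t * t := by
      have : 1 ≤ t * t := Nat.mul_pos (by omega) (by omega)
      omega
    have hp0 : p 0 = u := by
      have := (hp2 0 (by omega)).1
      simpa [ballF] using this
    have hpC : ∀ i, i ≤ t * t - 1 → p i ∉ C := by
      intro i
      induction i with
      | zero => intro _; rw [hp0]; exact huC
      | succ i ih =>
        intro hi hc
        exact ih (by omega) (hC _ hc _ (hp3 i (by omega)).symm)
    refine ⟨(Finset.range (t * t - 1 + 1)).image p, t, ?_, by omega, by unfold k0; omega, by rw [h1, htt], h2.trans ?_⟩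
    · rw [Finset.disjoint_right]
      intro w hw
      obtain ⟨i, hi, rfl⟩ := Finset.mem_image.1 hw
      exact hpC i (by rw [Finset.mem_range] at hi; omega)
    · have e : ((t * t - 1 : ℕ) : ℝ) + 1 = t * t := by exact_mod_cast htt
      rw [e]
      nlinarith [mul_nonneg (by positivity : (0:ℝ) ≤ (t:ℝ) * t) (by linarith : (0:ℝ) ≤ (t:ℝ) - 8)]
  · push Not at hpath
    have hd := h_degree L hs (by omega) hf
    have htt : 1 ≤ t * t := Nat.mul_pos (by omega) (by omega)
    -- balls are closed
    have hclosed : ∀ u, u ∉ C → ∀ v ∈ ballF L u (t * t - 1), ∀ w, L.Adj v w → w ∈ ballF L u (t * t - 1) := by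
      intro u hu
      have hB : ballF L u (t * t - 1) ⊆ ballF L u (t * t - 2) := by
        intro v hv
        by_contra hn
        refine hpath u hu v ⟨hv, fun j hj h => hn (ball_mono L u (by omega) h)⟩
      intro v hv w hvw
      have : t * t - 1 = t * t - 2 + 1 := by
        have : 8 * 8 ≤ t * t := Nat.mul_le_mul ht ht
        omega
      rw [this, mem_ball_succ]
      exact Or.inr ⟨v, hB hv, hvw⟩
    have hreach : ∀ u, u ∉ C → ∀ v, L.Reachable u v → v ∈ ballF L u (t * t - 1) := by
      intro u hu v hr
      obtain ⟨p⟩ := hr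
      have : ∀ a b, L.Walk a b → a ∈ ballF L u (t * t - 1) → b ∈ ballF L u (t * t - 1) := by
        intro a b p
        induction p with
        | nil => exact fun h => h
        | cons h p ih => exact fun ha => ih (hclosed u hu _ ha _ h)
      exact this u v p (ball_mono L u (Nat.zero_le _) (by simp [ballF]))
    have hCr : ∀ u v, L.Reachable u v → u ∈ C → v ∈ C := by
      intro u v ⟨p⟩
      induction p with
      | nil => exact fun h => h
      | cons h p ih => exact fun ha => ih (hC _ ha _ h)
    let f : W → L.ConnectedComponent := L.connectedComponentMk
    have hff : ∀ u v, f u = f v ↔ L.Reachable u v := fun u v => ConnectedComponent.eq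
    let Q := (Finset.univ \ C).image f
    let sz : L.ConnectedComponent → ℕ := fun q => (Finset.univ.filter (fun v => f v = q)).card
    have hsz : ∀ q ∈ Q, 1 ≤ sz q ∧ sz q ≤ Mb t := by
      intro q hq
      obtain ⟨u, hu, rfl⟩ := Finset.mem_image.1 hq
      simp only [Finset.mem_sdiff, Finset.mem_univ, true_and] at hu
      refine ⟨Finset.card_pos.2 ⟨u, by simp⟩, ?_⟩
      refine (Finset.card_le_card (t := ballF L u (t * t - 1)) fun v hv => ?_).trans ((ball_card L u hd _).trans ?_)
      · rw [Finset.mem_filter] at hv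
        exact hreach u hu v ((hff u v).1 hv.2.symm)
      · exact Nat.pow_le_pow_right (by omega) (by omega)
    have hQC : ∀ v, f v ∈ Q → v ∉ C := by
      intro v hv hvC
      obtain ⟨u, hu, huv⟩ := Finset.mem_image.1 hv
      simp only [Finset.mem_sdiff, Finset.mem_univ, true_and] at hu
      exact hu (hCr v u ((hff v u).1 huv.symm) hvC)
    have hcount : Fintype.card W - (t + 2) ≤ Q.card * Mb t := by
      have h1 : (Finset.univ \ C).card = ∑ q ∈ Q, ((Finset.univ \ C).filter (fun v => f v = q)).card :=
        Finset.card_eq_sum_card_fiberwise (fun v hv => Finset.mem_coe.2 (Finset.mem_image_of_mem _ hv))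
      rw [Finset.card_sdiff_of_subset (Finset.subset_univ _), Finset.card_univ, hCc] at h1
      rw [h1, ← smul_eq_mul]
      refine Finset.sum_le_card_nsmul _ _ _ fun q hq => (Finset.card_le_card ?_).trans (hsz q hq).2
      exact Finset.filter_subset_filter _ (Finset.subset_univ _)
    have hQ : (Mb t + 1) * t ≤ Q.card := by
      by_contra hlt
      push Not at hlt
      have h1 : Q.card * Mb t ≤ (Mb t + 1) * t * Mb t := Nat.mul_le_mul_right _ hlt.le
      unfold N0 at hW
      omega
    obtain ⟨m, hm, hmc⟩ := Finset.exists_le_card_fiber_of_mul_le_card_of_maps_to (s := Q) (t := Finset.range (Mb t + 1))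
      (f := sz) (n := t) (fun q hq => Finset.mem_range.2 (by have := (hsz q hq).2; omega)) ⟨0, by simp⟩ (by simpa using hQ)
    obtain ⟨P, hP, hPc⟩ := Finset.exists_subset_card_eq hmc
    have hPm : ∀ q ∈ P, q ∈ Q ∧ sz q = m := fun q hq => by simpa using hP hq
    have hPne : P.Nonempty := Finset.card_pos.1 (by omega)
    obtain ⟨q0, hq0⟩ := hPne
    have hm1 := hsz q0 (hPm q0 hq0).1
    rw [(hPm q0 hq0).2] at hm1
    have hSc : (Finset.univ.filter (fun v => f v ∈ P)).card = m * t := by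
      rw [Finset.card_eq_sum_card_fiberwise (f := f) (t := P) (fun v hv => by simpa using hv)]
      rw [Finset.sum_congr rfl (g := fun _ => m), Finset.sum_const, hPc, smul_eq_mul, mul_comm]
      intro q hq
      rw [← (hPm q hq).2, Finset.filter_filter]
      congr 1
      ext v
      simp only [Finset.mem_filter, Finset.mem_univ, true_and, and_iff_right_iff_imp]
      rintro rfl; exact hq
    refine ⟨Finset.univ.filter (fun v => f v ∈ P), m, ?_, hm1.1, by unfold k0; omega, hSc, ?_⟩
    · rw [Finset.disjoint_right]
      intro v hv
      simp only [Finset.mem_filter, Finset.mem_univ, true_and] at hv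
      exact hQC v (hPm _ hv).1
    · rw [touch_closed]
      · calc _ ≤ ∑ v ∈ Finset.univ.filter (fun v => f v ∈ P), ((t:ℝ) - 1) := Finset.sum_le_sum fun v _ => by
              rw [← deg_aw]
              have : ((L.degree v + 1 : ℕ) : ℝ) ≤ t := by exact_mod_cast hd v
              push_cast at this; linarith
          _ = _ := by rw [Finset.sum_const, hSc, nsmul_eq_mul]; push_cast; ring
      · intro v hv w hvw
        simp only [Finset.mem_filter, Finset.mem_univ, true_and] at hv ⊢
        rw [← (hff v w).2 hvw.reachable]; exact hv

end CT
open SimpleGraph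

namespace CT

theorem bip_tight {V : Type} [Fintype V] [DecidableEq V] {G : SimpleGraph V} {W : Finset V} {a b : ℕ}
    (h : Bip G ↑W a b) (hW : W.card ≤ a + b) :
    ∃ A ⊆ W, A.card = a ∧ ∀ u ∈ A, ∀ v ∈ W, v ∉ A → G.Adj u v := by
  obtain ⟨φ, h1, h2, h3, h4⟩ := h
  have hne : ∀ i, ∃ v, v ∈ φ i := fun i => by
    obtain ⟨v⟩ := (h2 i).nonempty
    exact ⟨v.1, v.2⟩
  choose g hg using hne
  have hinj : Function.Injective g := by
    intro i j hij
    by_contra hne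
    exact Set.disjoint_left.1 (h3 hne) (hg i) (hij ▸ hg j)
  have himg : (Finset.univ : Finset (Fin a ⊕ Fin b)).image g = W := by
    refine Finset.eq_of_subset_of_card_le ?_ ?_
    · intro v hv
      obtain ⟨i, -, rfl⟩ := Finset.mem_image.1 hv
      exact h1 i (hg i)
    · rw [Finset.card_image_of_injective _ hinj]; simpa using hW
  have hsing : ∀ i, ∀ v ∈ φ i, v = g i := by
    intro i v hv
    have : v ∈ (Finset.univ : Finset (Fin a ⊕ Fin b)).image g := by rw [himg]; exact h1 i hv
    obtain ⟨j, -, rfl⟩ := Finset.mem_image.1 this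
    by_contra hne
    exact Set.disjoint_left.1 (h3 (fun h : j = i => hne (by rw [h]))) (hg j) hv
  refine ⟨(Finset.univ : Finset (Fin a)).image (fun i => g (Sum.inl i)), ?_, ?_, ?_⟩
  · intro v hv
    obtain ⟨i, -, rfl⟩ := Finset.mem_image.1 hv
    exact h1 _ (hg _)
  · rw [Finset.card_image_of_injective _ (fun i j h => Sum.inl_injective (hinj h))]; simp
  · intro u hu v hv hvA
    obtain ⟨i, -, rfl⟩ := Finset.mem_image.1 hu
    rw [← himg] at hv
    obtain ⟨j, -, rfl⟩ := Finset.mem_image.1 hv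
    rcases j with j | j
    · exact absurd (Finset.mem_image.2 ⟨j, Finset.mem_univ _, rfl⟩) hvA
    · obtain ⟨x, hx, y, hy, hxy⟩ := h4 i j
      rw [hsing _ _ hx, hsing _ _ hy] at hxy
      exact hxy

/-- complement of a star forest given by parent map -/
def SC {V : Type} (par : V → V) : SimpleGraph V where
  Adj i j := i ≠ j ∧ par i ≠ j ∧ par j ≠ i
  symm := ⟨fun _ _ h => ⟨h.1.symm, h.2.2, h.2.1⟩⟩
  loopless := ⟨fun _ h => h.1 rfl⟩

theorem sc_free {V : Type} [Fintype V] [DecidableEq V] (par : V → V) {s t : ℕ} (hcard : Fintype.card V = t + 1)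
    (hsz : ∀ v, s < (Finset.univ.filter (fun w => par w = par v)).card) :
    Free (SC par) s t := by
  intro a b ha has hb hab h
  have h' : Bip (SC par) (↑(Finset.univ : Finset V)) a b := by simpa using h
  obtain ⟨A, -, hAc, hA⟩ := bip_tight h' (by rw [Finset.card_univ, hcard]; omega)
  obtain ⟨v, hv⟩ : A.Nonempty := Finset.card_pos.1 (by omega)
  have hr : par v ∈ A := by
    by_contra hn
    exact (hA v hv _ (Finset.mem_univ _) hn).2.1 rfl
  have hsub : Finset.univ.filter (fun w => par w = par v) ⊆ A := by
    intro w hw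
    by_contra hn
    exact (hA _ hr w (Finset.mem_univ _) hn).2.2 (Finset.mem_filter.1 hw).2
  have := Finset.card_le_card hsub
  have := hsz v
  omega

theorem sc_sum {V : Type} [Fintype V] [DecidableEq V] (par : V → V) {t m : ℕ} (hcard : Fintype.card V = t + 1)
    (hroots : (Finset.univ.filter (fun v => par v ≠ v)).card ≤ m) :
    (t:ℝ) * (t + 1) - 2 * m ≤ ∑ i, ∑ j, aw (SC par) i j := by
  have h1 : ∀ i j, 1 - (if i = j then 1 else 0) - (if par i = j then (if par i ≠ i then (1:ℝ) else 0) else 0)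
      - (if par j = i then (if par j ≠ j then (1:ℝ) else 0) else 0) ≤ aw (SC par) i j := by
    intro i j
    unfold aw SC
    by_cases h1 : i = j
    · subst h1; simp; split_ifs <;> norm_num
    · by_cases h2 : par i = j
      · have : par i ≠ i := by rw [h2]; exact Ne.symm h1
        simp only [h1, h2, if_false, if_true]
        split_ifs <;> simp_all
      · by_cases h3 : par j = i
        · simp [h1, h2, h3]
        · simp [h1, h2, h3]
  have h2 : ∑ i, ∑ j, (1 - (if i = j then 1 else 0) - (if par i = j then (if par i ≠ i then (1:ℝ) else 0) else 0)
      - (if par j = i then (if par j ≠ j then (1:ℝ) else 0) else 0)) ≤ ∑ i, ∑ j, aw (SC par) i j :=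
    Finset.sum_le_sum fun i _ => Finset.sum_le_sum fun j _ => h1 i j
  refine le_trans ?_ h2
  simp only [Finset.sum_sub_distrib]
  have e1 : ∑ i : V, ∑ j : V, (if par j = i then (if par j ≠ j then (1:ℝ) else 0) else 0) = (Finset.univ.filter (fun v => par v ≠ v)).card := by
    rw [Finset.sum_comm, Finset.card_filter]; simp
  have e2 : ∑ i : V, ∑ j : V, (if par i = j then (if par i ≠ i then (1:ℝ) else 0) else 0) = (Finset.univ.filter (fun v => par v ≠ v)).card := by
    rw [Finset.card_filter]; simp
  rw [e1, e2]
  have hm : ((Finset.univ.filter (fun v => par v ≠ v)).card : ℝ) ≤ m := by exact_mod_cast hroots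
  simp [hcard]
  nlinarith

def JJ {V : Type} (k t : ℕ) (P : SimpleGraph V) : SimpleGraph ((Fin k × Fin t) ⊕ (Fin 2 × V)) where
  Adj u v := match u, v with
    | Sum.inl a, Sum.inl b => a.1 = b.1 ∧ a.2 ≠ b.2
    | Sum.inr a, Sum.inr b => a.1 = b.1 ∧ P.Adj a.2 b.2
    | _, _ => False
  symm := ⟨by
    rintro (a | a) (b | b) h
    · exact ⟨h.1.symm, h.2.symm⟩
    · exact h
    · exact h
    · exact ⟨h.1.symm, h.2.symm⟩⟩
  loopless := ⟨by
    rintro (a | a) h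
    · exact h.2 rfl
    · exact P.loopless.irrefl _ h.2⟩

theorem JJ_free {V : Type} [Fintype V] [DecidableEq V] {s t : ℕ} (k : ℕ) (P : SimpleGraph V) (hP : Free P s t) :
    Free (JJ k t P) s t := by
  intro a b ha has hb hab h
  obtain ⟨i, hi⟩ := bip_fiber (G := JJ k t P) (fun u => Sum.map Prod.fst Prod.fst u)
    (fun u _ v _ (huv : (JJ k t P).Adj u v) => by
      rcases u with u | u <;> rcases v with v | v
      · exact congrArg Sum.inl huv.1
      · exact absurd huv (fun h => h)
      · exact absurd huv (fun h => h)
      · exact congrArg Sum.inr huv.1) ha hb h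
  rcases i with i | i
  · have : Bip (JJ k t P) (↑((Finset.univ : Finset (Fin t)).image (fun j => (Sum.inl (i, j) : (Fin k × Fin t) ⊕ (Fin 2 × V))))) a b := by
      refine bip_mono ?_ (fun _ _ _ _ h => h) hi
      rintro (⟨u1, u2⟩ | u) ⟨-, hu⟩
      · simp at hu ⊢; exact hu.symm
      · simp at hu
    have h1 := bip_card this
    have h2 := Finset.card_image_le (s := (Finset.univ : Finset (Fin t))) (f := fun j => (Sum.inl (i, j) : (Fin k × Fin t) ⊕ (Fin 2 × V)))
    simp at h2; omega
  · rcases isEmpty_or_nonempty V with hV | ⟨⟨v0⟩⟩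
    · have : Bip (JJ k t P) (↑(∅ : Finset ((Fin k × Fin t) ⊕ (Fin 2 × V)))) a b := by
        refine bip_mono ?_ (fun _ _ _ _ h => h) hi
        rintro (u | u) ⟨-, hu⟩
        · simp at hu
        · exact hV.elim u.2
      have := bip_card this
      simp at this; omega
    · refine hP a b ha has hb hab (bip_mapOn (fun u => Sum.elim (fun _ => v0) Prod.snd u) ?_ ?_ (fun _ _ => Set.mem_univ _) hi)
      · rintro (u | u) ⟨-, hu⟩ (v | v) ⟨-, hv⟩ huv
        · simp at hu
        · simp at hu
        · simp at hv
        · simp at hu hv huv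
          rw [Prod.ext (hu.trans hv.symm) huv]
      · rintro (u | u) ⟨-, hu⟩ (v | v) ⟨-, hv⟩ huv
        · simp at hu
        · simp at hu
        · simp at hv
        · exact huv.2

theorem JJ_sum {V : Type} [Fintype V] (k t : ℕ) (P : SimpleGraph V) :
    ∑ u, ∑ w, aw (JJ k t P) u w = k * t * (t - 1) + 2 * ∑ i, ∑ j, aw P i j := by
  classical
  have h1 : ∀ a b : Fin k × Fin t, aw (JJ k t P) (Sum.inl a) (Sum.inl b) = if a.1 = b.1 then (if a.2 ≠ b.2 then 1 else 0) else 0 := by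
    intro a b
    by_cases h : a.1 = b.1 <;> by_cases h' : a.2 = b.2 <;> simp [aw, JJ, h, h']
  have h2 : ∀ a b : Fin 2 × V, aw (JJ k t P) (Sum.inr a) (Sum.inr b) = if a.1 = b.1 then aw P a.2 b.2 else 0 := by
    intro a b
    by_cases h : a.1 = b.1 <;> simp [aw, JJ, h]
  have h3 : ∀ (a : Fin k × Fin t) (b : Fin 2 × V), aw (JJ k t P) (Sum.inl a) (Sum.inr b) = 0 := by
    intro a b; simp [aw, JJ]
  have h4 : ∀ (a : Fin k × Fin t) (b : Fin 2 × V), aw (JJ k t P) (Sum.inr b) (Sum.inl a) = 0 := by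
    intro a b; simp [aw, JJ]
  simp only [Fintype.sum_sum_type, h1, h2, h3, h4, Finset.sum_const_zero, add_zero, zero_add, Fintype.sum_prod_type]
  congr 1
  · have : ∀ (x : Fin k) (i : Fin t), ∑ y : Fin k, ∑ j : Fin t, (if x = y then (if i ≠ j then (1:ℝ) else 0) else 0) = t - 1 := by
      intro x i
      rw [Finset.sum_comm]
      simp only [Finset.sum_ite_eq, Finset.mem_univ, if_true]
      rw [sum_ne_const, mul_one]
    simp only [this, Finset.sum_const, Finset.card_univ, Fintype.card_fin, nsmul_eq_mul]
    ring
  · simp [Fin.sum_univ_two, two_mul]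

def par3 (s t : ℕ) (h : 3 * (s + 1) ≤ t + 1) (i : Fin (t+1)) : Fin (t+1) :=
  if (i:ℕ) < s + 1 then ⟨0, by omega⟩ else if (i:ℕ) < 2 * (s+1) then ⟨s+1, by omega⟩ else ⟨2*(s+1), by omega⟩

theorem par3_free (s t : ℕ) (h : 3 * (s + 1) ≤ t + 1) : Free (SC (par3 s t h)) s t := by
  refine sc_free _ (by simp) ?_
  · intro v
    have hmap : ∀ g : Fin (s+1) → Fin (t+1), Function.Injective g → (∀ j, par3 s t h (g j) = par3 s t h v) →
        s < (Finset.univ.filter (fun w => par3 s t h w = par3 s t h v)).card := by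
      intro g hg hg2
      have := Finset.card_le_card_of_injOn (s := (Finset.univ : Finset (Fin (s+1))))
        (t := Finset.univ.filter (fun w => par3 s t h w = par3 s t h v)) g (fun j _ => by simpa using hg2 j) hg.injOn
      simp at this; omega
    by_cases h1 : (v:ℕ) < s + 1
    · refine hmap (fun j => ⟨j, by omega⟩) (fun i j hij => by simpa [Fin.ext_iff] using hij) fun j => ?_
      have := j.2
      simp only [par3, h1, this, if_true]
    · by_cases h2 : (v:ℕ) < 2 * (s+1)
      · refine hmap (fun j => ⟨s + 1 + j, by omega⟩) (fun i j hij => by simpa [Fin.ext_iff] using hij) fun j => ?_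
        have := j.2
        have a1 : ¬ (s + 1 + (j:ℕ) < s + 1) := by omega
        have a2 : (s + 1 + (j:ℕ) < 2 * (s + 1)) := by omega
        simp only [par3, h1, h2, a1, a2, if_true, if_false]
      · refine hmap (fun j => ⟨2 * (s + 1) + j, by omega⟩) (fun i j hij => by simpa [Fin.ext_iff] using hij) fun j => ?_
        have a1 : ¬ (2 * (s + 1) + (j:ℕ) < s + 1) := by omega
        have a2 : ¬ (2 * (s + 1) + (j:ℕ) < 2 * (s + 1)) := by omega
        simp only [par3, h1, h2, a1, a2, if_false]

theorem par3_roots (s t : ℕ) (h : 3 * (s + 1) ≤ t + 1) :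
    (Finset.univ.filter (fun v => par3 s t h v ≠ v)).card ≤ t - 2 := by
  let T : Finset (Fin (t+1)) := {⟨0, by omega⟩, ⟨s+1, by omega⟩, ⟨2*(s+1), by omega⟩}
  have hT : T.card = 3 := by
    rw [Finset.card_eq_three]
    exact ⟨_, _, _, by simp [Fin.ext_iff], by simp [Fin.ext_iff], by simp [Fin.ext_iff], rfl⟩
  have hsub : Finset.univ.filter (fun v => par3 s t h v ≠ v) ⊆ Finset.univ \ T := by
    intro v hv
    rw [Finset.mem_filter] at hv
    rw [Finset.mem_sdiff]
    refine ⟨Finset.mem_univ _, fun hvT => hv.2 ?_⟩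
    simp only [T, Finset.mem_insert, Finset.mem_singleton] at hvT
    rcases hvT with rfl | rfl | rfl
    · simp [par3]
    · simp [par3]
    · simp [par3] <;> omega
  have := Finset.card_le_card hsub
  rw [Finset.card_sdiff_of_subset (Finset.subset_univ _), hT] at this
  simp at this
  omega

end CT
open SimpleGraph

namespace CT

theorem c2_final (ρ d τ : ℝ) (hρ : 0 < ρ) (hd : 0 ≤ d) (hτ : 0 ≤ τ)
    (h : (τ + 4) * (ρ - d) ^ 2 ≤ τ * ρ ^ 2) (h9 : (d + 1) * (τ + 4) < ρ) : False := by
  have h1 : 0 ≤ (τ + 4) * d ^ 2 := by positivity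
  have h2 : d * (τ + 4) ≤ ρ := by nlinarith
  have h3 : d * (τ + 4) * ρ ≤ ρ * ρ := mul_le_mul_of_nonneg_right h2 hρ.le
  have h4 : 0 < ρ * ρ := mul_pos hρ hρ
  nlinarith

section
variable {V : Type} [Fintype V] [DecidableEq V] {s t : ℕ} {G : SimpleGraph V} {K R C : Finset V}

theorem touch_split (G : SimpleGraph V) (R : Finset V) (T' : Finset {v // v ∈ R}) :
    ∑ v ∈ T'.map (Function.Embedding.subtype _), ∑ w ∈ R, aw G v w +
    ∑ v ∈ R \ T'.map (Function.Embedding.subtype _), ∑ w ∈ T'.map (Function.Embedding.subtype _), aw G v w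
      = touch (lg G R) T' := by
  classical
  set T := T'.map (Function.Embedding.subtype (fun v => v ∈ R)) with hT
  have hTR : T ⊆ R := by
    intro v hv
    obtain ⟨w, -, rfl⟩ := Finset.mem_map.1 hv
    exact w.2
  have hmem : ∀ v : {v // v ∈ R}, v ∈ T' ↔ v.1 ∈ T := by
    intro v; simp [hT]
  have h1 : touch (lg G R) T' = ∑ v ∈ R, ∑ w ∈ R, if v ∈ T ∨ w ∈ T then aw G v w else 0 := by
    unfold touch
    rw [Finset.sum_subtype R (fun _ => Iff.rfl)]
    refine Finset.sum_congr rfl fun v _ => ?_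
    rw [Finset.sum_subtype R (fun _ => Iff.rfl)]
    refine Finset.sum_congr rfl fun w _ => ?_
    have : aw (lg G R) v w = aw G v w := aw_congr Iff.rfl
    simp only [hmem, this]
  rw [h1, ← Finset.sum_sdiff hTR, add_comm]
  congr 1
  · refine Finset.sum_congr rfl fun v hv => ?_
    rw [Finset.mem_sdiff] at hv
    rw [← Finset.sum_subset hTR]
    · exact Finset.sum_congr rfl fun w hw => by simp [hw]
    · intro w _ hw; simp [hw, hv.2]
  · refine Finset.sum_congr rfl fun v hv => Finset.sum_congr rfl fun w hw => ?_
    simp [hv]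

set_option maxHeartbeats 1000000 in
theorem c2_false (hC : Cmp G K C t) (E : Ext s t G K R) {x : V → ℝ} (hx : Wts G K R (specRad G) ((t:ℝ)-1) x)
    (hβ : 3 * (s + 1) ≤ t + 1) (hcard : N0 t + s ≤ Fintype.card V)
    (hρ : (t:ℝ) * ((k0 t + 1) * t * t + 8) < specRad G) : False := by
  classical
  set ρ := specRad G with hρd
  have hs := E.hs
  have ht : 8 ≤ t := by omega
  have htR : (8:ℝ) ≤ t := by exact_mod_cast ht
  have hk0 : (0:ℝ) ≤ k0 t := Nat.cast_nonneg _
  have hbig : (t:ℝ) ≤ t * ((k0 t + 1) * t * t + 8) := by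
    refine le_mul_of_one_le_right (by linarith) ?_
    have : (0:ℝ) ≤ (k0 t + 1) * t * t := by positivity
    linarith
  have hρt : (t:ℝ) - 1 < ρ := by linarith
  have hsum := (shapes hC E hx hρt).2
  -- the local graph on R
  have hLfree : Free (lg G R) s t := E.free_sub _ fun v h => (E.hR v).1 h
  let C' : Finset {v // v ∈ R} := Finset.univ.filter (fun v => v.1 ∈ C)
  have hC'map : C'.map (Function.Embedding.subtype _) = C := by
    ext v
    simp only [C', Finset.mem_map, Finset.mem_filter, Finset.mem_univ, true_and, Function.Embedding.subtype_apply]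
    constructor
    · rintro ⟨w, hw, rfl⟩; exact hw
    · exact fun hv => ⟨⟨v, hC.subR E hv⟩, hv, rfl⟩
  have hC'card : C'.card = t + 2 := by
    rw [← hC.card, ← hC'map, Finset.card_map]
  have hC'closed : ∀ v ∈ C', ∀ w, (lg G R).Adj v w → w ∈ C' := by
    intro v hv w hvw
    simp only [C', Finset.mem_filter, Finset.mem_univ, true_and] at hv ⊢
    exact hC.closed v hv w ((E.hR w).1 w.2) hvw
  have hRcard : N0 t ≤ Fintype.card {v // v ∈ R} := by
    have h1 : R = Finset.univ \ K := by ext v; simp [E.hR]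
    rw [Fintype.card_coe, h1, Finset.card_sdiff_of_subset (Finset.subset_univ _), E.card, Finset.card_univ]
    omega
  obtain ⟨S, k, hCS, hk1, hkk, hSc, hSt⟩ := big_set (lg G R) (by omega) ht hLfree C' hC'closed hC'card hRcard
  have htC : touch (lg G R) C' = t * ((t:ℝ) - 1) + 4 := by
    rw [touch_closed _ _ hC'closed]
    have h1 : ∑ v ∈ C', ∑ w, aw (lg G R) v w = ∑ v ∈ C, ∑ w ∈ R, aw G v w := by
      conv_rhs => rw [← hC'map]
      rw [Finset.sum_map]
      refine Finset.sum_congr rfl fun v _ => ?_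
      rw [Finset.sum_subtype R (fun _ => Iff.rfl)]
      exact Finset.sum_congr rfl fun w _ => aw_congr Iff.rfl
    have h2 : ∑ v ∈ C, ∑ w ∈ R, aw G v w = ∑ v : {v // v ∈ C}, ((lg G C).degree v : ℝ) := by
      rw [Finset.sum_subtype C (fun _ => Iff.rfl)]
      refine Finset.sum_congr rfl fun v _ => ?_
      rw [deg_aw]
      have := local_sum hC E v (fun _ => 1)
      simpa using this
    rw [h1, h2, ← Nat.cast_sum, hsum]
    push_cast [Nat.cast_sub (by omega : 1 ≤ t)]
    ring
  set T' := C' ∪ S with hT'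
  have hT'c : T'.card = t + 2 + k * t := by
    rw [hT', Finset.card_union_of_disjoint hCS, hC'card, hSc]
  have htT : touch (lg G R) T' ≤ (k + 1) * t * ((t:ℝ) - 1) + 4 := by
    have := touch_union (lg G R) C' S
    rw [htC] at this
    nlinarith
  set T := T'.map (Function.Embedding.subtype (fun v => v ∈ R)) with hT
  have hTR : T ⊆ R := by
    intro v hv
    obtain ⟨w, -, rfl⟩ := Finset.mem_map.1 hv
    exact w.2
  obtain ⟨k', rfl⟩ : ∃ k', k = k' + 1 := ⟨k - 1, by omega⟩
  let P := SC (par3 s t hβ)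
  have hUc : Fintype.card ((Fin k' × Fin t) ⊕ (Fin 2 × Fin (t+1))) = Fintype.card {v // v ∈ T} := by
    rw [Fintype.card_coe, hT, Finset.card_map, hT'c]
    simp; ring
  have e := Fintype.equivOfCardEq hUc
  have hab := abs_ineq E hx hTR e (JJ k' t P) (JJ_free k' P (par3_free s t hβ)) (fun u => x (e u))
  have hen := wts_energy hx hTR
  have hmove : ∑ u, (2 * x (e u) - ρ * x (e u) ^ 2) = ∑ v ∈ T, (2 * x v - ρ * x v ^ 2) := by
    rw [Finset.sum_subtype T (fun _ => Iff.rfl)]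
    exact e.sum_comp (fun v : {v // v ∈ T} => 2 * x v - ρ * x v ^ 2)
  rw [hmove] at hab
  have hρpos : 0 < ρ := by linarith
  have hq : 0 < ρ - (t - 1) := by linarith
  set q := 1 / (ρ - ((t:ℝ) - 1)) with hqd
  have hxpos : ∀ v ∈ R, 0 ≤ x v := fun v hv => le_trans (by positivity) (hx.low v hv)
  have hxx : ∀ v ∈ R, ∀ w ∈ R, aw G v w * (x v * x w) ≤ aw G v w * (q * q) := by
    intro v hv w hw
    exact mul_le_mul_of_nonneg_left (mul_le_mul (hx.upp v hv) (hx.upp w hw) (hxpos w hw) (by positivity)) (aw_nonneg _ _ _)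
  have hup : ∑ v ∈ T, ∑ w ∈ R, aw G v w * (x v * x w) + ∑ v ∈ R \ T, ∑ w ∈ T, aw G v w * (x v * x w)
      ≤ touch (lg G R) T' * (q * q) := by
    rw [← touch_split, add_mul, Finset.sum_mul, Finset.sum_mul]
    refine add_le_add (Finset.sum_le_sum fun v hv => ?_) (Finset.sum_le_sum fun v hv => ?_)
    · rw [Finset.sum_mul]
      exact Finset.sum_le_sum fun w hw => hxx v (hTR hv) w hw
    · rw [Finset.sum_mul]
      exact Finset.sum_le_sum fun w hw => hxx v (Finset.sdiff_subset hv) w (hTR hw)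
  have hlow : (∑ u, ∑ w, aw (JJ k' t P) u w) * (1 / ρ * (1 / ρ)) ≤
      ∑ u, ∑ w, aw (JJ k' t P) u w * (x (e u) * x (e w)) := by
    rw [Finset.sum_mul]
    refine Finset.sum_le_sum fun u _ => ?_
    rw [Finset.sum_mul]
    refine Finset.sum_le_sum fun w _ => mul_le_mul_of_nonneg_left ?_ (aw_nonneg _ _ _)
    have h1 := hx.low _ (hTR (e u).2)
    have h2 := hx.low _ (hTR (e w).2)
    have h3 : 0 ≤ 1 / ρ := by positivity
    exact mul_le_mul h1 h2 h3 (h3.trans h1)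
  rw [JJ_sum] at hlow
  have hsc := sc_sum (par3 s t hβ) (t := t) (m := t - 2) (by simp) (par3_roots s t hβ)
  rw [Nat.cast_sub (by omega : 2 ≤ t)] at hsc
  set τ : ℝ := ((k' + 1 : ℕ) + 1) * t * ((t:ℝ) - 1) + 4 with hτ
  have hJ : τ + 4 ≤ k' * t * ((t:ℝ) - 1) + 2 * ∑ i, ∑ j, aw P i j := by
    rw [hτ]; push_cast at hsc ⊢
    nlinarith
  have hτ0 : 0 ≤ τ := by
    have : (0:ℝ) ≤ t - 1 := by linarith
    positivity
  have hfin : (τ + 4) * (1 / ρ * (1 / ρ)) ≤ τ * (q * q) := by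
    calc _ ≤ _ := mul_le_mul_of_nonneg_right hJ (by positivity)
      _ ≤ _ := hlow
      _ ≤ ∑ v ∈ T, ∑ w ∈ R, aw G v w * (x v * x w) + ∑ v ∈ R \ T, ∑ w ∈ T, aw G v w * (x v * x w) := by linarith
      _ ≤ _ := hup
      _ ≤ _ := mul_le_mul_of_nonneg_right htT (by positivity)
  have hfin2 : (τ + 4) * (ρ - (t - 1)) ^ 2 ≤ τ * ρ ^ 2 := by
    have e1 : (τ + 4) * (1 / ρ * (1 / ρ)) = (τ + 4) / ρ ^ 2 := by field_simp
    have e2 : τ * (q * q) = τ / (ρ - (t - 1)) ^ 2 := by rw [hqd]; field_simp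
    rw [e1, e2, div_le_div_iff₀ (by positivity) (by positivity)] at hfin
    exact hfin
  have hτb : τ + 4 ≤ (k0 t + 1) * t * t + 8 := by
    have hkR : ((k' + 1 : ℕ) : ℝ) ≤ k0 t := by exact_mod_cast hkk
    have : ((k' + 1 : ℕ) + 1 : ℝ) * t * ((t:ℝ) - 1) ≤ (k0 t + 1) * t * t := by
      have : (0:ℝ) ≤ t - 1 := by linarith
      gcongr
      linarith
    rw [hτ]; linarith
  have h9 : (t:ℝ) * (τ + 4) < ρ := lt_of_le_of_lt (mul_le_mul_of_nonneg_left hτb (by linarith)) hρ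
  exact c2_final ρ (t - 1) τ hρpos (by linarith) hτ0 hfin2 (by rw [sub_add_cancel]; exact h9)

end
end CT
open SimpleGraph

namespace CT

def c5b (i j : Fin 5) : Bool := (i, j) ∈ [((0:Fin 5),(3:Fin 5)),(3,0),(1,4),(4,1)]

def sw5 : Fin 5 → Fin 5 := ![1, 0, 2, 4, 3]

theorem F1.swap {V : Type} {F : SimpleGraph V} {f : V → Fin 5} (h : F1 F f) : F1 F (fun v => sw5 (f v)) := by
  have k0 : ∀ i, sw5 i = 0 ↔ i = 1 := by decide
  have k1 : ∀ i, sw5 i = 1 ↔ i = 0 := by decide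
  have k2 : ∀ i, sw5 i = 2 ↔ i = 2 := by decide
  have k3 : ∀ i j, c5 (sw5 i) (sw5 j) = c5 i j := by decide
  refine ⟨?_, ?_, ?_, ?_⟩
  · intro u v; rw [k3]; exact h.adj u v
  · simp only [k0]; exact h.h1
  · simp only [k1]; exact h.h0
  · simp only [k2]; exact h.h2

theorem fib_swap {V : Type} [Fintype V] (f : V → Fin 5) (i : Fin 5) :
    fib (fun v => sw5 (f v)) i = fib f (sw5 i) := by
  have k : ∀ a b, sw5 a = b ↔ a = sw5 b := by decide
  ext v; simp only [mem_fib, k]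

theorem F1.hadj {V : Type} [DecidableEq V] {J : SimpleGraph V} {f : V → Fin 5} (h : F1 Jᶜ f) (u v : V) :
    J.Adj u v ↔ u ≠ v ∧ c5 (f u) (f v) = false := by
  have := h.adj u v
  rw [compl_adj] at this
  constructor
  · intro h1
    refine ⟨h1.ne, ?_⟩
    by_contra h2
    have h3 := this.2 (by simpa using h2)
    exact h3.2 h1
  · rintro ⟨h1, h2⟩
    by_contra h3
    rw [this.1 ⟨h1, h3⟩] at h2
    exact absurd h2 (by decide)

def J5 {V : Type} (f : V → Fin 5) : SimpleGraph V where
  Adj u v := u ≠ v ∧ c5b (f u) (f v) = false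
  symm := ⟨fun u v h => ⟨h.1.symm, by
    have k : ∀ i j, c5b i j = c5b j i := by decide
    rw [k]; exact h.2⟩⟩
  loopless := ⟨fun u h => h.1 rfl⟩

theorem conn_nbr {V : Type} {G : SimpleGraph V} {S : Set V} (hc : (G.induce S).Connected) {y : V}
    (hy : y ∈ S) (hS : S ≠ {y}) : ∃ z ∈ S, G.Adj y z := by
  by_contra hno
  push Not at hno
  apply hS
  ext w
  rw [Set.mem_singleton_iff]
  constructor
  · intro hw
    by_contra hwy
    have hno' : ∀ u ∈ S, ∀ v ∈ S, G.Adj u v → (u = y) = (v = y) := by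
      intro u hu v hv huv
      apply propext
      constructor
      · rintro rfl; exact absurd huv (hno v hv)
      · rintro rfl; exact absurd huv.symm (hno u hu)
    have := const_of_connected (fun u => u = y) hno' le_rfl hc y hy w hw
    simp [hwy] at this
  · rintro rfl; exact hy

section
variable {U : Type} [Fintype U] [DecidableEq U] {J : SimpleGraph U} {s t a b : ℕ} {f : U → Fin 5}

theorem f1_case1 (h : F1 Jᶜ f) (hcard : Fintype.card U = t + 2) (hab : a + b = t + 1) (ha : 1 ≤ a) (hb : 1 ≤ b)
    (has : a ≤ s) (h3 : s ≤ (fib f 3).card) (h4 : s ≤ (fib f 4).card)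
    (φ : Fin a ⊕ Fin b → Set U) (c1 : ∀ i, (J.induce (φ i)).Connected)
    (c2 : Pairwise fun i j => Disjoint (φ i) (φ j))
    (c3 : ∀ i j, ∃ x ∈ φ (Sum.inl i), ∃ y ∈ φ (Sum.inr j), J.Adj x y)
    (y : U) (hy : f y = 2) (hne : ∀ i, φ i ≠ {y}) : False := by
  obtain ⟨h0, hh0, hh0u⟩ := h.h0
  obtain ⟨h1, hh1, hh1u⟩ := h.h1
  obtain ⟨_, _, hyu⟩ := h.h2
  have hyu' : ∀ w, f w = 2 → w = y := fun w hw => (hyu w hw).trans (hyu y hy).symm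
  have key : ∃ hb, (f hb = 0 ∨ f hb = 1) ∧ ∀ i, y ∈ φ i → hb ∈ φ i := by
    by_cases hex : ∃ i, y ∈ φ i
    · obtain ⟨i, hi⟩ := hex
      obtain ⟨z, hz, hyz⟩ := conn_nbr (c1 i) hi (hne i)
      have hz' := (h.hadj y z).1 hyz
      rw [hy] at hz'
      refine ⟨z, ?_, ?_⟩
      · have k : ∀ j, c5 2 j = false → j = 0 ∨ j = 1 ∨ j = 2 := by decide
        rcases k _ hz'.2 with k | k | k
        · exact Or.inl k
        · exact Or.inr k
        · exact absurd (hyu' z k).symm hz'.1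
      · intro j hj
        by_cases hij : i = j
        · exact hij ▸ hz
        · exact absurd hj (Set.disjoint_left.1 (c2 hij) hi)
    · push Not at hex
      exact ⟨h0, Or.inl hh0, fun i hi => absurd hi (hex i)⟩
  obtain ⟨hb', hhb, hhb2⟩ := key
  have hby : hb' ≠ y := by rintro rfl; rw [hy] at hhb; revert hhb; decide
  let g : U → U := fun v => if v = y then hb' else v
  have hgφ : ∀ i, ∀ v ∈ φ i, g v ∈ φ i := by
    intro i v hv
    by_cases hvy : v = y
    · simp only [g, hvy, if_true]; exact hhb2 i (hvy ▸ hv)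
    · simp only [g, hvy, if_false]; exact hv
  have hgadj : ∀ u v, J.Adj u v → g u = g v ∨ (J5 f).Adj (g u) (g v) := by
    intro u v huv
    by_cases hg : g u = g v
    · exact Or.inl hg
    right
    refine ⟨hg, ?_⟩
    have k1 := (h.hadj u v).1 huv
    by_cases hu : u = y
    · have hv : v ≠ y := fun hv => k1.1 (hu.trans hv.symm)
      simp only [g, hu, hv, if_true, if_false]
      have k := k1.2
      rw [hu, hy] at k
      have kk : ∀ j, c5 2 j = false → j = 0 ∨ j = 1 ∨ j = 2 := by decide
      rcases kk _ k with k | k | k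
      · rcases hhb with e | e <;> rw [e, k] <;> decide
      · rcases hhb with e | e <;> rw [e, k] <;> decide
      · exact absurd (hyu' v k) hv
    · by_cases hv : v = y
      · simp only [g, hu, hv, if_true, if_false]
        have k := k1.2
        rw [hv, hy] at k
        have kk : ∀ j, c5 j 2 = false → j = 0 ∨ j = 1 ∨ j = 2 := by decide
        rcases kk _ k with k | k | k
        · rcases hhb with e | e <;> rw [e, k] <;> decide
        · rcases hhb with e | e <;> rw [e, k] <;> decide
        · exact absurd (hyu' u k) hu
      · simp only [g, hu, hv, if_false]
        have kk : ∀ i j, c5 i j = false → c5b i j = false := by decide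
        exact kk _ _ k1.2
  have hB : Bip (J5 f) ↑(Finset.univ.erase y) a b := by
    refine ⟨fun i => g '' φ i, ?_, ?_, ?_, ?_⟩
    · rintro i _ ⟨v, hv, rfl⟩
      rw [Finset.mem_coe, Finset.mem_erase]
      refine ⟨?_, Finset.mem_univ _⟩
      by_cases hvy : v = y
      · simp only [g, hvy, if_true]; exact hby
      · simp only [g, hvy, if_false]; exact hvy
    · intro i
      have hcn := c1 i
      obtain ⟨v0⟩ := hcn.nonempty
      have hwalk : ∀ (u v : φ i), (J.induce (φ i)).Walk u v →
          ((J5 f).induce (g '' φ i)).Reachable ⟨g u, u, u.2, rfl⟩ ⟨g v, v, v.2, rfl⟩ := by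
        intro u v p
        induction p with
        | nil => exact Reachable.refl _
        | @cons u v w huv p ih =>
          refine Reachable.trans ?_ ih
          rcases hgadj u v huv with e | e
          · have : (⟨g u, u, u.2, rfl⟩ : g '' φ i) = ⟨g v, v, v.2, rfl⟩ := Subtype.ext e
            rw [this]
          · exact Adj.reachable (G := (J5 f).induce (g '' φ i)) (u := ⟨g u, u, u.2, rfl⟩) (v := ⟨g v, v, v.2, rfl⟩) e
      haveI : Nonempty (g '' φ i) := ⟨⟨g v0, v0, v0.2, rfl⟩⟩
      refine Connected.mk ?_
      rintro ⟨_, u, hu, rfl⟩ ⟨_, v, hv, rfl⟩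
      obtain ⟨p⟩ := hcn.preconnected ⟨u, hu⟩ ⟨v, hv⟩
      exact hwalk _ _ p
    · intro i j hij
      rw [Set.disjoint_left]
      rintro _ ⟨u, hu, rfl⟩ ⟨v, hv, huv⟩
      have e1 := hgφ i u hu
      have e2 := hgφ j v hv
      rw [huv] at e2
      exact Set.disjoint_left.1 (c2 hij) e1 e2
    · intro i j
      obtain ⟨x, hx, w, hw, hxw⟩ := c3 i j
      refine ⟨g x, ⟨x, hx, rfl⟩, g w, ⟨w, hw, rfl⟩, ?_⟩
      rcases hgadj x w hxw with e | e
      · have e1 := hgφ _ x hx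
        have e2 := hgφ _ w hw
        rw [← e] at e2
        exact absurd e2 (Set.disjoint_left.1 (c2 (by simp : (Sum.inl i : Fin a ⊕ Fin b) ≠ Sum.inr j)) e1)
      · exact e
  have hWc : (Finset.univ.erase y).card = t + 1 := by
    rw [Finset.card_erase_of_mem (Finset.mem_univ _), Finset.card_univ, hcard]; omega
  obtain ⟨A, hAW, hAc, hA⟩ := bip_tight hB (by omega)
  have hno : ∀ u ∈ A, ∀ v, v ≠ y → c5b (f u) (f v) = true → v ∈ A := by
    intro u hu v hv huv
    by_contra hvA
    have := (hA u hu v (by simp [hv]) hvA).2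
    rw [huv] at this; exact absurd this (by decide)
  have hny : ∀ v, f v ≠ 2 → v ≠ y := by rintro v hv rfl; exact hv hy
  have fin : ∀ (q : U) (S : Finset U), q ∈ A → q ∉ S → (∀ v ∈ S, v ∈ A) → s ≤ S.card → False := by
    intro q S hq hqS hSA hsS
    have : insert q S ⊆ A := by
      intro v hv
      rcases Finset.mem_insert.1 hv with rfl | hv
      · exact hq
      · exact hSA v hv
    have := Finset.card_le_card this
    rw [Finset.card_insert_of_notMem hqS] at this
    omega
  have f0 : h0 ∈ A → False := fun hm => fin h0 (fib f 3) hm (by rw [mem_fib, hh0]; decide)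
    (fun v hv => by
      rw [mem_fib] at hv
      exact hno h0 hm v (hny v (by rw [hv]; decide)) (by rw [hh0, hv]; decide)) h3
  have f1 : h1 ∈ A → False := fun hm => fin h1 (fib f 4) hm (by rw [mem_fib, hh1]; decide)
    (fun v hv => by
      rw [mem_fib] at hv
      exact hno h1 hm v (hny v (by rw [hv]; decide)) (by rw [hh1, hv]; decide)) h4
  have hAne : A.Nonempty := Finset.card_pos.1 (by omega)
  obtain ⟨w, hw⟩ := hAne
  have hwy : w ≠ y := (Finset.mem_erase.1 (hAW hw)).1
  have k5 : ∀ i : Fin 5, i = 0 ∨ i = 1 ∨ i = 2 ∨ i = 3 ∨ i = 4 := by decide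
  rcases k5 (f w) with k | k | k | k | k
  · exact f0 (hh0u w k ▸ hw)
  · exact f1 (hh1u w k ▸ hw)
  · exact hwy (hyu' w k)
  · exact f0 (hno w hw h0 (hny _ (by rw [hh0]; decide)) (by rw [k, hh0]; decide))
  · exact f1 (hno w hw h1 (hny _ (by rw [hh1]; decide)) (by rw [k, hh1]; decide))

theorem slack (hcard : Fintype.card U = t + 2) (hab : a + b = t + 1)
    (φ : Fin a ⊕ Fin b → Set U) (c2 : Pairwise fun i j => Disjoint (φ i) (φ j))
    (r : Fin a ⊕ Fin b → U) (hr : ∀ i, r i ∈ φ i) (S : Finset U) (hS : ∀ i, r i ∉ S) : S.card ≤ 1 := by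
  have hinj : Function.Injective r := by
    intro i j hij
    by_contra hne
    exact Set.disjoint_left.1 (c2 hne) (hr i) (hij ▸ hr j)
  have h1 : (Finset.univ.image r).card = t + 1 := by
    rw [Finset.card_image_of_injective _ hinj, Finset.card_univ]; simp [hab]
  have h2 : Disjoint (Finset.univ.image r) S := by
    rw [Finset.disjoint_left]
    intro v hv
    obtain ⟨i, -, rfl⟩ := Finset.mem_image.1 hv
    exact hS i
  have h3 := Finset.card_le_univ (Finset.univ.image r ∪ S)
  rw [Finset.card_union_of_disjoint h2, h1, hcard] at h3
  omega

/-- a left branch set which is the single hub of label 0 -/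
theorem f1_hub (h : F1 Jᶜ f) (hcard : Fintype.card U = t + 2) (hab : a + b = t + 1)
    (h3 : 2 ≤ (fib f 3).card)
    (φ : Fin a ⊕ Fin b → Set U) (c2 : Pairwise fun i j => Disjoint (φ i) (φ j))
    (c3 : ∀ i j, ∃ x ∈ φ (Sum.inl i), ∃ y ∈ φ (Sum.inr j), J.Adj x y)
    (hub : ∀ i, ∃ v ∈ φ (Sum.inl i), f v = 0 ∨ f v = 1)
    (h0 : U) (hh0 : f h0 = 0) (i : Fin a) (hi : φ (Sum.inl i) = {h0}) : False := by
  have hR : ∀ j, ∃ w ∈ φ (Sum.inr j), f w ≠ 3 := by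
    intro j
    obtain ⟨x, hx, w, hw, hxw⟩ := c3 i j
    rw [hi, Set.mem_singleton_iff] at hx
    subst hx
    refine ⟨w, hw, fun e => ?_⟩
    have := ((h.hadj x w).1 hxw).2
    rw [hh0, e] at this
    exact absurd this (by decide)
  choose rl hrl hrl2 using hub
  choose rr hrr hrr2 using hR
  have := slack hcard hab φ c2 (Sum.elim rl rr) (by rintro (i | j); exacts [hrl i, hrr j]) (fib f 3) (by
    rintro (i | j) hm <;> rw [mem_fib] at hm
    · simp only [Sum.elim_inl] at hm
      rcases hrl2 i with e | e <;> rw [e] at hm <;> exact absurd hm (by decide)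
    · exact hrr2 j hm)
  omega

end

end CT
open SimpleGraph

namespace CT

section
variable {U : Type} [Fintype U] [DecidableEq U] {J : SimpleGraph U} {s t a b : ℕ} {f : U → Fin 5}

/-- one left branch set, containing the hub of label 0 -/
theorem f1_one (h : F1 Jᶜ f) (hcard : Fintype.card U = t + 2) (hab : 1 + b = t + 1)
    (h3 : 2 ≤ (fib f 3).card)
    (φ : Fin 1 ⊕ Fin b → Set U) (c1 : ∀ i, (J.induce (φ i)).Connected)
    (c2 : Pairwise fun i j => Disjoint (φ i) (φ j))
    (c3 : ∀ i j, ∃ x ∈ φ (Sum.inl i), ∃ y ∈ φ (Sum.inr j), J.Adj x y)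
    (y : U) (hy : f y = 2) (hyX : y ∉ φ (Sum.inl 0))
    (h0 : U) (hh0 : f h0 = 0) (hm : h0 ∈ φ (Sum.inl 0)) : False := by
  obtain ⟨h1, hh1, hh1u⟩ := h.h1
  obtain ⟨h0', hh0', hh0u⟩ := h.h0
  obtain ⟨_, _, hyu⟩ := h.h2
  have hyu' : ∀ w, f w = 2 → w = y := fun w hw => (hyu w hw).trans (hyu y hy).symm
  have h0u : ∀ w, f w = 0 → w = h0 := fun w hw => (hh0u w hw).trans (hh0u h0 hh0).symm
  by_cases hX : φ (Sum.inl 0) = {h0}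
  · exact f1_hub h hcard hab h3 φ c2 c3 (fun i => ⟨h0, by rw [Subsingleton.elim i 0]; exact hm, Or.inl hh0⟩) h0 hh0 0 hX
  obtain ⟨z, hz, h0z⟩ := conn_nbr (c1 _) hm hX
  have hz' := (h.hadj h0 z).1 h0z
  rw [hh0] at hz'
  have hz4 : f z = 4 := by
    have k : ∀ j, c5 0 j = false → j = 0 ∨ j = 2 ∨ j = 4 := by decide
    rcases k _ hz'.2 with k | k | k
    · exact absurd (h0u z k).symm hz'.1
    · exact absurd (hyu' z k ▸ hz) hyX
    · exact k
  have hne : ∀ j, ∃ w, w ∈ φ (Sum.inr j) := fun j => by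
    obtain ⟨_, _, w, hw, _⟩ := c3 0 j; exact ⟨w, hw⟩
  have dj : ∀ j, ∀ w ∈ φ (Sum.inr j), w ∉ φ (Sum.inl 0) := fun j w hw hw' =>
    Set.disjoint_left.1 (c2 (by simp : (Sum.inl 0 : Fin 1 ⊕ Fin b) ≠ Sum.inr j)) hw' hw
  -- an extra vertex of X different from h0 and z
  have extra : ∀ w ∈ φ (Sum.inl 0), w ≠ h0 → w ≠ z → False := by
    intro w hw hw0 hwz
    choose rr hrr using hne
    have := slack hcard hab φ c2 (Sum.elim (fun _ => h0) rr) (by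
      rintro (i | j)
      · rw [Subsingleton.elim i 0]; exact hm
      · exact hrr j) {w, z} (by
      rintro (i | j) hm'
      · simp only [Sum.elim_inl, Finset.mem_insert, Finset.mem_singleton] at hm'
        rcases hm' with e | e
        · exact hw0 e.symm
        · exact hz'.1 e
      · simp only [Sum.elim_inr, Finset.mem_insert, Finset.mem_singleton] at hm'
        rcases hm' with e | e
        · exact dj j _ (hrr j) (e ▸ hw)
        · exact dj j _ (hrr j) (e ▸ hz))
    rw [Finset.card_pair hwz] at this
    omega
  have hXe : ∀ w ∈ φ (Sum.inl 0), f w = 0 ∨ f w = 4 := by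
    intro w hw
    by_cases e1 : w = h0
    · exact Or.inl (e1 ▸ hh0)
    by_cases e2 : w = z
    · exact Or.inr (e2 ▸ hz4)
    exact absurd (extra w hw e1 e2) id
  have hR : ∀ j, ∃ w ∈ φ (Sum.inr j), w ≠ h1 := by
    intro j
    obtain ⟨x, hx, w, hw, hxw⟩ := c3 0 j
    refine ⟨w, hw, ?_⟩
    rintro rfl
    have := ((h.hadj x w).1 hxw).2
    rw [hh1] at this
    rcases hXe x hx with e | e <;> rw [e] at this <;> exact absurd this (by decide)
  choose rr hrr hrr2 using hR
  have h1z : h1 ≠ z := by rintro rfl; rw [hh1] at hz4; exact absurd hz4 (by decide)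
  have h10 : h0 ≠ h1 := by rintro rfl; rw [hh1] at hh0; exact absurd hh0 (by decide)
  have := slack hcard hab φ c2 (Sum.elim (fun _ => h0) rr) (by
      rintro (i | j)
      · rw [Subsingleton.elim i 0]; exact hm
      · exact hrr j) {h1, z} (by
      rintro (i | j) hm'
      · simp only [Sum.elim_inl, Finset.mem_insert, Finset.mem_singleton] at hm'
        rcases hm' with e | e
        · exact h10 e
        · exact hz'.1 e
      · simp only [Sum.elim_inr, Finset.mem_insert, Finset.mem_singleton] at hm'
        rcases hm' with e | e
        · exact hrr2 j e
        · exact dj j _ (hrr j) (e ▸ hz))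
  rw [Finset.card_pair h1z] at this
  omega

/-- the complement of a blow-up F1 has no forbidden minors -/
theorem f1_free (h : F1 Jᶜ f) (hcard : Fintype.card U = t + 2) (hs : 2 ≤ s)
    (h3 : s ≤ (fib f 3).card) (h4 : s ≤ (fib f 4).card) (h34 : (fib f 3).card + (fib f 4).card + 1 = t) :
    Free J s t := by
  rintro a b ha has hb hab ⟨φ, -, c1, c2, c3⟩
  obtain ⟨y, hy, hyu⟩ := h.h2
  obtain ⟨h0, hh0, hh0u⟩ := h.h0
  obtain ⟨h1, hh1, hh1u⟩ := h.h1
  by_cases hne : ∀ i, φ i ≠ {y}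
  · exact f1_case1 h hcard hab ha hb has h3 h4 φ c1 c2 c3 y hy hne
  push Not at hne
  obtain ⟨i, hi⟩ := hne
  have nby : ∀ w, J.Adj y w → f w = 0 ∨ f w = 1 := by
    intro w hw
    have := (h.hadj y w).1 hw
    rw [hy] at this
    have k : ∀ j, c5 2 j = false → j = 0 ∨ j = 1 ∨ j = 2 := by decide
    rcases k _ this.2 with k | k | k
    · exact Or.inl k
    · exact Or.inr k
    · exact absurd (hyu w k).symm this.1
  have two : ∀ {m : ℕ} (ψ : Fin m → Set U), (Pairwise fun i j => Disjoint (ψ i) (ψ j)) →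
      (∀ i, ∃ v ∈ ψ i, f v = 0 ∨ f v = 1) → m ≤ 2 := by
    intro m ψ hψ hψ2
    choose r hr hr2 using hψ2
    have hinj : Function.Injective r := by
      intro i j hij
      by_contra hne
      exact Set.disjoint_left.1 (hψ hne) (hr i) (hij ▸ hr j)
    have : Finset.univ.image r ⊆ {h0, h1} := by
      intro v hv
      obtain ⟨i, -, rfl⟩ := Finset.mem_image.1 hv
      rw [Finset.mem_insert, Finset.mem_singleton]
      rcases hr2 i with e | e
      · exact Or.inl (hh0u _ e)
      · exact Or.inr (hh1u _ e)
    have := (Finset.card_le_card this).trans Finset.card_le_two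
    rwa [Finset.card_image_of_injective _ hinj, Finset.card_univ, Fintype.card_fin] at this
  rcases i with i | j
  · have := two (fun j => φ (Sum.inr j)) (fun i j hij => c2 (by simpa using hij)) (fun j => by
      obtain ⟨x, hx, w, hw, hxw⟩ := c3 i j
      rw [hi, Set.mem_singleton_iff] at hx
      subst hx
      exact ⟨w, hw, nby w hxw⟩)
    omega
  have hub : ∀ i, ∃ v ∈ φ (Sum.inl i), f v = 0 ∨ f v = 1 := by
    intro i
    obtain ⟨x, hx, w, hw, hxw⟩ := c3 i j
    rw [hi, Set.mem_singleton_iff] at hw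
    subst hw
    exact ⟨x, hx, nby x hxw.symm⟩
  have ha2 := two (fun i => φ (Sum.inl i)) (fun i j hij => c2 (by simpa using hij)) hub
  have hyX : ∀ i, y ∉ φ (Sum.inl i) := fun i hm =>
    Set.disjoint_left.1 (c2 (by simp : (Sum.inl i : Fin a ⊕ Fin b) ≠ Sum.inr j)) hm (by rw [hi]; rfl)
  have sfib3 : (fib (fun v => sw5 (f v)) 3).card = (fib f 4).card := by rw [fib_swap]; rfl
  have ksw : ∀ i, sw5 i = 0 ↔ i = 1 := by decide
  have ksw1 : ∀ i, sw5 i = 1 ↔ i = 0 := by decide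
  have hub' : ∀ i, ∃ v ∈ φ (Sum.inl i), sw5 (f v) = 0 ∨ sw5 (f v) = 1 := by
    intro i
    obtain ⟨v, hv, hv2⟩ := hub i
    rw [← ksw, ← ksw1] at hv2
    exact ⟨v, hv, hv2.symm⟩
  obtain rfl | rfl : a = 1 ∨ a = 2 := by omega
  · obtain ⟨v, hv, hv0 | hv1⟩ := hub 0
    · exact f1_one h hcard hab (by omega) φ c1 c2 c3 y hy (hyX 0) v hv0 hv
    · exact f1_one h.swap hcard hab (by rw [sfib3]; omega) φ c1 c2 c3 y (by rw [hy]; rfl) (hyX 0) v (by rw [hv1]; rfl) hv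
  · have single : ∀ i, ∀ v ∈ φ (Sum.inl i), f v = 0 ∨ f v = 1 → φ (Sum.inl i) ≠ {v} := by
      intro i v hv hv2 he
      rcases hv2 with e | e
      · exact f1_hub h hcard hab (by omega) φ c2 c3 hub v e i he
      · exact f1_hub h.swap hcard hab (by rw [sfib3]; omega) φ c2 c3 hub' v (by rw [e]; rfl) i he
    choose r hr hr2 using hub
    have hz : ∀ i, ∃ z ∈ φ (Sum.inl i), z ≠ r i := by
      intro i
      obtain ⟨z, hz, hz2⟩ := conn_nbr (c1 _) (hr i) (single i _ (hr i) (hr2 i))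
      exact ⟨z, hz, hz2.ne'⟩
    choose z hz hzr using hz
    have hne : ∀ j, ∃ w, w ∈ φ (Sum.inr j) := fun j => by
      obtain ⟨_, _, w, hw, _⟩ := c3 0 j; exact ⟨w, hw⟩
    choose rr hrr using hne
    have d : ∀ i j, i ≠ j → ∀ w ∈ φ i, w ∉ φ j := fun i j hij w hw hw' => Set.disjoint_left.1 (c2 hij) hw hw'
    have hzz : z 0 ≠ z 1 := fun e => d (Sum.inl 0) (Sum.inl 1) (by simp) _ (hz 0) (e ▸ hz 1)
    have := slack hcard hab φ c2 (Sum.elim r rr) (by rintro (i | j); exacts [hr i, hrr j]) {z 0, z 1} (by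
      have key : ∀ k : Fin 2, ∀ i, Sum.elim r rr i ≠ z k := by
        rintro k (i | j) e
        · simp only [Sum.elim_inl] at e
          by_cases hik : i = k
          · exact hzr k (hik ▸ e.symm)
          · exact d (Sum.inl i) (Sum.inl k) (by simpa using hik) _ (hr i) (e ▸ hz k)
        · simp only [Sum.elim_inr] at e
          exact d (Sum.inr j) (Sum.inl k) (by simp) _ (hrr j) (e ▸ hz k)
      intro i hm
      rw [Finset.mem_insert, Finset.mem_singleton] at hm
      rcases hm with e | e
      · exact key 0 i e
      · exact key 1 i e)
    rw [Finset.card_pair hzz] at this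
    omega

end

end CT
open SimpleGraph

namespace CT

section
variable {V : Type} [Fintype V] [DecidableEq V] {s t : ℕ} {G : SimpleGraph V} {K R C : Finset V}

theorem sq_bound (hC : Cmp G K C t) (E : Ext s t G K R) {D : ℝ} {x : V → ℝ} (hx : Wts G K R (specRad G) D x)
    [DecidableRel (lg G C).Adj] {U : Type} [Fintype U] (hU : Fintype.card U = t + 2) (J : SimpleGraph U)
    [DecidableRel J.Adj] (hJ : Free J s t)
    (hsum : ∑ u, J.degree u = ∑ v, (lg G C).degree v)
    (hρ : (t:ℝ) + (t + 2) * t ^ 3 < specRad G) :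
    ∑ u, J.degree u ^ 2 ≤ ∑ v, (lg G C).degree v ^ 2 := by
  have h1t := E.ht
  have hs := E.hs
  have htR : (4:ℝ) ≤ t := by exact_mod_cast h1t
  set ρ := specRad G with hρd
  have hρt : (t:ℝ) < ρ := by have : (0:ℝ) ≤ (t + 2) * t ^ 3 := by positivity
                             linarith
  have hρ0 : 0 < ρ := by linarith
  have hdeg : ∀ v, ((lg G C).degree v : ℝ) ≤ t := fun v => by
    have := h_degree (lg G C) (by omega) (by omega) (hC.free E) v
    exact_mod_cast (by omega : (lg G C).degree v ≤ t)
  have up := local_upper (lg G C) ρ (fun v => x v) (local_eig hC E hx) (fun v => (hdeg v).trans_lt hρt)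
  have lo := comp_ineq hC E hx hU J hJ (fun u => 1 / ρ + J.degree u / ρ ^ 2)
  have lo2 : (t + 2 : ℝ) / ρ + (∑ u, (J.degree u : ℝ)) / ρ ^ 2 + (∑ u, (J.degree u : ℝ) ^ 2) / ρ ^ 3 ≤
      ∑ u, (2 * (1 / ρ + J.degree u / ρ ^ 2) - ρ * (1 / ρ + J.degree u / ρ ^ 2) ^ 2) +
      ∑ u, ∑ w, aw J u w * ((1 / ρ + J.degree u / ρ ^ 2) * (1 / ρ + J.degree w / ρ ^ 2)) := by
    have a1 : ∑ u, (2 * (1 / ρ + J.degree u / ρ ^ 2) - ρ * (1 / ρ + J.degree u / ρ ^ 2) ^ 2) =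
        (t + 2 : ℝ) / ρ - (∑ u, (J.degree u : ℝ) ^ 2) / ρ ^ 3 := by
      have : ∀ u, (2 * (1 / ρ + J.degree u / ρ ^ 2) - ρ * (1 / ρ + J.degree u / ρ ^ 2) ^ 2) =
          1 / ρ - (J.degree u : ℝ) ^ 2 / ρ ^ 3 := by
        intro u; field_simp; ring
      rw [Finset.sum_congr rfl fun u _ => this u, Finset.sum_sub_distrib, Finset.sum_div, Finset.sum_const,
        Finset.card_univ, hU, nsmul_eq_mul]
      push_cast; ring
    have a2 : ∑ u, ∑ w, aw J u w * (1 / ρ ^ 2 + (J.degree u + J.degree w) / ρ ^ 3) ≤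
        ∑ u, ∑ w, aw J u w * ((1 / ρ + J.degree u / ρ ^ 2) * (1 / ρ + J.degree w / ρ ^ 2)) := by
      refine Finset.sum_le_sum fun u _ => Finset.sum_le_sum fun w _ => mul_le_mul_of_nonneg_left ?_ (aw_nonneg _ _ _)
      have : (1 / ρ + J.degree u / ρ ^ 2) * (1 / ρ + J.degree w / ρ ^ 2) =
        1 / ρ ^ 2 + (J.degree u + J.degree w) / ρ ^ 3 + J.degree u * J.degree w / ρ ^ 4 := by
        field_simp; ring
      rw [this]
      have : (0:ℝ) ≤ J.degree u * J.degree w / ρ ^ 4 := by positivity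
      linarith
    have a3 : ∑ u, ∑ w, aw J u w * (1 / ρ ^ 2 + ((J.degree u : ℝ) + J.degree w) / ρ ^ 3) =
        (∑ u, (J.degree u : ℝ)) / ρ ^ 2 + 2 * (∑ u, (J.degree u : ℝ) ^ 2) / ρ ^ 3 := by
      have e1 : ∑ u, ∑ w, aw J u w * (1 / ρ ^ 2 + ((J.degree u : ℝ) + J.degree w) / ρ ^ 3) =
        (∑ u, ∑ w, aw J u w) / ρ ^ 2 + (∑ u, ∑ w, aw J u w * J.degree u) / ρ ^ 3 +
          (∑ u, ∑ w, aw J u w * J.degree w) / ρ ^ 3 := by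
        simp only [Finset.sum_div, ← Finset.sum_add_distrib]
        refine Finset.sum_congr rfl fun u _ => Finset.sum_congr rfl fun w _ => ?_
        ring
      have e2 : ∑ u, ∑ w, aw J u w * (J.degree w : ℝ) = ∑ u, ∑ w, aw J u w * (J.degree u : ℝ) := by
        rw [Finset.sum_comm]
        refine Finset.sum_congr rfl fun u _ => Finset.sum_congr rfl fun w _ => ?_
        rw [aw_symm]
      have e3 : ∑ u, ∑ w, aw J u w * (J.degree u : ℝ) = ∑ u, (J.degree u : ℝ) ^ 2 := by
        refine Finset.sum_congr rfl fun u _ => ?_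
        rw [← Finset.sum_mul, ← deg_aw, sq]
      have e4 : ∑ u, ∑ w, aw J u w = ∑ u, (J.degree u : ℝ) :=
        Finset.sum_congr rfl fun u _ => (deg_aw J u).symm
      rw [e1, e2, e3, e4]; ring
    rw [a1]
    rw [a3] at a2
    have : 2 * (∑ u, (J.degree u : ℝ) ^ 2) / ρ ^ 3 = (∑ u, (J.degree u : ℝ) ^ 2) / ρ ^ 3 + (∑ u, (J.degree u : ℝ) ^ 2) / ρ ^ 3 := by ring
    linarith
  have up2 : ∑ v, 1 / (ρ - (lg G C).degree v) ≤
      (t + 2 : ℝ) / ρ + (∑ v, ((lg G C).degree v : ℝ)) / ρ ^ 2 + (∑ v, ((lg G C).degree v : ℝ) ^ 2) / ρ ^ 3 +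
        (t + 2) * t ^ 3 / (ρ ^ 3 * (ρ - t)) := by
    have b1 : ∀ v, 1 / (ρ - (lg G C).degree v) ≤ 1 / ρ + ((lg G C).degree v : ℝ) / ρ ^ 2 +
        ((lg G C).degree v : ℝ) ^ 2 / ρ ^ 3 + (t:ℝ) ^ 3 / (ρ ^ 3 * (ρ - t)) := by
      intro v
      have hd := hdeg v
      have hd0 : (0:ℝ) ≤ (lg G C).degree v := Nat.cast_nonneg _
      generalize ((lg G C).degree v : ℝ) = d at hd hd0
      have p1 : 0 < ρ - d := by linarith
      have p2 : 0 < ρ - t := by linarith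
      have : 1 / (ρ - d) = 1 / ρ + d / ρ ^ 2 + d ^ 2 / ρ ^ 3 + d ^ 3 / (ρ ^ 3 * (ρ - d)) := by
        field_simp; ring
      rw [this]
      gcongr
    refine (Finset.sum_le_sum fun v _ => b1 v).trans (le_of_eq ?_)
    simp only [Finset.sum_add_distrib, Finset.sum_const, Finset.card_univ, hC.fcard, nsmul_eq_mul, ← Finset.sum_div]
    push_cast; ring
  have hs' : (∑ u, (J.degree u : ℝ)) = ∑ v, ((lg G C).degree v : ℝ) := by exact_mod_cast hsum
  rw [hs'] at lo2
  have fin : (∑ u, (J.degree u : ℝ) ^ 2) / ρ ^ 3 ≤ (∑ v, ((lg G C).degree v : ℝ) ^ 2) / ρ ^ 3 +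
        (t + 2) * t ^ 3 / (ρ ^ 3 * (ρ - t)) := by linarith
  have p2 : 0 < ρ - t := by linarith
  have fin2 : (∑ u, (J.degree u : ℝ) ^ 2) ≤ (∑ v, ((lg G C).degree v : ℝ) ^ 2) + (t + 2) * t ^ 3 / (ρ - t) := by
    have e : (∑ v, ((lg G C).degree v : ℝ) ^ 2) / ρ ^ 3 + (t + 2) * t ^ 3 / (ρ ^ 3 * (ρ - t)) =
      ((∑ v, ((lg G C).degree v : ℝ) ^ 2) + (t + 2) * t ^ 3 / (ρ - t)) / ρ ^ 3 := by field_simp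
    rw [e] at fin
    exact (div_le_div_iff_of_pos_right (by positivity)).1 fin
  have fin3 : (t + 2) * (t:ℝ) ^ 3 / (ρ - t) < 1 := by
    rw [div_lt_one p2]; linarith
  have fin4 : (∑ u, (J.degree u : ℝ) ^ 2) < (∑ v, ((lg G C).degree v : ℝ) ^ 2) + 1 := by linarith
  have : ∑ u, J.degree u ^ 2 < ∑ v, (lg G C).degree v ^ 2 + 1 := by exact_mod_cast fin4
  omega

end

theorem f1_deg {U : Type} [Fintype U] [DecidableEq U] {J : SimpleGraph U} [DecidableRel J.Adj] {t : ℕ} {f : U → Fin 5}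
    (h : F1 Jᶜ f) (hcard : Fintype.card U = t + 2) {p q : ℕ} (hp : (fib f 3).card = p) (hq : (fib f 4).card = q)
    (v : U) : J.degree v = (![q + 1, p + 1, 2, p + q, p + q] : Fin 5 → ℕ) (f v) := by
  have h1 := fib_sum f
  have h2 := pat_degree Jᶜ f c5 h.adj v
  rw [J.degree_compl, hcard] at h2
  have h3 := J.degree_lt_card_verts v
  rw [hcard] at h3 h1
  simp only [Fin.sum_univ_five, fib_card_one f 0 h.h0, fib_card_one f 1 h.h1, fib_card_one f 2 h.h2, hp, hq] at h1 h2
  have k5 : ∀ i : Fin 5, i = 0 ∨ i = 1 ∨ i = 2 ∨ i = 3 ∨ i = 4 := by decide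
  rcases k5 (f v) with k | k | k | k | k <;> rw [k] at h2 ⊢ <;> simp [c5] at h2 ⊢ <;> omega

theorem f1_sq {U : Type} [Fintype U] [DecidableEq U] {J : SimpleGraph U} [DecidableRel J.Adj] {t : ℕ} {f : U → Fin 5}
    (h : F1 Jᶜ f) (hcard : Fintype.card U = t + 2) {p q : ℕ} (hp : (fib f 3).card = p) (hq : (fib f 4).card = q) :
    ∑ v, J.degree v ^ 2 = (q + 1) ^ 2 + (p + 1) ^ 2 + 4 + (p + q) * (p + q) ^ 2 := by
  simp only [f1_deg h hcard hp hq]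
  rw [pat_sum f (fun i => (![q + 1, p + 1, 2, p + q, p + q] : Fin 5 → ℕ) i ^ 2)]
  simp [Fin.sum_univ_five, fib_card_one f 0 h.h0, fib_card_one f 1 h.h1, fib_card_one f 2 h.h2, hp, hq]
  ring

theorem f1_dsum {U : Type} [Fintype U] [DecidableEq U] {J : SimpleGraph U} [DecidableRel J.Adj] {t : ℕ} {f : U → Fin 5}
    (h : F1 Jᶜ f) (hcard : Fintype.card U = t + 2) (ht : 4 ≤ t) :
    ∑ v, J.degree v = t * (t - 1) + 4 := by
  have h1 := f1_sum _ hcard f h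
  have h2 := compl_sum J hcard
  have e : t * (t - 1) + 4 + (4 * t - 2) = (t + 2) * (t + 1) := by
    obtain ⟨k, rfl⟩ : ∃ k, t = k + 1 := ⟨t - 1, by omega⟩
    have : 4 * (k + 1) - 2 = 4 * k + 2 := by omega
    rw [this, Nat.add_sub_cancel]; ring
  omega

/-- model graph -/
def ml (p q : ℕ) : Fin 3 ⊕ (Fin p ⊕ Fin q) → Fin 5
  | Sum.inl i => Fin.castLE (by norm_num) i
  | Sum.inr (Sum.inl _) => 3
  | Sum.inr (Sum.inr _) => 4

def mg (p q : ℕ) : SimpleGraph (Fin 3 ⊕ (Fin p ⊕ Fin q)) where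
  Adj u v := c5 (ml p q u) (ml p q v) = true
  symm := ⟨fun u v h => by
    have k : ∀ i j, c5 i j = c5 j i := by decide
    rw [k]; exact h⟩
  loopless := ⟨fun u h => by
    have k : ∀ i, c5 i i = false := by decide
    rw [k] at h; exact absurd h (by decide)⟩

theorem mg_F1 (p q : ℕ) : F1 (mg p q) (ml p q) := by
  have key : ∀ i : Fin 3, ∃! v, ml p q v = Fin.castLE (by norm_num) i := by
    intro i
    refine ⟨Sum.inl i, rfl, ?_⟩
    rintro (j | j | j) hj
    · simp only [ml] at hj
      rw [Fin.castLE_injective _ hj]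
    · exfalso; simp only [ml] at hj; revert hj; revert i; decide
    · exfalso; simp only [ml] at hj; revert hj; revert i; decide
  exact ⟨fun u v => Iff.rfl, key 0, key 1, key 2⟩

theorem ml_fib3 (p q : ℕ) : (fib (ml p q) 3).card = p := by
  have : fib (ml p q) 3 = (Finset.univ : Finset (Fin p)).map
      (Function.Embedding.inl.trans (Function.Embedding.inr : (Fin p ⊕ Fin q) ↪ Fin 3 ⊕ (Fin p ⊕ Fin q))) := by
    ext v
    rw [mem_fib, Finset.mem_map]
    rcases v with i | i | i
    · simp only [ml]; constructor
      · intro h; exfalso; revert h; revert i; decide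
      · rintro ⟨a, -, h⟩; simp at h
    · simp [ml]
    · simp [ml]
  rw [this, Finset.card_map, Finset.card_univ, Fintype.card_fin]

theorem ml_fib4 (p q : ℕ) : (fib (ml p q) 4).card = q := by
  have : fib (ml p q) 4 = (Finset.univ : Finset (Fin q)).map
      (Function.Embedding.inr.trans (Function.Embedding.inr : (Fin p ⊕ Fin q) ↪ Fin 3 ⊕ (Fin p ⊕ Fin q))) := by
    ext v
    rw [mem_fib, Finset.mem_map]
    rcases v with i | i | i
    · simp only [ml]; constructor
      · intro h; exfalso; revert h; revert i; decide
      · rintro ⟨a, -, h⟩; simp at h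
    · simp [ml]
    · simp [ml]
  rw [this, Finset.card_map, Finset.card_univ, Fintype.card_fin]

end CT
open SimpleGraph

namespace CT

section
variable {V : Type} [Fintype V] [DecidableEq V] {s t : ℕ} {G : SimpleGraph V} {K R C : Finset V}

theorem c3_shape (hC : Cmp G K C t) (E : Ext s t G K R) {D : ℝ} {x : V → ℝ} (hx : Wts G K R (specRad G) D x)
    (hβ : 2 * (s + 1) ≤ t + 1) (hβ2 : t + 1 < 3 * (s + 1))
    (hρ : (t:ℝ) + (t + 2) * t ^ 3 < specRad G) :
    ∃ f, F1 (lg G C)ᶜ f ∧ (fib f 3).card = s ∧ (fib f 4).card = t - (s + 1) := by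
  classical
  have ht := E.ht
  have hs := E.hs
  have hρt : (t:ℝ) - 1 < specRad G := by
    have : (0:ℝ) ≤ (t + 2) * t ^ 3 := by positivity
    linarith
  obtain ⟨hsh, hsum⟩ := shapes hC E hx hρt
  have hfree := hC.free E
  have hU : Fintype.card (Fin 3 ⊕ (Fin s ⊕ Fin (t - (s + 1)))) = t + 2 := by
    simp; omega
  have hF : F1 ((mg s (t - (s+1)))ᶜ)ᶜ (ml s (t - (s+1))) := by rw [compl_compl]; exact mg_F1 _ _
  have hJ : Free (mg s (t - (s+1)))ᶜ s t := f1_free hF hU hs (by rw [ml_fib3]) (by rw [ml_fib4]; omega)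
    (by rw [ml_fib3, ml_fib4]; omega)
  have hsq := sq_bound hC E hx hU _ hJ (by rw [f1_dsum hF hU ht, hsum]) hρ
  rw [f1_sq hF hU (ml_fib3 _ _) (ml_fib4 _ _)] at hsq
  rcases hsh with ⟨f, h⟩ | ⟨f, h⟩ | ⟨h, ⟨e⟩⟩
  · obtain ⟨h3, h4, h34⟩ := f1_sizes (lg G C) hC.fcard hfree f h
    rw [f1_sq h hC.fcard rfl rfl] at hsq
    by_cases e3 : (fib f 3).card = s
    · exact ⟨f, h, e3, by omega⟩
    by_cases e4 : (fib f 4).card = s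
    · exact ⟨_, h.swap, by rw [fib_swap]; exact e4, by rw [fib_swap]; show (fib f 3).card = _; omega⟩
    exfalso
    generalize (fib f 3).card = p at *
    generalize (fib f 4).card = q at *
    obtain ⟨i, rfl⟩ : ∃ i, p = s + 1 + i := ⟨p - (s + 1), by omega⟩
    obtain ⟨j, rfl⟩ : ∃ j, q = s + 1 + j := ⟨q - (s + 1), by omega⟩
    have e5 : t - (s + 1) = s + 2 + i + j := by omega
    rw [e5] at hsq
    have e6 : s + (s + 2 + i + j) = s + 1 + i + (s + 1 + j) := by ring
    rw [e6] at hsq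
    nlinarith
  · have := f2_sizes (lg G C) hC.fcard hfree f h
    omega
  · exfalso
    have hd : ∀ v, (lg G C).degree v = 6 := by
      intro v
      have h1 := pet_deg _ e v
      have h2 := (lg G C).degree_lt_card_verts v
      rw [degree_compl, hC.fcard] at h1
      rw [hC.fcard] at h2
      omega
    simp only [hd, Finset.sum_const, Finset.card_univ, hC.fcard] at hsq
    obtain rfl : s = 3 := by omega
    subst h
    revert hsq
    decide

end

def HG (m s α : ℕ) : SimpleGraph ((Fin m × (Fin 1 ⊕ Fin s)) ⊕ (Fin 1 ⊕ Fin α)) :=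
  gUnion (copies m (starG s)) (starG α)

def hl (s α : ℕ) : ((Fin 1 × (Fin 1 ⊕ Fin s)) ⊕ (Fin 1 ⊕ Fin α)) → Fin 5
  | Sum.inl (_, Sum.inl _) => 0
  | Sum.inl (_, Sum.inr _) => 3
  | Sum.inr (Sum.inl _) => 1
  | Sum.inr (Sum.inr _) => 4

theorem hg_adj (s α : ℕ) (a b) : (HG 1 s α).Adj a b ↔ c5b (hl s α a) (hl s α b) = true := by
  rcases a with ⟨i, i' | i'⟩ | i' | i' <;> rcases b with ⟨j, j' | j'⟩ | j' | j' <;>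
    simp [HG, gUnion, copies, starG, hl, c5b, eq_iff_true_of_subsingleton]

def hu (s α : ℕ) : ((Fin 1 × (Fin 1 ⊕ Fin s)) ⊕ (Fin 1 ⊕ Fin α)) := Sum.inl (0, Sum.inl 0)
def hv (s α : ℕ) : ((Fin 1 × (Fin 1 ⊕ Fin s)) ⊕ (Fin 1 ⊕ Fin α)) := Sum.inr (Sum.inl 0)

theorem hl_u (s α : ℕ) (a) : hl s α a = 0 ↔ a = hu s α := by
  rcases a with ⟨i, i' | i'⟩ | i' | i' <;> simp [hl, hu] <;> exact ⟨Subsingleton.elim _ _, Subsingleton.elim _ _⟩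

theorem hl_v (s α : ℕ) (a) : hl s α a = 1 ↔ a = hv s α := by
  rcases a with ⟨i, i' | i'⟩ | i' | i' <;> simp [hl, hv]
  exact Subsingleton.elim _ _

theorem hl_2 (s α : ℕ) (a) : hl s α a ≠ 2 := by
  rcases a with ⟨i, i' | i'⟩ | i' | i' <;> simp [hl]

theorem hl_fib3 (s α : ℕ) : (fib (hl s α) 3).card = s := by
  have : fib (hl s α) 3 = (Finset.univ : Finset (Fin s)).image (fun i => Sum.inl (0, Sum.inr i)) := by
    ext v
    rw [mem_fib, Finset.mem_image]
    rcases v with ⟨i, i' | i'⟩ | i' | i' <;> simp [hl]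
    exact Subsingleton.elim _ _
  rw [this, Finset.card_image_of_injective, Finset.card_univ, Fintype.card_fin]
  intro i j h
  simpa using h

theorem hl_fib4 (s α : ℕ) : (fib (hl s α) 4).card = α := by
  have : fib (hl s α) 4 = (Finset.univ : Finset (Fin α)).image (fun i => Sum.inr (Sum.inr i)) := by
    ext v
    rw [mem_fib, Finset.mem_image]
    rcases v with ⟨i, i' | i'⟩ | i' | i' <;> simp [hl]
  rw [this, Finset.card_image_of_injective, Finset.card_univ, Fintype.card_fin]
  intro i j h
  simpa using h

theorem deg_eq {V : Type} [Fintype V] (G : SimpleGraph V) [DecidableRel G.Adj] (v : V) : deg G v = G.degree v := by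
  rw [deg, Set.ncard_eq_toFinset_card']; rfl

theorem hg_deg (s α : ℕ) (a) :
    deg (HG 1 s α)ᶜ a = (![α + 1, s + 1, 0, s + α, s + α] : Fin 5 → ℕ) (hl s α a) := by
  classical
  rw [deg_eq, degree_compl, pat_degree (HG 1 s α) (hl s α) c5b (hg_adj s α) a]
  have hc : Fintype.card ((Fin 1 × (Fin 1 ⊕ Fin s)) ⊕ (Fin 1 ⊕ Fin α)) = s + α + 2 := by simp; ring
  have e0 : (fib (hl s α) 0).card = 1 := fib_card_one _ _ ⟨hu s α, rfl, fun w h => (hl_u s α w).1 h⟩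
  have e1 : (fib (hl s α) 1).card = 1 := fib_card_one _ _ ⟨hv s α, rfl, fun w h => (hl_v s α w).1 h⟩
  simp only [hc, Fin.sum_univ_five, e0, e1, hl_fib3, hl_fib4]
  have k5 : ∀ i : Fin 5, i = 0 ∨ i = 1 ∨ i = 2 ∨ i = 3 ∨ i = 4 := by decide
  rcases k5 (hl s α a) with k | k | k | k | k
  · rw [k]; simp [c5b]; omega
  · rw [k]; simp [c5b]; omega
  · exact absurd k (hl_2 s α a)
  · rw [k]; simp [c5b]
  · rw [k]; simp [c5b]

def sl (s α : ℕ) : ((Fin 1 × (Fin 1 ⊕ Fin s)) ⊕ (Fin 1 ⊕ Fin α)) ⊕ Fin 1 → Fin 5 :=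
  Sum.elim (hl s α) (fun _ => 2)

theorem sub_adj (s α : ℕ) (x y) : (subdividePath (HG 1 s α)ᶜ (hu s α) (hv s α) 1).Adj x y ↔
    x ≠ y ∧ c5 (sl s α x) (sl s α y) = false := by
  have kk : ∀ i j : Fin 5, i ≠ 2 → j ≠ 2 → (c5 i j = false ↔ c5b i j = false ∧ ¬ (i = 0 ∧ j = 1) ∧ ¬ (i = 1 ∧ j = 0)) := by
    decide
  have k2 : ∀ i : Fin 5, i ≠ 2 → (c5 i 2 = false ↔ i = 0 ∨ i = 1) := by decide
  have k2' : ∀ i : Fin 5, i ≠ 2 → (c5 2 i = false ↔ i = 0 ∨ i = 1) := by decide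
  have ksym : ∀ i j, c5b i j = c5b j i := by decide
  rcases x with a | i <;> rcases y with b | j
  · simp only [subdividePath, fromRel_adj, sl, Sum.elim_inl]
    rw [kk _ _ (hl_2 s α a) (hl_2 s α b), hl_u, hl_v, hl_u, hl_v]
    simp only [compl_adj, hg_adj]
    constructor
    · rintro ⟨h1, h2⟩
      refine ⟨h1, ?_⟩
      rcases h2 with (⟨a', b', ha, hb, h3, h4, h5⟩ | ⟨_, _, h, _⟩ | ⟨_, _, h, _⟩ | ⟨_, h, _⟩) | (⟨a', b', ha, hb, h3, h4, h5⟩ | ⟨_, _, h, _⟩ | ⟨_, _, h, _⟩ | ⟨_, h, _⟩)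
      · cases ha; cases hb
        exact ⟨by simpa using h3.2, h4, h5⟩
      · cases h
      · cases h
      · cases h
      · cases ha; cases hb
        refine ⟨by rw [ksym]; simpa using h3.2, fun h => h5 h.symm, fun h => h4 h.symm⟩
      · cases h
      · cases h
      · cases h
    · rintro ⟨h1, h2, h3, h4⟩
      refine ⟨h1, Or.inl (Or.inl ⟨a, b, rfl, rfl, ⟨fun e => h1 (by rw [e]), by rw [h2]; decide⟩, h3, h4⟩)⟩
  · simp only [subdividePath, fromRel_adj, sl, Sum.elim_inl, Sum.elim_inr]
    rw [k2 _ (hl_2 s α a), hl_u, hl_v]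
    simp
  · simp only [subdividePath, fromRel_adj, sl, Sum.elim_inl, Sum.elim_inr]
    rw [k2' _ (hl_2 s α b), hl_u, hl_v]
    simp [or_comm]
  · rw [Subsingleton.elim i j]
    simp

theorem target_iso (s α : ℕ) (hs : 1 ≤ s) (hα : 1 ≤ α) {V : Type} [Fintype V] [DecidableEq V] (H : SimpleGraph V)
    (f : V → Fin 5) (h : F1 Hᶜ f) (h3 : (fib f 3).card = s) (h4 : (fib f 4).card = α) :
    ∃ u v, (HG 1 s α)ᶜ.Adj u v ∧
            (∀ a b, (HG 1 s α)ᶜ.Adj a b →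
              deg (HG 1 s α)ᶜ u + deg (HG 1 s α)ᶜ v ≤ deg (HG 1 s α)ᶜ a + deg (HG 1 s α)ᶜ b) ∧
            Nonempty (H ≃g subdividePath (HG 1 s α)ᶜ u v 1) := by
  have huv : hu s α ≠ hv s α := by simp [hu, hv]
  have lu : hl s α (hu s α) = 0 := rfl
  have lv : hl s α (hv s α) = 1 := rfl
  refine ⟨hu s α, hv s α, ?_, ?_, ?_⟩
  · rw [compl_adj, hg_adj, lu, lv]
    exact ⟨huv, by decide⟩
  · intro a b hab
    have hne : a ≠ b := hab.ne
    simp only [hg_deg, lu, lv]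
    have k5 : ∀ i : Fin 5, i = 0 ∨ i = 1 ∨ i = 2 ∨ i = 3 ∨ i = 4 := by decide
    have n0 : ¬ (hl s α a = 0 ∧ hl s α b = 0) := by
      rintro ⟨h1, h2⟩; rw [hl_u] at h1 h2; exact hne (h1.trans h2.symm)
    have n1 : ¬ (hl s α a = 1 ∧ hl s α b = 1) := by
      rintro ⟨h1, h2⟩; rw [hl_v] at h1 h2; exact hne (h1.trans h2.symm)
    have n2 := hl_2 s α a
    have n3 := hl_2 s α b
    rcases k5 (hl s α a) with k | k | k | k | k <;> rcases k5 (hl s α b) with k' | k' | k' | k' | k' <;>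
      rw [k] at n0 n1 n2 <;> rw [k'] at n0 n1 n3 <;> rw [k, k'] <;> simp at n0 n1 n2 n3 ⊢ <;> omega
  · have e0 : (fib (sl s α) 0).card = 1 := fib_card_one _ _ ⟨Sum.inl (hu s α), rfl, by
      rintro (w | w) h
      · rw [(hl_u s α w).1 h]
      · exact absurd h (by simp [sl])⟩
    have e1 : (fib (sl s α) 1).card = 1 := fib_card_one _ _ ⟨Sum.inl (hv s α), rfl, by
      rintro (w | w) h
      · rw [(hl_v s α w).1 h]
      · exact absurd h (by simp [sl])⟩
    have e2 : (fib (sl s α) 2).card = 1 := fib_card_one _ _ ⟨Sum.inr 0, rfl, by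
      rintro (w | w) h
      · exact absurd h (hl_2 s α w)
      · rw [Subsingleton.elim w 0]⟩
    have em : ∀ i, i ≠ 2 → fib (sl s α) i = (fib (hl s α) i).map Function.Embedding.inl := by
      intro i hi
      ext v
      rw [mem_fib, Finset.mem_map]
      rcases v with w | w
      · simp [sl, mem_fib]
      · simp [sl, hi.symm]
    have e3 : (fib (sl s α) 3).card = s := by rw [em 3 (by decide), Finset.card_map, hl_fib3]
    have e4 : (fib (sl s α) 4).card = α := by rw [em 4 (by decide), Finset.card_map, hl_fib4]
    obtain ⟨e, he⟩ := fiber_equiv f (sl s α) (by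
      intro i
      have k5 : ∀ i : Fin 5, i = 0 ∨ i = 1 ∨ i = 2 ∨ i = 3 ∨ i = 4 := by decide
      rcases k5 i with rfl | rfl | rfl | rfl | rfl
      · rw [e0, fib_card_one f 0 h.h0]
      · rw [e1, fib_card_one f 1 h.h1]
      · rw [e2, fib_card_one f 2 h.h2]
      · rw [e3, h3]
      · rw [e4, h4])
    refine ⟨⟨e, ?_⟩⟩
    intro a b
    rw [sub_adj, he, he, h.hadj]
    simp

end CT
open SimpleGraph

namespace CT

/-- passing from a connected component to a finite vertex set -/
theorem comp_data {V : Type} [Fintype V] [DecidableEq V] {G : SimpleGraph V} {K : Finset V} {t : ℕ}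
    (c : (G.comap (Subtype.val : {v : V // v ∉ K} → V)).ConnectedComponent) (hc : c.supp.ncard = t + 2) :
    ∃ C : Finset V, Cmp G K C t ∧
      Nonempty ((G.comap (Subtype.val : {v : V // v ∉ K} → V)).induce c.supp ≃g lg G C) := by
  classical
  let C : Finset V := Finset.univ.filter (fun v => ∃ h : v ∉ K, (⟨v, h⟩ : {v : V // v ∉ K}) ∈ c.supp)
  have hmem : ∀ v, v ∈ C ↔ ∃ h : v ∉ K, (⟨v, h⟩ : {v : V // v ∉ K}) ∈ c.supp := by
    intro v; simp [C]
  let e : c.supp ≃ {v // v ∈ C} :=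
    { toFun := fun v => ⟨v.1.1, (hmem _).2 ⟨v.1.2, v.2⟩⟩
      invFun := fun v => ⟨⟨v.1, ((hmem _).1 v.2).1⟩, ((hmem _).1 v.2).2⟩
      left_inv := fun v => rfl
      right_inv := fun v => rfl }
  let i : (G.comap (Subtype.val : {v : V // v ∉ K} → V)).induce c.supp ≃g lg G C :=
    ⟨e, Iff.rfl⟩
  refine ⟨C, ⟨?_, ?_, ?_, ?_⟩, ⟨i⟩⟩
  · intro v hv; exact ((hmem v).1 hv).1
  · intro u hu w hw huw
    obtain ⟨h1, h2⟩ := (hmem u).1 hu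
    refine (hmem w).2 ⟨hw, ?_⟩
    rw [ConnectedComponent.mem_supp_iff] at h2 ⊢
    rw [← h2]
    exact ConnectedComponent.sound
      (Adj.reachable (G := G.comap (Subtype.val : {v : V // v ∉ K} → V)) (u := ⟨w, hw⟩) (v := ⟨u, h1⟩) huw.symm)
  · have := c.connected_toSimpleGraph
    exact i.connected_iff.1 this
  · rw [← hc, ← Nat.card_coe_set_eq, Nat.card_congr e, Nat.card_eq_fintype_card, Fintype.card_coe]

def Bd (t : ℕ) : ℕ := t * ((k0 t + 1) * t * t + 8) + (t + (t + 2) * t ^ 3) + 1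

theorem main (s t : ℕ) (ht : 4 ≤ t) (hs : 2 ≤ s) (hst : s ≤ t) {n : ℕ} (hn : Bd t ^ 2 + 2 + N0 t + s ≤ n)
    (G : SimpleGraph (Fin n)) (K : Finset (Fin n))
    (hfree : ¬ MinorOf (completeBipartiteGraph (Fin s) (Fin t)) G)
    (hmax : ∀ G' : SimpleGraph (Fin n),
        ¬ MinorOf (completeBipartiteGraph (Fin s) (Fin t)) G' → specRad G' ≤ specRad G)
    (hKc : K.card = s - 1) (hKq : G.IsClique (↑K : Set (Fin n)))
    (hKd : ∀ v : Fin n, v ∉ K → ∀ u ∈ K, G.Adj u v)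
    {C : Finset (Fin n)} (hC : Cmp G K C t) :
    t + 1 < 3 * (s + 1) ∧
    (2 * (s + 1) ≤ t + 1 → ∃ f, F1 (lg G C)ᶜ f ∧ (fib f 3).card = s ∧ (fib f 4).card = t - (s + 1)) ∧
    (t + 1 < 2 * (s + 1) → t = 8 ∧ Nonempty ((lg G C)ᶜ ≃g petersen)) := by
  classical
  have E : Ext s t G K (Finset.univ \ K) := ⟨ht, hs, hst, hKc, ⟨hKq, hKd⟩, hfree, hmax, fun v => by simp⟩
  have hcardn : Fintype.card (Fin n) = n := Fintype.card_fin n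
  have hρ : (Bd t : ℝ) ≤ specRad G := by
    refine le_trans ?_ (rho_lower E.dom E.ne (by rw [hcardn]; omega))
    apply Real.le_sqrt_of_sq_le
    rw [hcardn]
    have : ((Bd t ^ 2 + 1 : ℕ) : ℝ) ≤ n := by exact_mod_cast (by omega : Bd t ^ 2 + 1 ≤ n)
    push_cast at this
    linarith
  have hBd : (Bd t : ℝ) = t * ((k0 t + 1) * t * t + 8) + (t + (t + 2) * t ^ 3) + 1 := by
    rw [Bd]; push_cast; ring
  have p1 : (0:ℝ) ≤ t * ((k0 t + 1) * t * t + 8) := by positivity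
  have p2 : (0:ℝ) ≤ (t + 2) * (t:ℝ) ^ 3 := by positivity
  have htR : (4:ℝ) ≤ t := by exact_mod_cast ht
  have hρ1 : (t:ℝ) - 1 < specRad G := by linarith
  obtain ⟨x, hx⟩ := exists_wts E.hR E.dom E.ne (D := (t:ℝ) - 1) (by linarith) E.deg_le hρ1
  have hβ3 : t + 1 < 3 * (s + 1) := by
    by_contra hcon
    exact c2_false hC E hx (by omega) (by rw [hcardn]; omega) (by linarith)
  refine ⟨hβ3, fun hβ => c3_shape hC E hx hβ hβ3 (by linarith), fun hβ => ?_⟩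
  obtain ⟨hsh, -⟩ := shapes hC E hx hρ1
  have hf := hC.free E
  rcases hsh with ⟨f, h⟩ | ⟨f, h⟩ | h
  · have := f1_sizes (lg G C) hC.fcard hf f h
    omega
  · have := f2_sizes (lg G C) hC.fcard hf f h
    omega
  · exact h

theorem target_gen (s m α : ℕ) (hm : m = 1) (hs : 1 ≤ s) (hα : 1 ≤ α) {V : Type} [Fintype V] [DecidableEq V]
    (H : SimpleGraph V)
    (f : V → Fin 5) (h : F1 Hᶜ f) (h3 : (fib f 3).card = s) (h4 : (fib f 4).card = α) :
    ∃ u v, (HG m s α)ᶜ.Adj u v ∧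
            (∀ a b, (HG m s α)ᶜ.Adj a b →
              deg (HG m s α)ᶜ u + deg (HG m s α)ᶜ v ≤ deg (HG m s α)ᶜ a + deg (HG m s α)ᶜ b) ∧
            Nonempty (H ≃g subdividePath (HG m s α)ᶜ u v 1) := by
  subst hm
  exact target_iso s α hs hα H f h h3 h4

end CT

/-- Theorem 3.2: (t+2)-vertex components of G⋆ − K. -/
theorem component_t_plus_two (s t : ℕ) (ht : 4 ≤ t) (hs : 2 ≤ s) (hst : s ≤ t) :
    ∃ n₀ : ℕ, ∀ n : ℕ, n₀ ≤ n →
    ∀ (G : SimpleGraph (Fin n)) (K : Finset (Fin n)),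
      ¬ MinorOf (completeBipartiteGraph (Fin s) (Fin t)) G →
      (∀ G' : SimpleGraph (Fin n),
        ¬ MinorOf (completeBipartiteGraph (Fin s) (Fin t)) G' → specRad G' ≤ specRad G) →
      K.card = s - 1 → G.IsClique (↑K : Set (Fin n)) →
      (∀ v : Fin n, v ∉ K → ∀ u ∈ K, G.Adj u v) →
      ∀ c : (G.comap (Subtype.val : {v : Fin n // v ∉ K} → Fin n)).ConnectedComponent,
        c.supp.ncard = t + 2 →
        (t+1)/(s+1) ≤ 2 ∧
        ((t+1)/(s+1) = 2 →
          ∃ u v, (Hst s t)ᶜ.Adj u v ∧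
            (∀ a b, (Hst s t)ᶜ.Adj a b →
              deg (Hst s t)ᶜ u + deg (Hst s t)ᶜ v ≤ deg (Hst s t)ᶜ a + deg (Hst s t)ᶜ b) ∧
            Nonempty ((G.comap (Subtype.val : {v : Fin n // v ∉ K} → Fin n)).induce c.supp ≃g
              subdividePath (Hst s t)ᶜ u v 1)) ∧
        ((t+1)/(s+1) = 1 →
          t = 8 ∧
          Nonempty ((G.comap (Subtype.val : {v : Fin n // v ∉ K} → Fin n)).induce c.supp ≃g
            petersenᶜ)) := by
  refine ⟨CT.Bd t ^ 2 + 2 + CT.N0 t + s, ?_⟩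
  intro n hn G K hfree hmax hKc hKq hKd c hc
  obtain ⟨C, hC, ⟨i⟩⟩ := CT.comp_data c hc
  obtain ⟨m1, m2, m3⟩ := CT.main s t ht hs hst hn G K hfree hmax hKc hKq hKd hC
  refine ⟨?_, ?_, ?_⟩
  · have : (t + 1) / (s + 1) < 3 := (Nat.div_lt_iff_lt_mul (by omega)).2 m1
    omega
  · intro hβ
    have h2 : 2 * (s + 1) ≤ t + 1 := (Nat.le_div_iff_mul_le (by omega)).1 hβ.ge
    obtain ⟨f, hf, f3, f4⟩ := m2 h2
    have hm : (t+1)/(s+1) - 1 = 1 := by omega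
    obtain ⟨u, v, h1, h2', ⟨j⟩⟩ := CT.target_gen s ((t+1)/(s+1) - 1) (t - ((t+1)/(s+1) - 1) * (s+1)) hm (by omega)
      (by rw [hm]; omega) (CT.lg G C) f hf f3 (by rw [hm, one_mul]; exact f4)
    exact ⟨u, v, h1, h2', ⟨i.trans j⟩⟩
  · intro hβ
    have : t + 1 < 2 * (s + 1) := (Nat.div_lt_iff_lt_mul (by omega)).1 (by omega)
    obtain ⟨h8, ⟨j⟩⟩ := m3 this
    refine ⟨h8, ⟨i.trans ⟨j.toEquiv, ?_⟩⟩⟩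
    intro a b
    have h1 := j.map_rel_iff (a := a) (b := b)
    have h2 : j a = j b ↔ a = b := j.injective.eq_iff
    rw [SimpleGraph.compl_adj] at h1 ⊢
    change ¬ (j a = j b) ∧ ¬ petersen.Adj (j a) (j b) ↔ _
    rw [h2, h1]
    constructor
    · rintro ⟨h3, h4⟩
      by_contra h5
      exact h4 ⟨h3, h5⟩
    · exact fun h => ⟨h.ne, fun h5 => h5.2 h⟩
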